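/- **Data schemas.** A data schema $D=\langle Cat,CType,Repo,X\rangle$ over a set of types (some of them identifier types; each type has a set of constant objects, one of them $\mathsf{undef}$) consists of: a finite catalog $Cat$ of read-only relations, each having a primary key whose identifier type is not shared with another relation, and further attributes, where an attribute of identifier type is a foreign key referring to a catalog relation; a case identifier type $CType$, which is no key type of the catalog; a finite repository $Repo$ of updatable relations; a finite set $X$ of typed case variables, containing $\mathsf{self}$ of type $CType$. A *conjunctive query with filters* is a conjunction of possibly negated atoms $t=u$ and $R(t_1,\dots,t_m)$ with $R$ in the catalog or the repository, whose terms are (normal) variables, case variables and constant objects. A *guard* $q(\vec x)\leftarrow\bigvee_{i=1}^n Q_i$ has conjunctive queries with filters $Q_i$, each containing all answer variables $\vec x$; it is *boolean* if $\vec x$ is empty, and *repo-free* if it has no repository atom. It is *separated* if distinct disjuncts have no normal variable in common and each $Q_i$ has, up to the order of conjuncts, the form $\chi\wedge R(\vec y)\wedge\xi$ (each part optional), where $R$ is a repository relation, $\chi$ and $\xi$ have no repository atom, $\vec y$ and $\xi$ contain no case variable, and $\chi$ shares no normal variable with $\vec y$ or $\xi$. **Update specifications.** An update specification $u$ is a pair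 of a guard $pre(u)$ and an effect $eff(u)$ of one of the forms: (insert&set) $\mathrm{INSERT}\ \vec u\ \mathrm{INTO}\ R\ \mathrm{AND\ SET}\ x_1=v_1,\dots,x_m=v_m$; (set) the same without the INSERT part; (delete&set) $\mathrm{DEL}\ \vec u\ \mathrm{FROM}\ R\ \mathrm{AND\ SET}\ x_1=v_1,\dots,x_m=v_m$; (conditional update) $\mathrm{UPDATE}\ R(\vec v)\ \mathrm{IF}\ \psi\ \mathrm{THEN}\ \eta_1\ \mathrm{ELSE}\ \eta_2$, which replaces every tuple $\vec v$ of $R$ as prescribed by possibly nested conditionals with repo-free filters. Here $R$ is a repository relation, the $x_i$ are distinct case variables other than $\mathsf{self}$, possibly none, and $\vec u,v_i$ are answer variables of $pre(u)$ or constant objects. Call $u$ *isolated* if each disjunct $Q$ of $pre(u)$ can be written in the form $\chi\wedge R(\vec y)\wedge\xi$ of a separated guard in such a way that no variable of $\chi$ occurs in $eff(u)$ and, if $eff(u)$ deletes a tuple $\vec u$ from a relation $R'$, then $Q$ has no repository atom or its repository atom is $R'(\vec u)$. **DABs.** A DAB $M=\langle D,P\rangle$ consists of a data schema and a block-structured BPMN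 process $P$, built from empty blocks, tasks, events, processes, subprocesses, sequences, possible completions, deferred, exclusive, inclusive and event-driven choices, parallel blocks, loops, and backward, forward and non-interrupting exception handlers, with update specifications attached to tasks and events and boolean conditions attached to choices; every case has a lifecycle state for each block. It is *acyclic* if the graph with nodes $\langle R,a\rangle$ ($R$ a catalog relation, $a$ an attribute of $R$) and with edges from $\langle R,key\rangle$ to $\langle R,a\rangle$ for the other attributes $a$ of $R$, and from $\langle R,a\rangle$ to $\langle R',key\rangle$ if $a$ is a foreign key referring to $R'$, has no directed cycle. It is *case-bounded* if at most $k$ cases can be created, for some fixed $k$. A *property* over $n$ cases is a conjunction of guards $G_1,\dots,G_n$, to be satisfied by $n$ distinct cases, which may also query the lifecycle states of the blocks, and in which each normal variable also occurs in a repository atom of the same guard; it is *separated* if all $G_i$ are. **BackReach.** $M$ with bound $k$ is translated into the array-based system with: a unary function symbol $f_{R,a}$ for each non-key attribute $a$ of a catalog relation $R$ (the atom $R(t_0,\vec t)$ becomes $t_0\ne\mathsf{undef}\wedge\bigwedge_a t_a=f_{R,a}(t_0)$); one variable for each of the $k$ cases and each case variable or lifecycle; one array for each attribute of a repository relation; initially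 the repository is empty, all case variables but $\mathsf{self}$ are undefined and all lifecycles are idle. Under the *multiset insertion semantics* an insertion writes the tuple to some empty row. The theory $T$ consists of the axioms $\forall x\,(x=\mathsf{undef}\leftrightarrow f_{R,a}(x)=\mathsf{undef})$ and of $c\neq d$ for an arbitrary chosen set of pairs of constants. Let $T^*$ be a model completion of $T$. $\mathsf{BackReach}$ starts with a state formula $\phi$ (a formula $\exists\vec e\,\phi_0$ with index variables $\vec e$ and $\phi_0$ quantifier-free) that expresses the property, and with $B=\bot$; while $\phi\wedge\neg B$ is $T$-satisfiable, it returns *unsafe* if $\iota\wedge\phi$ is $T$-satisfiable, where $\iota$ is the initial formula, and otherwise replaces $B$ by $\phi\vee B$ and $\phi$ by a state formula that is $T^*$-equivalent to the preimage of $\phi$ under the transitions. It *terminates* if $T^*$ exists, the property and all preimages of state formulae have such state formulae, and the loop ends after finitely many iterations, whichever model completion and whichever of these formulae are chosen. **Theorem.** Let $M$ be a case-bounded (with any bound $k$), acyclic DAB using the multiset insertion semantics such that every update specification $u$ of $M$ satisfies: (i) if $eff(u)$ is an insert&set rule with an explicit INSERT part, then $pre(u)$ is repo-free; (ii) if $eff(u)$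 is a pure set rule, then either $pre(u)$ is repo-free, or $pre(u)$ is separated, $u$ is isolated, and all case variables other than $\mathsf{self}$ appear in the SET part of $eff(u)$; (iii) if $eff(u)$ is a delete&set rule, then $pre(u)$ is separated, $u$ is isolated, and all case variables other than $\mathsf{self}$ appear in the SET part of $eff(u)$; (iv) if $eff(u)$ is a conditional update rule, then $pre(u)$ is repo-free and boolean, and $eff(u)$ only uses the new variables introduced in its UPDATE part together with constant objects. Then $\mathsf{BackReach}$ terminates when verifying separated properties over $M$. -/

import Mathlib

/-!
# Data-aware BPMN models, array-based artifact systems and backward reachability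

The file has three parts: relational artifact systems (RAS) and their backward reachability
procedure; data-aware BPMN models (DABs); the translation of DABs into RASs.
-/

noncomputable section

open Classical

namespace RAS

/-! ## Database signatures, first-order formulae, model completions -/

/-- A multi-sorted signature with equality, unary functions and constants only; every sort has a
constant `undef`. -/
structure Signature where
  Srt : Type
  Fn : Type
  src : Fn → Srt
  tgt : Fn → Srt
  Cst : Srt → Type
  undef : ∀ S, Cst S

/-- Terms over a sorted family of variables. -/
inductive Term (σ : Signature) (V : σ.Srt → Type) : σ.Srt → Type
  | var {S : σ.Srt} (v : V S) : Term σ V S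
  | cst {S : σ.Srt} (c : σ.Cst S) : Term σ V S
  | app (f : σ.Fn) (t : Term σ V (σ.src f)) : Term σ V (σ.tgt f)

/-- Structures for a signature. -/
structure Struct (σ : Signature) where
  Dom : σ.Srt → Type
  fn : ∀ f, Dom (σ.src f) → Dom (σ.tgt f)
  cst : ∀ {S : σ.Srt}, σ.Cst S → Dom S

def Term.eval {σ : Signature} {V : σ.Srt → Type} (𝔄 : Struct σ) (v : ∀ S, V S → 𝔄.Dom S) :
    {S : σ.Srt} → Term σ V S → 𝔄.Dom S
  | _, .var x => v _ x
  | _, .cst c => 𝔄.cst c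
  | _, .app f t => 𝔄.fn f (t.eval 𝔄 v)

/-- First-order formulae; each sort has the variables `0, 1, 2, …`. -/
inductive Formula (σ : Signature) : Type
  | eq {S : σ.Srt} (t u : Term σ (fun _ => ℕ) S) : Formula σ
  | neg (φ : Formula σ) : Formula σ
  | and (φ ψ : Formula σ) : Formula σ
  | all (S : σ.Srt) (n : ℕ) (φ : Formula σ) : Formula σ

def Formula.Realize {σ : Signature} (𝔄 : Struct σ) :
    Formula σ → (∀ S, ℕ → 𝔄.Dom S) → Prop
  | .eq t u, v => t.eval 𝔄 v = u.eval 𝔄 v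
  | .neg φ, v => ¬ φ.Realize 𝔄 v
  | .and φ ψ, v => φ.Realize 𝔄 v ∧ ψ.Realize 𝔄 v
  | .all S n φ, v => ∀ d : 𝔄.Dom S,
      φ.Realize 𝔄 (Function.update v S (Function.update (v S) n d))

def Formula.QuantifierFree {σ : Signature} : Formula σ → Prop
  | .eq _ _ => True
  | .neg φ => φ.QuantifierFree
  | .and φ ψ => φ.QuantifierFree ∧ ψ.QuantifierFree
  | .all _ _ _ => False

/-- Truth of all members of a theory; their free variables are read universally. -/
def Struct.Models {σ : Signature} (𝔄 : Struct σ) (T : Set (Formula σ)) : Prop :=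
  ∀ φ ∈ T, ∀ v, φ.Realize 𝔄 v

/-- `Ts` is a model completion of the universal theory `T`: it extends `T`, quantifier-free
formulae satisfiable in models of `T` are satisfiable in models of `Ts`, and `Ts` eliminates
quantifiers. -/
def IsModelCompletion {σ : Signature} (T Ts : Set (Formula σ)) : Prop :=
  T ⊆ Ts ∧
  (∀ φ : Formula σ, φ.QuantifierFree →
    (∃ 𝔄 : Struct σ, 𝔄.Models T ∧ ∃ v, φ.Realize 𝔄 v) →
      ∃ 𝔄 : Struct σ, 𝔄.Models Ts ∧ ∃ v, φ.Realize 𝔄 v) ∧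
  ∀ φ : Formula σ, ∃ ψ : Formula σ, ψ.QuantifierFree ∧
    ∀ 𝔄 : Struct σ, 𝔄.Models Ts → ∀ v, φ.Realize 𝔄 v ↔ ψ.Realize 𝔄 v

/-- The axiom `x = undef ↔ f x = undef`. -/
def nullAxiom {σ : Signature} (f : σ.Fn) : Formula σ :=
  let p : Formula σ := .eq (.var 0) (.cst (σ.undef (σ.src f)))
  let q : Formula σ := .eq (.app f (.var 0)) (.cst (σ.undef (σ.tgt f)))
  .and (.neg (.and p (.neg q))) (.neg (.and q (.neg p)))

/-- The database theory: the axioms for `undef`, together with `c ≠ d` for the pairs of constants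
listed in `Δ`. -/
def dbTheory (σ : Signature) (Δ : ∀ S, σ.Cst S → σ.Cst S → Prop) : Set (Formula σ) :=
  {φ | (∃ f, φ = nullAxiom f) ∨
    ∃ S, ∃ c d : σ.Cst S, Δ S c d ∧ φ = .neg (.eq (.cst c) (.cst d))}

/-! ## Artifact settings, states and formulae -/

/-- An artifact setting: sorted artifact variables, artifact sorts, and artifact components
(arrays) from an artifact sort to a basic sort. -/
structure Setting (σ : Signature) where
  AVar : Type
  avSort : AVar → σ.Srt
  ASort : Type
  Comp : Type
  src : Comp → ASort
  tgt : Comp → σ.Srt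

variable {σ : Signature}

/-- The atomic terms available in formulae: variables of basic sorts `V`, artifact variables, and
array reads `a[i]`, where `i` is an index variable from `I`. -/
inductive Cell (A : Setting σ) (V : σ.Srt → Type) (I : A.ASort → Type) : σ.Srt → Type
  | bas {S : σ.Srt} (v : V S) : Cell A V I S
  | art (x : A.AVar) : Cell A V I (A.avSort x)
  | read (a : A.Comp) (i : I (A.src a)) : Cell A V I (A.tgt a)

abbrev ATerm (A : Setting σ) (V : σ.Srt → Type) (I : A.ASort → Type) (S : σ.Srt) : Type :=
  Term σ (Cell A V I) S

/-- Quantifier-free formulae over an artifact setting. -/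
inductive QF (A : Setting σ) (V : σ.Srt → Type) (I : A.ASort → Type) : Type
  | tru : QF A V I
  | eq {S : σ.Srt} (t u : ATerm A V I S) : QF A V I
  | idxEq {E : A.ASort} (i j : I E) : QF A V I
  | neg (φ : QF A V I) : QF A V I
  | and (φ ψ : QF A V I) : QF A V I

def QF.conj {A : Setting σ} {V : σ.Srt → Type} {I : A.ASort → Type}
    (l : List (QF A V I)) : QF A V I :=
  l.foldr QF.and QF.tru

def QF.disj {A : Setting σ} {V : σ.Srt → Type} {I : A.ASort → Type}
    (l : List (QF A V I)) : QF A V I :=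
  .neg (QF.conj (l.map QF.neg))

/-- A structure together with an interpretation of the artifact sorts. -/
structure ExtStruct (A : Setting σ) extends Struct σ where
  Idx : A.ASort → Type
  idx_nonempty : ∀ E, Nonempty (Idx E)

/-- An assignment to the artifact setting, that is, a content of the working memory. -/
structure State {A : Setting σ} (𝔐 : ExtStruct A) where
  art : ∀ x : A.AVar, 𝔐.Dom (A.avSort x)
  arr : ∀ a : A.Comp, 𝔐.Idx (A.src a) → 𝔐.Dom (A.tgt a)

def Cell.eval {A : Setting σ} {V : σ.Srt → Type} {I : A.ASort → Type} {𝔐 : ExtStruct A}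
    (s : State 𝔐) (y : ∀ S, V S → 𝔐.Dom S) (e : ∀ E, I E → 𝔐.Idx E) :
    (S : σ.Srt) → Cell A V I S → 𝔐.Dom S
  | _, .bas v => y _ v
  | _, .art x => s.art x
  | _, .read a i => s.arr a (e _ i)

def QF.Holds {A : Setting σ} {V : σ.Srt → Type} {I : A.ASort → Type} {𝔐 : ExtStruct A}
    (s : State 𝔐) (y : ∀ S, V S → 𝔐.Dom S) (e : ∀ E, I E → 𝔐.Idx E) : QF A V I → Prop
  | .tru => True
  | .eq t u => t.eval 𝔐.toStruct (Cell.eval s y e) = u.eval 𝔐.toStruct (Cell.eval s y e)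
  | .idxEq i j => e _ i = e _ j
  | .neg φ => ¬ φ.Holds s y e
  | .and φ ψ => φ.Holds s y e ∧ ψ.Holds s y e

/-- Sets of states, uniformly in the underlying structure. -/
abbrev StateSet (A : Setting σ) : Type 1 := ∀ 𝔐 : ExtStruct A, State 𝔐 → Prop

/-- State formulae `∃ e, φ(e, x, a)`: a quantifier-free matrix without variables of basic sorts,
whose index variables (`0, 1, 2, …` of each artifact sort) are existentially quantified. -/
abbrev StateFormula (A : Setting σ) : Type := QF A (fun _ => Empty) (fun _ => ℕ)

def StateFormula.sat {A : Setting σ} (φ : StateFormula A) : StateSet A :=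
  fun 𝔐 s => ∃ e : ∀ E, ℕ → 𝔐.Idx E, QF.Holds s (fun _ v => v.elim) e φ

/-- Case-defined functions, as nested conditionals. -/
inductive CaseDef (A : Setting σ) (V : σ.Srt → Type) (I : A.ASort → Type) (S : σ.Srt) : Type
  | ret (t : ATerm A V I S) : CaseDef A V I S
  | ite (κ : QF A V I) (d₁ d₂ : CaseDef A V I S) : CaseDef A V I S

def CaseDef.eval {A : Setting σ} {V : σ.Srt → Type} {I : A.ASort → Type} {S : σ.Srt}
    {𝔐 : ExtStruct A} (s : State 𝔐) (y : ∀ S, V S → 𝔐.Dom S) (e : ∀ E, I E → 𝔐.Idx E) :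
    CaseDef A V I S → 𝔐.Dom S
  | .ret t => t.eval 𝔐.toStruct (Cell.eval s y e)
  | .ite κ d₁ d₂ => if κ.Holds s y e then d₁.eval s y e else d₂.eval s y e

/-- Index variables of an array update `a' = λ j. G(j, e, x, a)`: the quantified ones and `j`. -/
inductive WithCur {A : Setting σ} (E₀ : A.ASort) : A.ASort → Type
  | old {E : A.ASort} (n : ℕ) : WithCur E₀ E
  | cur : WithCur E₀ E₀

def WithCur.eval {A : Setting σ} {𝔐 : ExtStruct A} {E₀ : A.ASort} (e : ∀ E, ℕ → 𝔐.Idx E)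
    (j : 𝔐.Idx E₀) : (E : A.ASort) → WithCur E₀ E → 𝔐.Idx E
  | _, .old n => e _ n
  | _, .cur => j

/-- Transition formulae
`∃ e y, γ(e, y, x, a) ∧ ⋀ x' = F(e, y, x, a) ∧ ⋀ a' = λ j. G(j, e, y, x, a)`. -/
structure Transition (A : Setting σ) where
  guard : QF A (fun _ => ℕ) (fun _ => ℕ)
  art : ∀ x : A.AVar, CaseDef A (fun _ => ℕ) (fun _ => ℕ) (A.avSort x)
  arr : ∀ a : A.Comp, CaseDef A (fun _ => ℕ) (WithCur (A.src a)) (A.tgt a)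

def Transition.Rel {A : Setting σ} (τ : Transition A) {𝔐 : ExtStruct A} (s s' : State 𝔐) :
    Prop :=
  ∃ (y : ∀ S, ℕ → 𝔐.Dom S) (e : ∀ E, ℕ → 𝔐.Idx E),
    τ.guard.Holds s y e ∧
    (∀ x, s'.art x = (τ.art x).eval s y e) ∧
    ∀ a j, s'.arr a j = (τ.arr a).eval s y (WithCur.eval e j)

/-! ## Relational artifact systems and backward reachability -/

/-- A relational artifact system: theory, artifact setting, initial formula (a constant for each
artifact variable and each array) and transition formulae. -/
structure System (σ : Signature) where
  theory : Set (Formula σ)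
  setting : Setting σ
  startArt : ∀ x : setting.AVar, σ.Cst (setting.avSort x)
  startArr : ∀ a : setting.Comp, σ.Cst (setting.tgt a)
  trans : List (Transition setting)

/-- The initial formula. -/
def System.start (𝒮 : System σ) : StateSet 𝒮.setting := fun 𝔐 s =>
  (∀ x, s.art x = 𝔐.cst (𝒮.startArt x)) ∧ ∀ a j, s.arr a j = 𝔐.cst (𝒮.startArr a)

/-- The preimage `∃ x' a', τ(x, a, x', a') ∧ φ(x', a')`. -/
def System.pre (𝒮 : System σ) (φ : StateSet 𝒮.setting) : StateSet 𝒮.setting := fun 𝔐 s =>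
  ∃ s' : State 𝔐, (∃ τ ∈ 𝒮.trans, τ.Rel s s') ∧ φ 𝔐 s'

/-- Satisfiability modulo a theory. -/
def Satisfiable {A : Setting σ} (T : Set (Formula σ)) (P : StateSet A) : Prop :=
  ∃ 𝔐 : ExtStruct A, 𝔐.toStruct.Models T ∧ ∃ s : State 𝔐, P 𝔐 s

/-- Equivalence modulo a theory. -/
def Equivalent {A : Setting σ} (T : Set (Formula σ)) (P Q : StateSet A) : Prop :=
  ∀ 𝔐 : ExtStruct A, 𝔐.toStruct.Models T → ∀ s : State 𝔐, P 𝔐 s ↔ Q 𝔐 s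

/-- The program variables of the procedure: the current formula `φ` and the list whose disjunction
is the set `B` of states reached so far. -/
structure Config (A : Setting σ) where
  phi : StateFormula A
  B : List (StateFormula A)

/-- The loop test: `φ ∧ ¬ B` is satisfiable modulo the theory. -/
def System.LoopTest (𝒮 : System σ) (c : Config 𝒮.setting) : Prop :=
  Satisfiable 𝒮.theory fun 𝔐 s => c.phi.sat 𝔐 s ∧ ¬ ∃ ψ ∈ c.B, StateFormula.sat ψ 𝔐 s

/-- The unsafety test: `ι ∧ φ` is satisfiable modulo the theory. -/
def System.UnsafeTest (𝒮 : System σ) (c : Config 𝒮.setting) : Prop :=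
  Satisfiable 𝒮.theory fun 𝔐 s => 𝒮.start 𝔐 s ∧ c.phi.sat 𝔐 s

/-- One full iteration of the loop: the loop test succeeds, the procedure does not return `unsafe`,
`B` becomes `φ ∨ B`, and `φ` becomes `QE(T*, Pre(τ, φ))`, a state formula equivalent modulo `T*` to
the preimage of `φ`. -/
def System.Iteration (𝒮 : System σ) (Ts : Set (Formula σ)) (c c' : Config 𝒮.setting) : Prop :=
  𝒮.LoopTest c ∧ ¬ 𝒮.UnsafeTest c ∧ c'.B = c.phi :: c.B ∧
    Equivalent Ts c'.phi.sat (𝒮.pre c.phi.sat)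

/-- Termination of backward reachability for the goal `υ`: the model completion `T*` on which the
procedure relies exists, the goal is expressed by a state formula, quantifier elimination in `T*`
always delivers a state formula for a preimage, and, whichever state formulae are delivered, the
loop is iterated only finitely often. -/
def System.Terminates (𝒮 : System σ) (υ : StateSet 𝒮.setting) : Prop :=
  (∃ Ts, IsModelCompletion 𝒮.theory Ts) ∧
  (∃ φ : StateFormula 𝒮.setting, Equivalent 𝒮.theory φ.sat υ) ∧
  ∀ Ts, IsModelCompletion 𝒮.theory Ts →
    (∀ φ : StateFormula 𝒮.setting, ∃ ψ : StateFormula 𝒮.setting,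
      Equivalent Ts ψ.sat (𝒮.pre φ.sat)) ∧
    ∀ φ : StateFormula 𝒮.setting, Equivalent 𝒮.theory φ.sat υ →
      Acc (fun c' c => 𝒮.Iteration Ts c c') ⟨φ, []⟩

end RAS

/-! # Data-aware BPMN models -/

namespace DAB

/-- Lifecycle states of blocks. -/
inductive LState
  | idle | enabled | active | waiting | waiting1 | waiting2 | completed | error

/-- Data schemas. Attributes are given by position. The primary key of a catalog relation is listed
separately from its other attributes, and `CVar` lists the case variables other than `self`, which
has type `CType`. -/
structure DataSchema where
  /-- the types, with their domains of objects -/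
  Ty : Type
  IsId : Ty → Prop
  Obj : Ty → Type
  undef : ∀ S, Obj S
  /-- the catalog -/
  Cat : Type
  cat_finite : Finite Cat
  catKey : Cat → Ty
  catArity : Cat → ℕ
  catAttr : ∀ R, Fin (catArity R) → Ty
  catKey_isId : ∀ R, IsId (catKey R)
  catKey_injective : Function.Injective catKey
  foreignKey : ∀ R a, IsId (catAttr R a) → ∃ R', catKey R' = catAttr R a
  /-- the case identifier type -/
  CType : Ty
  ctype_isId : IsId CType
  ctype_ne_catKey : ∀ R, catKey R ≠ CType
  /-- the repository -/
  Repo : Type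
  repo_finite : Finite Repo
  repoArity : Repo → ℕ
  repoArity_pos : ∀ R, 0 < repoArity R
  repoAttr : ∀ R, Fin (repoArity R) → Ty
  repo_ref : ∀ R a, IsId (repoAttr R a) → repoAttr R a = CType ∨ ∃ R', catKey R' = repoAttr R a
  /-- the case variables -/
  CVar : Type
  cvar_finite : Finite CVar
  cvTy : CVar → Ty
  cvar_ref : ∀ x, IsId (cvTy x) → cvTy x = CType ∨ ∃ R', catKey R' = cvTy x

/-! ## Characteristic graph of the catalog -/

/-- Nodes `⟨R, a⟩`; `none` stands for the primary key. -/
abbrev CatNode (D : DataSchema) : Type := Σ R : D.Cat, Option (Fin (D.catArity R))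

inductive CatEdge (D : DataSchema) : CatNode D → CatNode D → Prop
  | attr (R : D.Cat) (a : Fin (D.catArity R)) : CatEdge D ⟨R, none⟩ ⟨R, some a⟩
  | ref (R₁ : D.Cat) (a : Fin (D.catArity R₁)) (R₂ : D.Cat) (h : D.catAttr R₁ a = D.catKey R₂) :
      CatEdge D ⟨R₁, some a⟩ ⟨R₂, none⟩

/-! ## Queries and guards -/

/-- Terms of queries: normal variables, case variables, constant objects. -/
inductive QTerm (D : DataSchema) (V : D.Ty → Type) : D.Ty → Type
  | var {S : D.Ty} (v : V S) : QTerm D V S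
  | cvar (x : D.CVar) : QTerm D V (D.cvTy x)
  | self : QTerm D V D.CType
  | obj {S : D.Ty} (c : D.Obj S) : QTerm D V S

/-- Terms of effects: normal variables and constant objects. -/
inductive ETerm (D : DataSchema) (V : D.Ty → Type) : D.Ty → Type
  | var {S : D.Ty} (v : V S) : ETerm D V S
  | obj {S : D.Ty} (c : D.Obj S) : ETerm D V S

def ETerm.toQTerm {D : DataSchema} {V : D.Ty → Type} {S : D.Ty} : ETerm D V S → QTerm D V S
  | .var v => .var v
  | .obj c => .obj c

/-- Atoms. `C` lists the case control variables that may be queried (none in the guards of a DAB,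
the block lifecycles in properties). -/
inductive Atom (D : DataSchema) (V : D.Ty → Type) (C : Type) : Type
  | eq {S : D.Ty} (t u : QTerm D V S) : Atom D V C
  | cat (R : D.Cat) (key : QTerm D V (D.catKey R)) (args : ∀ a, QTerm D V (D.catAttr R a)) :
      Atom D V C
  | repo (R : D.Repo) (args : ∀ a, QTerm D V (D.repoAttr R a)) : Atom D V C
  | ctlState (b : C) (l : LState) : Atom D V C
  | ctlEq (b b' : C) : Atom D V C

structure Literal (D : DataSchema) (V : D.Ty → Type) (C : Type) where
  positive : Bool
  atom : Atom D V C

/-- Conjunctive queries with filters, as lists of literals; the empty list is `true`. -/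
abbrev CQ (D : DataSchema) (V : D.Ty → Type) (C : Type) : Type := List (Literal D V C)

section Occurrences

variable {D : DataSchema} {V : D.Ty → Type} {C : Type}

/-- The normal variables of a term. -/
def QTerm.vars : {S : D.Ty} → QTerm D V S → Set (Σ S, V S)
  | S, .var v => {⟨S, v⟩}
  | _, .cvar _ => ∅
  | _, .self => ∅
  | _, .obj _ => ∅

/-- The term is not a case variable. -/
def QTerm.CaseFree : {S : D.Ty} → QTerm D V S → Prop
  | _, .var _ => True
  | _, .cvar _ => False
  | _, .self => False
  | _, .obj _ => True

def ETerm.vars {S : D.Ty} (t : ETerm D V S) : Set (Σ S, V S) := t.toQTerm.vars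

def Atom.vars : Atom D V C → Set (Σ S, V S)
  | .eq t u => t.vars ∪ u.vars
  | .cat _ key args => key.vars ∪ ⋃ a, (args a).vars
  | .repo _ args => ⋃ a, (args a).vars
  | .ctlState _ _ => ∅
  | .ctlEq _ _ => ∅

/-- No case variable, and no case control variable, occurs in the atom. -/
def Atom.CaseFree : Atom D V C → Prop
  | .eq t u => t.CaseFree ∧ u.CaseFree
  | .cat _ key args => key.CaseFree ∧ ∀ a, (args a).CaseFree
  | .repo _ args => ∀ a, (args a).CaseFree
  | .ctlState _ _ => False
  | .ctlEq _ _ => False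

def Atom.IsRepo : Atom D V C → Prop
  | .repo _ _ => True
  | _ => False

def cqVars (Q : CQ D V C) : Set (Σ S, V S) := {x | ∃ l ∈ Q, x ∈ l.atom.vars}

def cqCaseFree (Q : CQ D V C) : Prop := ∀ l ∈ Q, l.atom.CaseFree

def cqRepoFree (Q : CQ D V C) : Prop := ∀ l ∈ Q, ¬ l.atom.IsRepo

end Occurrences

/-- The countably many normal variables of each type. -/
abbrev NVar (D : DataSchema) : D.Ty → Type := fun _ => ℕ

/-- Guards `q(head) ← ⋁ body`. -/
structure Guard (D : DataSchema) (C : Type) where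
  head : List (Σ S, NVar D S)
  body : List (CQ D (NVar D) C)
  safe : ∀ Q ∈ body, ∀ x ∈ head, x ∈ cqVars Q

section Guards

variable {D : DataSchema} {C : Type}

def Guard.vars (G : Guard D C) : Set (Σ S, NVar D S) := {x | ∃ Q ∈ G.body, x ∈ cqVars Q}

def Guard.RepoFree (G : Guard D C) : Prop := ∀ Q ∈ G.body, cqRepoFree Q

def Guard.IsBoolean (G : Guard D C) : Prop := G.head = []

/-- A partition of a conjunctive query into `χ`, an optional repository atom `R(y)`, and `ξ`. -/
structure Split (D : DataSchema) (C : Type) where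
  chi : CQ D (NVar D) C
  tuple : Option (Σ R : D.Repo, ∀ a, QTerm D (NVar D) (D.repoAttr R a))
  xi : CQ D (NVar D) C

def Split.tupleLits (p : Split D C) : CQ D (NVar D) C :=
  match p.tuple with
  | none => []
  | some ⟨R, y⟩ => [⟨true, .repo R y⟩]

/-- The query `Q` is `χ ∧ R(y) ∧ ξ` up to the order of conjuncts, with the restrictions of
separated guards. -/
structure Split.Separates (p : Split D C) (Q : CQ D (NVar D) C) : Prop where
  perm : Q.Perm (p.chi ++ p.tupleLits ++ p.xi)
  chi_repoFree : cqRepoFree p.chi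
  xi_repoFree : cqRepoFree p.xi
  tuple_caseFree : cqCaseFree p.tupleLits
  xi_caseFree : cqCaseFree p.xi
  chi_tuple : Disjoint (cqVars p.chi) (cqVars p.tupleLits)
  chi_xi : Disjoint (cqVars p.chi) (cqVars p.xi)

def Guard.Separated (G : Guard D C) : Prop :=
  G.body.Pairwise (fun Q Q' => Disjoint (cqVars Q) (cqVars Q')) ∧
  ∀ Q ∈ G.body, ∃ p : Split D C, p.Separates Q

end Guards

/-! ## Update specifications -/

/-- Variables of a conditional update of `R(v)`: answer variables, and the new variables `v`, one
for each attribute of `R`. -/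
inductive UVar (D : DataSchema) (R : D.Repo) : D.Ty → Type
  | ans {S : D.Ty} (n : ℕ) : UVar D R S
  | new (a : Fin (D.repoArity R)) : UVar D R (D.repoAttr R a)

/-- The `THEN` and `ELSE` parts of a conditional update: a tuple or a nested conditional whose
filter is a disjunction of conjunctive queries. -/
inductive Branch (D : DataSchema) (R : D.Repo) : Type
  | tup (u : ∀ a, ETerm D (UVar D R) (D.repoAttr R a)) : Branch D R
  | ite (ψ : List (CQ D (UVar D R) Empty)) (b₁ b₂ : Branch D R) : Branch D R

/-- The `SET` part of an effect: a partial map on the case variables other than `self`. -/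
abbrev SetPart (D : DataSchema) : Type := ∀ x : D.CVar, Option (ETerm D (NVar D) (D.cvTy x))

abbrev RepoTuple (D : DataSchema) (R : D.Repo) : Type := ∀ a, ETerm D (NVar D) (D.repoAttr R a)

inductive Effect (D : DataSchema) : Type
  | insertSet (R : D.Repo) (u : RepoTuple D R) (θ : SetPart D) : Effect D
  | setOnly (θ : SetPart D) : Effect D
  | deleteSet (R : D.Repo) (u : RepoTuple D R) (θ : SetPart D) : Effect D
  | update (R : D.Repo) (ψ : List (CQ D (UVar D R) Empty)) (b₁ b₂ : Branch D R) : Effect D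

section Effects

variable {D : DataSchema}

def SetPart.vars (θ : SetPart D) : Set (Σ S, NVar D S) := {y | ∃ x, ∃ t ∈ θ x, y ∈ ETerm.vars t}

/-- All case variables other than `self` are set. -/
def SetPart.IsTotal (θ : SetPart D) : Prop := ∀ x, (θ x).isSome

def RepoTuple.vars {R : D.Repo} (u : RepoTuple D R) : Set (Σ S, NVar D S) := ⋃ a, (u a).vars

def filterVars {R : D.Repo} (ψ : List (CQ D (UVar D R) Empty)) : Set (Σ S, UVar D R S) :=
  {x | ∃ Q ∈ ψ, x ∈ cqVars Q}

def Branch.vars {R : D.Repo} : Branch D R → Set (Σ S, UVar D R S)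
  | .tup u => ⋃ a, (u a).vars
  | .ite ψ b₁ b₂ => filterVars ψ ∪ b₁.vars ∪ b₂.vars

def Branch.RepoFree {R : D.Repo} : Branch D R → Prop
  | .tup _ => True
  | .ite ψ b₁ b₂ => (∀ Q ∈ ψ, cqRepoFree Q) ∧ b₁.RepoFree ∧ b₂.RepoFree

/-- No case variable occurs in the filters. -/
def Branch.CaseFree {R : D.Repo} : Branch D R → Prop
  | .tup _ => True
  | .ite ψ b₁ b₂ => (∀ Q ∈ ψ, cqCaseFree Q) ∧ b₁.CaseFree ∧ b₂.CaseFree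

/-- The normal variables of an effect, other than the new variables of a conditional update. -/
def Effect.vars : Effect D → Set (Σ S, NVar D S)
  | .insertSet _ u θ => u.vars ∪ θ.vars
  | .setOnly θ => θ.vars
  | .deleteSet _ u θ => u.vars ∪ θ.vars
  | .update _ ψ b₁ b₂ => {y | ⟨y.1, UVar.ans y.2⟩ ∈ (Branch.ite ψ b₁ b₂).vars}

/-- The filters of a conditional update do not query the repository. -/
def Effect.FiltersRepoFree : Effect D → Prop
  | .update _ ψ b₁ b₂ => (Branch.ite ψ b₁ b₂).RepoFree
  | _ => True

end Effects

/-- Update specifications: effects use answer variables of the precondition only (apart from the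
new variables of a conditional update). -/
structure UpdateSpec (D : DataSchema) where
  pre : Guard D Empty
  eff : Effect D
  vars_subset : ∀ y ∈ eff.vars, y ∈ pre.head
  filters : eff.FiltersRepoFree

/-- The effect takes nothing from the part `χ` of the (separated) precondition, which inspects the
case variables: no variable of `χ` occurs in the deleted tuple or in the `SET` part, and a tuple to
be deleted is the one retrieved by the precondition, if the precondition retrieves one. -/
def UpdateSpec.Isolated {D : DataSchema} (u : UpdateSpec D) : Prop :=
  ∀ Q ∈ u.pre.body, ∃ p : Split D Empty, p.Separates Q ∧
    Disjoint (cqVars p.chi) u.eff.vars ∧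
    match u.eff with
    | .deleteSet R t _ => p.tuple = none ∨ p.tuple = some ⟨R, fun a => (t a).toQTerm⟩
    | _ => True

/-- The conditions that the termination theorem imposes on update specifications. -/
def UpdateSpec.Restricted {D : DataSchema} (u : UpdateSpec D) : Prop :=
  match u.eff with
  | .insertSet _ _ _ => u.pre.RepoFree
  | .setOnly θ => u.pre.RepoFree ∨ (u.pre.Separated ∧ θ.IsTotal ∧ u.Isolated)
  | .deleteSet _ _ θ => u.pre.Separated ∧ θ.IsTotal ∧ u.Isolated
  | .update _ ψ b₁ b₂ => u.pre.RepoFree ∧ u.pre.IsBoolean ∧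
      (∀ y, y ∉ u.eff.vars) ∧ (Branch.ite ψ b₁ b₂).CaseFree

/-! ## Block-structured processes -/

/-- Conditions. -/
inductive Cond (D : DataSchema) : Type
  | eq {S : D.Ty} (t u : QTerm D (NVar D) S) : Cond D
  | neg (φ : Cond D) : Cond D
  | and (φ ψ : Cond D) : Cond D

/-- The end event of a possible completion block: an error handled at the boundary of the named
subprocess, or an end event that completes the innermost enclosing process block. -/
inductive EndEvent (N : Type) : Type
  | error (handler : N) : EndEvent N
  | plain : EndEvent N

/-- Blocks; the first argument is the name of the block. The types of events (message, timer, …)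
are left out, since events are triggered nondeterministically whatever their type. -/
inductive Block (D : DataSchema) (N : Type) : Type
  | empty (n : N) : Block D N
  | task (n : N) (atomic : Bool) (u : UpdateSpec D) : Block D N
  | event (n : N) (u : UpdateSpec D) : Block D N
  | proc (n : N) (uStart uEnd : UpdateSpec D) (B : Block D N) : Block D N
  | subproc (n : N) (B : Block D N) : Block D N
  | seq (n : N) (B₁ B₂ : Block D N) : Block D N
  | possibleCompletion (n : N) (B₁ : Block D N) (φ : Cond D) (e : EndEvent N) : Block D N
  | deferredChoice (n : N) (B₁ B₂ : Block D N) : Block D N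
  | parallel (n : N) (B₁ B₂ : Block D N) : Block D N
  | exclChoice (n : N) (φ : Cond D) (B₁ B₂ : Block D N) : Block D N
  | inclChoice (n : N) (φ₁ φ₂ : Cond D) (B₁ B₂ : Block D N) : Block D N
  | loop (n : N) (φ : Cond D) (B₁ B₂ : Block D N) : Block D N
  | eventChoice (n : N) (E₁ E₂ B₁ B₂ : Block D N) : Block D N
  | backExc (n : N) (A B₁ : Block D N) : Block D N
  | forExc (n : N) (A B₁ B₂ : Block D N) : Block D N
  | nonInterr (n : N) (A B₁ B₂ : Block D N) : Block D N

section Blocks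

variable {D : DataSchema} {N : Type}

def Block.name : Block D N → N
  | .empty n | .task n _ _ | .event n _ | .proc n _ _ _ | .subproc n _ | .seq n _ _
  | .possibleCompletion n _ _ _ | .deferredChoice n _ _ | .parallel n _ _ | .exclChoice n _ _ _
  | .inclChoice n _ _ _ _ | .loop n _ _ _ | .eventChoice n _ _ _ _ | .backExc n _ _
  | .forExc n _ _ _ | .nonInterr n _ _ _ => n

/-- The immediate sub-blocks. -/
def Block.children : Block D N → List (Block D N)
  | .empty _ | .task _ _ _ | .event _ _ => []
  | .proc _ _ _ B | .subproc _ B | .possibleCompletion _ B _ _ => [B]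
  | .seq _ B₁ B₂ | .deferredChoice _ B₁ B₂ | .parallel _ B₁ B₂ | .exclChoice _ _ B₁ B₂
  | .inclChoice _ _ _ B₁ B₂ | .loop _ _ B₁ B₂ | .backExc _ B₁ B₂ => [B₁, B₂]
  | .eventChoice _ E₁ E₂ B₁ B₂ => [E₁, E₂, B₁, B₂]
  | .forExc _ A B₁ B₂ | .nonInterr _ A B₁ B₂ => [A, B₁, B₂]

/-- All blocks of a process: the block itself and its descendants. -/
def Block.all : Block D N → List (Block D N)
  | .empty n => [.empty n]
  | .task n a u => [.task n a u]
  | .event n u => [.event n u]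
  | .proc n u v B => .proc n u v B :: B.all
  | .subproc n B => .subproc n B :: B.all
  | .seq n B₁ B₂ => .seq n B₁ B₂ :: (B₁.all ++ B₂.all)
  | .possibleCompletion n B φ e => .possibleCompletion n B φ e :: B.all
  | .deferredChoice n B₁ B₂ => .deferredChoice n B₁ B₂ :: (B₁.all ++ B₂.all)
  | .parallel n B₁ B₂ => .parallel n B₁ B₂ :: (B₁.all ++ B₂.all)
  | .exclChoice n φ B₁ B₂ => .exclChoice n φ B₁ B₂ :: (B₁.all ++ B₂.all)
  | .inclChoice n φ φ' B₁ B₂ => .inclChoice n φ φ' B₁ B₂ :: (B₁.all ++ B₂.all)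
  | .loop n φ B₁ B₂ => .loop n φ B₁ B₂ :: (B₁.all ++ B₂.all)
  | .eventChoice n E₁ E₂ B₁ B₂ =>
      .eventChoice n E₁ E₂ B₁ B₂ :: (E₁.all ++ E₂.all ++ B₁.all ++ B₂.all)
  | .backExc n A B₁ => .backExc n A B₁ :: (A.all ++ B₁.all)
  | .forExc n A B₁ B₂ => .forExc n A B₁ B₂ :: (A.all ++ B₁.all ++ B₂.all)
  | .nonInterr n A B₁ B₂ => .nonInterr n A B₁ B₂ :: (A.all ++ B₁.all ++ B₂.all)

def Block.names (B : Block D N) : List N := B.all.map Block.name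

/-- The names of the proper descendants of a block. -/
def Block.inner (B : Block D N) : List N := (B.children.map Block.names).flatten

def Block.IsProc : Block D N → Prop
  | .proc _ _ _ _ => True
  | _ => False

def Block.IsSubproc : Block D N → Prop
  | .subproc _ _ => True
  | _ => False

def Block.IsEvent : Block D N → Prop
  | .event _ _ => True
  | _ => False

/-- The update specifications attached to a block itself. -/
def Block.ownSpecs : Block D N → List (UpdateSpec D)
  | .task _ _ u => [u]
  | .event _ u => [u]
  | .proc _ u v _ => [u, v]
  | _ => []

/-- Local well-formedness: nonatomic tasks act on case variables only, subprocesses contain process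
blocks, event-driven choices start with catch events, exceptions are attached to subprocesses. -/
def Block.LocallyWF : Block D N → Prop
  | .task _ false u => ∃ θ, u.eff = .setOnly θ
  | .subproc _ B => B.IsProc
  | .eventChoice _ E₁ E₂ _ _ => E₁.IsEvent ∧ E₂.IsEvent
  | .backExc _ A _ | .forExc _ A _ _ | .nonInterr _ A _ _ => A.IsSubproc
  | _ => True

end Blocks

/-- A DAB: a data schema and a root process block. Distinct blocks have distinct names, and every
name is the name of a block. -/
structure Model where
  schema : DataSchema
  Name : Type
  root : Block schema Name
  root_isProc : root.IsProc
  names_nodup : root.names.Nodup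
  names_all : ∀ n, n ∈ root.names
  wf : ∀ B ∈ root.all, B.LocallyWF

/-- The update specifications of a DAB. -/
def Model.specs (M : Model) : Set (UpdateSpec M.schema) :=
  {u | ∃ B ∈ M.root.all, u ∈ B.ownSpecs}

/-- Acyclicity of the characteristic graph of the catalog. -/
def Model.Acyclic (M : Model) : Prop :=
  ∀ p : CatNode M.schema, ¬ Relation.TransGen (CatEdge M.schema) p p

/-- Properties over `n` cases; the control variables are the lifecycles of the blocks. -/
structure Property (M : Model) where
  n : ℕ
  guard : Fin n → Guard M.schema M.Name
  range : ∀ i, ∀ y ∈ (guard i).vars,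
    ∃ Q ∈ (guard i).body, ∃ l ∈ Q, l.atom.IsRepo ∧ y ∈ l.atom.vars

def Property.Separated {M : Model} (P : Property M) : Prop := ∀ i, (P.guard i).Separated

/-! ## Lifecycle rules of blocks -/

/-- Control variables of a case: the lifecycle of each block, and for each block a flag (`idle` for
false, `error` for true) that records an error at a non-interrupting boundary. -/
inductive CtlVar (N : Type) : Type
  | life (n : N) : CtlVar N
  | flag (n : N) : CtlVar N

/-- A rule for one case: tests on control variables, conditions, a precondition and an effect (both
optional), and assignments to control variables (the first one for a variable counts). -/
structure Rule (D : DataSchema) (N : Type) where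
  tests : List (CtlVar N × LState)
  conds : List (Cond D) := []
  pre : Option (Guard D Empty) := none
  eff : Option (Effect D) := none
  assigns : List (CtlVar N × LState)

section Rules

variable {D : DataSchema} {N : Type}

open LState CtlVar

/-- Notation for `(lifecycle of B, state)`. -/
def Block.is (B : Block D N) (l : LState) : CtlVar N × LState := (life B.name, l)

def resets (ns : List N) : List (CtlVar N × LState) := ns.map fun n => (life n, idle)

/-- The interruption of the subprocess `A` by its boundary event. -/
def interruptRules (A : Block D N) : List (Rule D N) :=
  [enabled, waiting, active].map fun l =>
    { tests := [A.is l], assigns := A.is error :: resets A.inner }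

/-- The rules of a block, apart from those of its sub-blocks, in the process `P`. -/
def Block.ownRules (P : Block D N) (B : Block D N) : List (Rule D N) :=
  match B with
  | .empty _ => [{ tests := [B.is enabled], assigns := [B.is completed] }]
  | .task _ true u =>
      [{ tests := [B.is enabled], pre := some u.pre, eff := some u.eff,
         assigns := [B.is completed] }]
  | .task _ false u =>
      [{ tests := [B.is enabled], pre := some u.pre, assigns := [B.is active] },
       { tests := [B.is active], eff := some u.eff, assigns := [B.is completed] }]
  | .event _ u =>
      [{ tests := [B.is enabled], pre := some u.pre, eff := some u.eff,
         assigns := [B.is completed] }]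
  | .proc _ u v B₁ =>
      [{ tests := [B.is enabled], pre := some u.pre, eff := some u.eff,
         assigns := [B₁.is enabled, B.is waiting] },
       { tests := [B₁.is completed], pre := some v.pre, eff := some v.eff,
         assigns := [B₁.is idle, B.is completed] }]
  | .subproc _ B₁ =>
      [{ tests := [B.is enabled], assigns := [B₁.is enabled, B.is waiting] },
       { tests := [B₁.is completed], assigns := [B₁.is idle, B.is completed] }]
  | .seq _ B₁ B₂ =>
      [{ tests := [B.is enabled], assigns := [B₁.is enabled, B.is waiting] },
       { tests := [B₁.is completed], assigns := [B₁.is idle, B₂.is enabled] },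
       { tests := [B₂.is completed], assigns := [B₂.is idle, B.is completed] }]
  | .possibleCompletion _ B₁ φ e =>
      [{ tests := [B.is enabled], assigns := [B₁.is enabled, B.is waiting] },
       { tests := [B₁.is completed], conds := [φ], assigns := [B₁.is idle, B.is completed] }] ++
      match e with
      | .error h =>
          -- the enclosing subprocess `h` goes to its error state, its descendants become idle
          (P.all.filter fun A => decide (A.name = h ∧ B.name ∈ A.inner)).map fun A =>
            { tests := [B₁.is completed], conds := [.neg φ],
              assigns := A.is error :: resets A.inner }
      | .plain =>
          -- the innermost enclosing process block completes, its descendants become idle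
          (P.all.filter fun A => decide (A.IsProc ∧ B.name ∈ A.inner ∧
              ∀ A' ∈ P.all, A'.IsProc → B.name ∈ A'.inner → A'.name ∉ A.inner)).map fun A =>
            { tests := [B₁.is completed], conds := [.neg φ],
              assigns := A.is completed :: resets A.inner }
  | .deferredChoice _ B₁ B₂ =>
      [{ tests := [B.is enabled], assigns := [B₁.is enabled, B.is waiting] },
       { tests := [B.is enabled], assigns := [B₂.is enabled, B.is waiting] },
       { tests := [B₁.is completed], assigns := [B₁.is idle, B.is completed] },
       { tests := [B₂.is completed], assigns := [B₂.is idle, B.is completed] }]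
  | .parallel _ B₁ B₂ =>
      [{ tests := [B.is enabled], assigns := [B₁.is enabled, B₂.is enabled, B.is waiting] },
       { tests := [B₁.is completed, B₂.is completed],
         assigns := [B₁.is idle, B₂.is idle, B.is completed] }]
  | .exclChoice _ φ B₁ B₂ =>
      [{ tests := [B.is enabled], conds := [φ], assigns := [B₁.is enabled, B.is waiting] },
       { tests := [B.is enabled], conds := [.neg φ], assigns := [B₂.is enabled, B.is waiting] },
       { tests := [B₁.is completed], assigns := [B₁.is idle, B.is completed] },
       { tests := [B₂.is completed], assigns := [B₂.is idle, B.is completed] }]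
  | .inclChoice _ φ₁ φ₂ B₁ B₂ =>
      [{ tests := [B.is enabled], conds := [φ₁, .neg φ₂],
         assigns := [B₁.is enabled, B.is waiting1] },
       { tests := [B.is enabled], conds := [φ₂, .neg φ₁],
         assigns := [B₂.is enabled, B.is waiting1] },
       { tests := [B.is enabled], conds := [φ₁, φ₂],
         assigns := [B₁.is enabled, B₂.is enabled, B.is waiting2] },
       { tests := [B₁.is completed, B.is waiting1], assigns := [B₁.is idle, B.is completed] },
       { tests := [B.is waiting1, B₂.is completed], assigns := [B₂.is idle, B.is completed] },
       { tests := [B₁.is completed, B₂.is completed],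
         assigns := [B₁.is idle, B₂.is idle, B.is completed] }]
  | .loop _ φ B₁ B₂ =>
      [{ tests := [B.is enabled], assigns := [B₁.is enabled, B.is waiting] },
       { tests := [B₁.is completed], conds := [φ], assigns := [B₁.is idle, B₂.is enabled] },
       { tests := [B₂.is completed], assigns := [B₁.is enabled, B₂.is idle] },
       { tests := [B₁.is completed], conds := [.neg φ], assigns := [B₁.is idle, B.is completed] }]
  | .eventChoice _ E₁ E₂ B₁ B₂ =>
      [{ tests := [B.is enabled], assigns := [E₁.is enabled, E₂.is enabled, B.is waiting] },
       { tests := [E₁.is completed], assigns := [E₁.is idle, E₂.is idle, B₁.is enabled] },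
       { tests := [E₂.is completed], assigns := [E₁.is idle, E₂.is idle, B₂.is enabled] },
       { tests := [B₁.is completed], assigns := [B₁.is idle, B.is completed] },
       { tests := [B₂.is completed], assigns := [B₂.is idle, B.is completed] }]
  | .backExc _ A B₁ =>
      [{ tests := [B.is enabled], assigns := [A.is enabled, B.is waiting] },
       { tests := [A.is completed], assigns := [A.is idle, B.is completed] },
       { tests := [A.is error], assigns := [A.is idle, B₁.is enabled] },
       { tests := [B₁.is completed], assigns := [B₁.is idle, A.is enabled] }] ++
      interruptRules A
  | .forExc _ A B₁ B₂ =>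
      [{ tests := [B.is enabled], assigns := [A.is enabled, B.is waiting] },
       { tests := [A.is completed], assigns := [A.is idle, B₁.is enabled] },
       { tests := [B₁.is completed], assigns := [B₁.is idle, B.is completed] },
       { tests := [A.is error], assigns := [A.is idle, B₂.is enabled] },
       { tests := [B₂.is completed], assigns := [B₂.is idle, B.is completed] }] ++
      interruptRules A
  | .nonInterr _ A B₁ B₂ =>
      [{ tests := [B.is enabled],
         assigns := [A.is enabled, B.is waiting, (flag A.name, idle)] },
       { tests := [A.is completed], assigns := [A.is idle, B₁.is enabled] },
       { tests := [B₁.is completed, (flag A.name, idle)],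
         assigns := [B₁.is idle, B.is completed] },
       { tests := [(flag A.name, error), B₂.is idle], assigns := [B₂.is enabled] },
       { tests := [B₁.is completed, B₂.is completed],
         assigns := [B₁.is idle, B₂.is idle, B.is completed, (flag A.name, idle)] }] ++
      [enabled, waiting, active].map fun l =>
        -- the boundary event does not interrupt `A`
        { tests := [A.is l], assigns := [(flag A.name, error)] }

/-- All rules of a process: the creation of the case, which enables the root block, and the rules of
all blocks. -/
def Block.rules (P : Block D N) : List (Rule D N) :=
  { tests := [P.is idle], assigns := [P.is enabled] } ::
    (P.all.map (Block.ownRules P)).flatten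

end Rules

/-! # Translation of DABs into relational artifact systems

A DAB with at most `k` cases is translated into a system that has, for each of the `k` cases, one
artifact variable for every case variable and every control variable, and for every repository
relation an artifact sort with one array for every attribute. -/

open RAS

section Translation

/-- Constants of the signature: the objects of the domains, the identifiers of the `k` cases, the
lifecycle states. `none` is the sort of lifecycle states. -/
inductive TConst (D : DataSchema) (k : ℕ) : Option D.Ty → Type
  | obj {S : D.Ty} (c : D.Obj S) : TConst D k (some S)
  | caseId (j : Fin k) : TConst D k (some D.CType)
  | life (l : LState) : TConst D k none
  | lifeUndef : TConst D k none

/-- The signature of the catalog: a function `f_{R,a}` for each non-key attribute. -/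
abbrev sig (D : DataSchema) (k : ℕ) : Signature where
  Srt := Option D.Ty
  Fn := Σ R : D.Cat, Fin (D.catArity R)
  src f := some (D.catKey f.1)
  tgt f := some (D.catAttr f.1 f.2)
  Cst := TConst D k
  undef
    | none => .lifeUndef
    | some S => .obj (D.undef S)

/-- The variables of one case. -/
inductive Slot (D : DataSchema) (N : Type) : Type
  | self : Slot D N
  | data (x : D.CVar) : Slot D N
  | ctl (c : CtlVar N) : Slot D N

abbrev Slot.sort {D : DataSchema} {N : Type} : Slot D N → Option D.Ty
  | .self => some D.CType
  | .data x => some (D.cvTy x)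
  | .ctl _ => none

abbrev setting (D : DataSchema) (N : Type) (k : ℕ) : Setting (sig D k) where
  AVar := Fin k × Slot D N
  avSort p := p.2.sort
  ASort := D.Repo
  Comp := Σ R : D.Repo, Fin (D.repoArity R)
  src c := c.1
  tgt c := some (D.repoAttr c.1 c.2)

variable {D : DataSchema} {N : Type} {k : ℕ}

section Queries

variable {W : Option D.Ty → Type} {I : D.Repo → Type} {V : D.Ty → Type} {C : Type}

/-- Terms of queries for the case `j`; `ρ` translates the normal variables. -/
def trQTerm (j : Fin k) (ρ : ∀ S, V S → ATerm (setting D N k) W I (some S)) :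
    {S : D.Ty} → QTerm D V S → ATerm (setting D N k) W I (some S)
  | _, .var v => ρ _ v
  | _, .cvar x => .var (.art (A := setting D N k) (j, Slot.data x))
  | _, .self => .var (.art (A := setting D N k) (j, Slot.self))
  | _, .obj c => .cst (σ := sig D k) (TConst.obj c)

def trETerm (ρ : ∀ S, V S → ATerm (setting D N k) W I (some S)) :
    {S : D.Ty} → ETerm D V S → ATerm (setting D N k) W I (some S)
  | _, .var v => ρ _ v
  | _, .obj c => .cst (σ := sig D k) (TConst.obj c)

/-- The control variable `c` of the case `j`. -/
def ctlTerm (j : Fin k) (c : CtlVar N) : ATerm (setting D N k) W I none :=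
  .var (.art (A := setting D N k) (j, Slot.ctl c))

def lifeTerm (l : LState) : ATerm (setting D N k) W I none :=
  .cst (σ := sig D k) (TConst.life l)

def undefTerm (S : D.Ty) : ATerm (setting D N k) W I (some S) :=
  .cst (σ := sig D k) (TConst.obj (D.undef S))

def readTerm (R : D.Repo) (a : Fin (D.repoArity R)) (i : I R) :
    ATerm (setting D N k) W I (some (D.repoAttr R a)) :=
  .var (.read (A := setting D N k) ⟨R, a⟩ i)

/-- The row of `R` with index `i` is the tuple `t`. -/
def rowEq (R : D.Repo) (i : I R)
    (t : ∀ a, ATerm (setting D N k) W I (some (D.repoAttr R a))) : QF (setting D N k) W I :=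
  QF.conj (List.ofFn fun a => QF.eq (readTerm R a i) (t a))

/-- Atoms; `ix` supplies the index variable for a repository atom, `life` the control variables. A
catalog atom `R(t₀, t)` becomes `t₀ ≠ undef ∧ ⋀ t_a = f_{R,a}(t₀)`. -/
def trAtom (j : Fin k) (ρ : ∀ S, V S → ATerm (setting D N k) W I (some S))
    (ix : ∀ R, I R) (life : C → CtlVar N) : Atom D V C → QF (setting D N k) W I
  | .eq t u => .eq (trQTerm j ρ t) (trQTerm j ρ u)
  | .cat R key args =>
      .and (.neg (.eq (trQTerm j ρ key) (undefTerm (D.catKey R))))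
        (QF.conj (List.ofFn fun a =>
          QF.eq (trQTerm j ρ (args a))
            (Term.app (σ := sig D k) (⟨R, a⟩ : Σ R : D.Cat, Fin (D.catArity R))
              (trQTerm j ρ key))))
  | .repo R args => rowEq R (ix R) fun a => trQTerm j ρ (args a)
  | .ctlState b l => .eq (ctlTerm j (life b)) (lifeTerm l)
  | .ctlEq b b' => .eq (ctlTerm j (life b)) (ctlTerm j (life b'))

/-- Conjunctive queries; the repository atom at position `p` gets the index variable `p + 1`, so
that distinct atoms get distinct variables, all different from the variable `0`. -/
def trCQ (j : Fin k) (ρ : ∀ S, V S → ATerm (setting D N k) W I (some S))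
    (ix : ℕ → ∀ R, I R) (life : C → CtlVar N) (Q : CQ D V C) : QF (setting D N k) W I :=
  QF.conj (Q.mapIdx fun p l =>
    let φ := trAtom j ρ (ix (p + 1)) life l.atom
    if l.positive then φ else .neg φ)

def trCond (j : Fin k) (ρ : ∀ S, NVar D S → ATerm (setting D N k) W I (some S)) :
    Cond D → QF (setting D N k) W I
  | .eq t u => .eq (trQTerm j ρ t) (trQTerm j ρ u)
  | .neg φ => .neg (trCond j ρ φ)
  | .and φ ψ => .and (trCond j ρ φ) (trCond j ρ ψ)

end Queries

/-- Normal variables become quantified variables of basic sorts. -/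
def stdVar (I : D.Repo → Type) : ∀ S, NVar D S → ATerm (setting D N k) (fun _ => ℕ) I (some S) :=
  fun S n => .var (.bas (A := setting D N k) (V := fun _ => ℕ) (S := (some S : Option D.Ty)) n)

/-- In a conditional update of `R`, the new variables become the attributes of the current row. -/
def rowVar (R : D.Repo) : ∀ S, UVar D R S →
    ATerm (setting D N k) (fun _ => ℕ) (WithCur (A := setting D N k) R) (some S)
  | _, .ans n => stdVar _ _ n
  | _, .new a => readTerm R a WithCur.cur

/-- The values of the attribute `a` produced by a conditional update. -/
def trBranch (j : Fin k) {R : D.Repo} (a : Fin (D.repoArity R)) : Branch D R →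
    CaseDef (setting D N k) (fun _ => ℕ) (WithCur (A := setting D N k) R)
      (some (D.repoAttr R a))
  | .tup u => .ret (trETerm (rowVar R) (u a))
  | .ite ψ b₁ b₂ =>
      .ite (QF.disj (ψ.map (trCQ j (rowVar R) (fun p _ => WithCur.old p) Empty.elim)))
        (trBranch j a b₁) (trBranch j a b₂)

/-- The two semantics of insertion. -/
inductive InsertSem
  | multiset
  | set

/-- The values of the attributes of the rows of `R` after an effect, as functions of the index. -/
abbrev RowUpdate (D : DataSchema) (N : Type) (k : ℕ) (R : D.Repo) : Type :=
  ∀ a : Fin (D.repoArity R), CaseDef (setting D N k) (fun _ => ℕ)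
    (WithCur (A := setting D N k) R) (some (D.repoAttr R a))

def keepRow (R : D.Repo) : RowUpdate D N k R := fun a => .ret (readTerm R a WithCur.cur)

/-- The tests added to the guard by an effect. The index variable `0` of `R` is the inserted or
deleted row: before an insertion it is undefined, before a deletion it is the deleted tuple. -/
def effGuard : Effect D → QF (setting D N k) (fun _ => ℕ) (fun _ => ℕ)
  | .insertSet R _ _ => rowEq R (0 : ℕ) fun a => undefTerm (D.repoAttr R a)
  | .deleteSet R u _ => rowEq R (0 : ℕ) fun a => trETerm (stdVar _) (u a)
  | .setOnly _ => .tru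
  | .update _ _ _ _ => .tru

def effSet : Effect D → SetPart D
  | .insertSet _ _ θ => θ
  | .setOnly θ => θ
  | .deleteSet _ _ θ => θ
  | .update _ _ _ _ => fun _ => none

/-- The row is the inserted or deleted one. -/
def isRow0 (R : D.Repo) :
    QF (setting D N k) (fun _ => ℕ) (WithCur (A := setting D N k) R) :=
  .idxEq (E := R) WithCur.cur (WithCur.old 0)

def effRows (sem : InsertSem) (j : Fin k) : Effect D → ∀ R, RowUpdate D N k R
  | .setOnly _ => keepRow
  | .insertSet R u _ => Function.update keepRow R fun a =>
      .ite (isRow0 R) (.ret (trETerm (stdVar _) (u a)))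
        (match sem with
          | .multiset => keepRow R a
          | .set => .ite (rowEq R WithCur.cur fun a => trETerm (stdVar _) (u a))
              (.ret (undefTerm _)) (keepRow R a))
  | .deleteSet R _ _ => Function.update keepRow R fun a =>
      .ite (isRow0 R) (.ret (undefTerm _)) (keepRow R a)
  | .update R ψ b₁ b₂ => Function.update keepRow R fun a => trBranch j a (.ite ψ b₁ b₂)

/-- New values of the artifact variables when the case `j` makes a step: its control variables are
assigned, its case variables are set, everything else is kept. -/
def trArt (j : Fin k) (r : Rule D N) (x : Fin k × Slot D N) :
    CaseDef (setting D N k) (fun _ => ℕ) (fun _ => ℕ) x.2.sort :=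
  if x.1 = j then
    match x with
    | (i, .self) => .ret (.var (.art (A := setting D N k) (i, Slot.self)))
    | (i, .data v) => .ret <|
        match r.eff.bind fun E => effSet E v with
        | some t => trETerm (stdVar _) t
        | none => .var (.art (A := setting D N k) (i, Slot.data v))
    | (i, .ctl c) => .ret <|
        match r.assigns.find? fun p => decide (p.1 = c) with
        | some p => lifeTerm p.2
        | none => ctlTerm i c
  else .ret (.var (.art (A := setting D N k) x))

/-- The transition formula of a rule for the case `j` and one disjunct `Q` of its precondition. -/
def trRule (sem : InsertSem) (j : Fin k) (r : Rule D N) (Q : CQ D (NVar D) Empty) :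
    Transition (setting D N k) where
  guard := QF.conj
    (r.tests.map (fun p => QF.eq (ctlTerm j p.1) (lifeTerm p.2)) ++
      r.conds.map (trCond j (stdVar _)) ++
      [trCQ j (stdVar _) (fun p _ => p) Empty.elim Q,
        match r.eff with
        | some E => effGuard E
        | none => .tru])
  art := trArt j r
  arr c :=
    match r.eff with
    | some E => effRows sem j E c.1 c.2
    | none => keepRow c.1 c.2

/-- Guards are split into their disjuncts; a missing precondition is `true`. -/
def Rule.disjuncts (r : Rule D N) : List (CQ D (NVar D) Empty) :=
  match r.pre with
  | some G => G.body
  | none => [[]]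

end Translation

/-- The system of a DAB with at most `k` cases. Initially all case variables are undefined except
`self`, all lifecycles are idle, and the repository is empty. -/
def Model.toSystem (M : Model) (sem : InsertSem) (k : ℕ)
    (Δ : ∀ S, TConst M.schema k S → TConst M.schema k S → Prop) : System (sig M.schema k) where
  theory := dbTheory (sig M.schema k) Δ
  setting := setting M.schema M.Name k
  startArt
    | (j, .self) => TConst.caseId j
    | (_, .data x) => TConst.obj (M.schema.undef (M.schema.cvTy x))
    | (_, .ctl _) => TConst.life .idle
  startArr c := TConst.obj (M.schema.undef (M.schema.repoAttr c.1 c.2))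
  trans := (List.finRange k).flatMap fun j => M.root.rules.flatMap fun r =>
    r.disjuncts.map (trRule sem j r)

/-- The states that satisfy a property: its guards hold for pairwise different cases. The normal
variables and the rows of each guard are existentially quantified. -/
def Property.toStateSet {M : Model} (P : Property M) (k : ℕ) :
    StateSet (setting M.schema M.Name k) := fun 𝔐 s =>
  ∃ f : Fin P.n ↪ Fin k, ∀ i, ∃ Q ∈ (P.guard i).body,
    ∃ (y : ∀ S, ℕ → 𝔐.Dom S) (e : ∀ E, ℕ → 𝔐.Idx E),
      (trCQ (f i) (stdVar _) (fun p _ => p) CtlVar.life Q).Holds s y e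

/-- `BackReach`, applied to a DAB with at most `k` cases and a property, terminates. -/
def BackReachTerminates (M : Model) (sem : InsertSem) (k : ℕ)
    (Δ : ∀ S, TConst M.schema k S → TConst M.schema k S → Prop) (P : Property M) : Prop :=
  (M.toSystem sem k Δ).Terminates (P.toStateSet k)

end DAB

end

noncomputable section

open Classical

namespace RAS

/-! ## Correspondences between structures -/

section Correspondences

variable {σ : Signature}

/-- The signature has finitely many functions, and the sorts are well-founded along them in both
directions. -/
structure Signature.Tame (σ : Signature) : Prop where
  finite_fn : Finite σ.Fn
  wf_tgt : WellFounded fun S' S => ∃ f, σ.src f = S ∧ σ.tgt f = S'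
  wf_src : WellFounded fun S S' => ∃ f, σ.src f = S ∧ σ.tgt f = S'

/-- The functions map exactly `undef` to `undef`. -/
def Struct.Strict (𝔄 : Struct σ) : Prop :=
  ∀ f (x : 𝔄.Dom (σ.src f)), x = 𝔄.cst (σ.undef _) ↔ 𝔄.fn f x = 𝔄.cst (σ.undef _)

theorem Struct.models_dbTheory_iff {𝔄 : Struct σ} {Δ : ∀ S, σ.Cst S → σ.Cst S → Prop} :
    𝔄.Models (dbTheory σ Δ) ↔
      𝔄.Strict ∧ ∀ S (c d : σ.Cst S), Δ S c d → 𝔄.cst c ≠ 𝔄.cst d := by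
  constructor
  · intro h
    refine ⟨fun f x => ?_, fun S c d hcd => ?_⟩
    · have := h (nullAxiom f) (Or.inl ⟨f, rfl⟩)
        (Function.update (fun S _ => 𝔄.cst (σ.undef S)) (σ.src f) fun _ => x)
      simp only [nullAxiom, Formula.Realize, Term.eval, Function.update_self] at this
      tauto
    · have := h _ (Or.inr ⟨S, c, d, hcd, rfl⟩) (fun S _ => 𝔄.cst (σ.undef S))
      simpa only [Formula.Realize, Term.eval] using this
  · rintro ⟨h₁, h₂⟩ φ (⟨f, rfl⟩ | ⟨S, c, d, hcd, rfl⟩) v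
    · simp only [nullAxiom, Formula.Realize, Term.eval]
      have := h₁ f (v _ 0)
      tauto
    · simpa only [Formula.Realize, Term.eval] using h₂ S c d hcd

/-- A bi-unique relation between two structures that is compatible with the functions, with
`undef`, and with the constants in `Cs`. -/
structure Corr (Cs : Set (Σ S, σ.Cst S)) (𝔄 𝔅 : Struct σ) where
  rel : ∀ {S}, 𝔄.Dom S → 𝔅.Dom S → Prop
  eq_iff : ∀ {S} {x x' : 𝔄.Dom S} {y y' : 𝔅.Dom S}, rel x y → rel x' y' → (x = x' ↔ y = y')
  fn : ∀ f {x : 𝔄.Dom (σ.src f)} {y : 𝔅.Dom (σ.src f)}, rel x y → rel (𝔄.fn f x) (𝔅.fn f y)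
  cst : ∀ {S} (c : σ.Cst S), ⟨S, c⟩ ∈ Cs → rel (𝔄.cst c) (𝔅.cst c)
  undef : ∀ S, rel (𝔄.cst (σ.undef S)) (𝔅.cst (σ.undef S))

/-- Correspondences that are finite in each sort. -/
structure PIso (Cs : Set (Σ S, σ.Cst S)) (𝔄 𝔅 : Struct σ) extends Corr Cs 𝔄 𝔅 where
  finite_dom : ∀ S, {x : 𝔄.Dom S | ∃ y, rel x y}.Finite
  finite_ran : ∀ S, {y : 𝔅.Dom S | ∃ x, rel x y}.Finite

variable {Cs : Set (Σ S, σ.Cst S)} {𝔄 𝔅 : Struct σ}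

/-- The identity. -/
def Corr.refl (Cs : Set (Σ S, σ.Cst S)) (𝔄 : Struct σ) : Corr Cs 𝔄 𝔄 where
  rel x y := x = y
  eq_iff := by rintro _ _ _ _ _ rfl rfl; rfl
  fn := by rintro _ _ _ rfl; rfl
  cst _ _ := rfl
  undef _ := rfl

def PIso.symm (ρ : PIso Cs 𝔄 𝔅) : PIso Cs 𝔅 𝔄 where
  rel x y := ρ.rel y x
  eq_iff h h' := (ρ.eq_iff h h').symm
  fn f _ _ h := ρ.fn f h
  cst c h := ρ.cst c h
  undef S := ρ.undef S
  finite_dom := ρ.finite_ran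
  finite_ran := ρ.finite_dom

instance : LE (PIso Cs 𝔄 𝔅) where
  le ρ ρ' := ∀ ⦃S⦄ ⦃x : 𝔄.Dom S⦄ ⦃y : 𝔅.Dom S⦄, ρ.rel x y → ρ'.rel x y

theorem PIso.le_refl (ρ : PIso Cs 𝔄 𝔅) : ρ ≤ ρ := fun _ _ _ h => h

theorem PIso.le_trans {ρ₁ ρ₂ ρ₃ : PIso Cs 𝔄 𝔅} (h : ρ₁ ≤ ρ₂) (h' : ρ₂ ≤ ρ₃) : ρ₁ ≤ ρ₃ :=
  fun _ _ _ hx => h' (h hx)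

/-- Models of the database theory in which every tuple of defined values is taken by the functions
at infinitely many arguments. -/
structure Struct.Rich (Δ : ∀ S, σ.Cst S → σ.Cst S → Prop) (𝔄 : Struct σ) : Prop where
  models : 𝔄.Models (dbTheory σ Δ)
  exists_fresh : ∀ (S : σ.Srt) (t : ∀ f, 𝔄.Dom (σ.tgt f)),
    (∀ f, S = σ.src f → t f ≠ 𝔄.cst (σ.undef _)) → ∀ F : Set (𝔄.Dom S), F.Finite →
      ∃ x, x ∉ F ∧ ∀ f (h : S = σ.src f), 𝔄.fn f (h ▸ x) = t f

theorem Struct.Rich.strict {Δ : ∀ S, σ.Cst S → σ.Cst S → Prop} (h : 𝔄.Rich Δ) : 𝔄.Strict :=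
  (Struct.models_dbTheory_iff.1 h.models).1

/-- Add one pair to a finite correspondence whose domain contains the function values. -/
theorem PIso.exists_insert (ρ : PIso Cs 𝔄 𝔅) {S : σ.Srt} {d : 𝔄.Dom S} {d' : 𝔅.Dom S}
    (hd : ∀ y, ¬ ρ.rel d y) (hd' : ∀ x, ¬ ρ.rel x d')
    (hf : ∀ f (h : S = σ.src f), ρ.rel (𝔄.fn f (h ▸ d)) (𝔅.fn f (h ▸ d'))) :
    ∃ ρ' : PIso Cs 𝔄 𝔅, ρ ≤ ρ' ∧ ρ'.rel d d' := by
  let r : ∀ {S'}, 𝔄.Dom S' → 𝔅.Dom S' → Prop := fun {S'} x y =>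
    ρ.rel x y ∨ ∃ h : S = S', x = h ▸ d ∧ y = h ▸ d'
  have eqn : ∀ {S'} (h : S = S') (x : 𝔄.Dom S') (y : 𝔅.Dom S'), ρ.rel x y →
      x ≠ h ▸ d ∧ y ≠ h ▸ d' := by
    rintro _ rfl x y hxy
    exact ⟨fun (h : x = d) => hd y (h ▸ hxy), fun (h : y = d') => hd' x (h ▸ hxy)⟩
  refine ⟨⟨⟨r, ?_, ?_, fun c hc => Or.inl (ρ.cst c hc), fun S => Or.inl (ρ.undef S)⟩, ?_, ?_⟩,
    fun _ _ _ h => Or.inl h, Or.inr ⟨rfl, rfl, rfl⟩⟩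
  · rintro S' x x' y y' (h | ⟨h, rfl, rfl⟩) (h' | ⟨h', rfl, rfl⟩)
    · exact ρ.eq_iff h h'
    · exact iff_of_false (eqn h' _ _ h).1 (eqn h' _ _ h).2
    · exact iff_of_false (eqn h _ _ h').1.symm (eqn h _ _ h').2.symm
    · exact iff_of_true rfl rfl
  · rintro f x y (h | ⟨h, rfl, rfl⟩)
    · exact Or.inl (ρ.fn f h)
    · exact Or.inl (hf f h)
  · intro S'
    by_cases h : S = S'
    · subst h
      refine ((ρ.finite_dom S).insert d).subset ?_
      rintro x ⟨y, h | ⟨_, rfl, _⟩⟩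
      · exact Or.inr ⟨y, h⟩
      · exact Or.inl rfl
    · refine (ρ.finite_dom S').subset ?_
      rintro x ⟨y, h' | ⟨h', _⟩⟩
      · exact ⟨y, h'⟩
      · exact absurd h' h
  · intro S'
    by_cases h : S = S'
    · subst h
      refine ((ρ.finite_ran S).insert d').subset ?_
      rintro x ⟨y, h | ⟨_, _, rfl⟩⟩
      · exact Or.inr ⟨y, h⟩
      · exact Or.inl rfl
    · refine (ρ.finite_ran S').subset ?_
      rintro x ⟨y, h' | ⟨h', _⟩⟩
      · exact ⟨y, h'⟩
      · exact absurd h' h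

theorem PIso.exists_le_of_list (P : (Σ S, 𝔄.Dom S) → Prop)
    (step : ∀ p, P p → ∀ ρ : PIso Cs 𝔄 𝔅, ∃ ρ' : PIso Cs 𝔄 𝔅, ρ ≤ ρ' ∧ ∃ y, ρ'.rel p.2 y)
    (l : List (Σ S, 𝔄.Dom S)) (hl : ∀ p ∈ l, P p) (ρ : PIso Cs 𝔄 𝔅) :
    ∃ ρ' : PIso Cs 𝔄 𝔅, ρ ≤ ρ' ∧ ∀ p ∈ l, ∃ y, ρ'.rel p.2 y := by
  induction l generalizing ρ with
  | nil => exact ⟨ρ, ρ.le_refl, by simp⟩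
  | cons p l ih =>
    obtain ⟨ρ₁, h₁, y, hy⟩ := step p (hl p (by simp)) ρ
    obtain ⟨ρ₂, h₂, hl₂⟩ := ih (fun q hq => hl q (by simp [hq])) ρ₁
    refine ⟨ρ₂, le_trans h₁ h₂, fun q hq => ?_⟩
    rcases List.mem_cons.1 hq with rfl | hq
    · exact ⟨y, h₂ hy⟩
    · exact hl₂ q hq

/-- Finite correspondences into rich structures can be extended. -/
theorem PIso.exists_extend {Δ : ∀ S, σ.Cst S → σ.Cst S → Prop} (hσ : σ.Tame) (h𝔄 : 𝔄.Strict)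
    (h𝔅 : 𝔅.Rich Δ) (S : σ.Srt) (d : 𝔄.Dom S) (ρ : PIso Cs 𝔄 𝔅) :
    ∃ ρ' : PIso Cs 𝔄 𝔅, ρ ≤ ρ' ∧ ∃ d', ρ'.rel d d' := by
  induction S using hσ.wf_tgt.induction generalizing ρ with
  | _ S ih =>
  have := hσ.finite_fn
  have := Fintype.ofFinite {f // S = σ.src f}
  let g : {f // S = σ.src f} → Σ S, 𝔄.Dom S := fun f => ⟨σ.tgt f.1, 𝔄.fn f.1 (f.2 ▸ d)⟩
  obtain ⟨ρ₁, h₁, hl⟩ := PIso.exists_le_of_list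
    (fun p => ∃ f, σ.src f = S ∧ σ.tgt f = p.1) (fun p hp ρ => ih p.1 hp p.2 ρ)
    ((Finset.univ : Finset {f // S = σ.src f}).toList.map g) (by
        intro p hp
        obtain ⟨f, -, rfl⟩ := List.mem_map.1 hp
        exact ⟨f.1, f.2.symm, rfl⟩) ρ
  have hl' : ∀ f (h : S = σ.src f), ∃ y, ρ₁.rel (𝔄.fn f (h ▸ d)) y := fun f h =>
    hl ⟨σ.tgt f, 𝔄.fn f (h ▸ d)⟩ (List.mem_map.2 ⟨⟨f, h⟩, by simp, rfl⟩)
  by_cases hd : ∃ y, ρ₁.rel d y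
  · exact ⟨ρ₁, h₁, hd⟩
  have key : ∀ f, ∃ b : 𝔅.Dom (σ.tgt f), ∀ h : S = σ.src f,
      ρ₁.rel (𝔄.fn f (h ▸ d)) b ∧ b ≠ 𝔅.cst (σ.undef _) := by
    intro f
    by_cases h : S = σ.src f
    · obtain ⟨b, hb⟩ := hl' f h
      refine ⟨b, fun _ => ⟨hb, fun hbu => hd ?_⟩⟩
      have h1 := (ρ₁.eq_iff hb (ρ₁.undef _)).2 hbu
      rw [← h𝔄] at h1
      subst h
      have h2 : d = _ := h1
      exact ⟨_, h2 ▸ ρ₁.undef _⟩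
    · exact ⟨𝔅.cst (σ.undef _), fun h' => absurd h' h⟩
  choose b hb using key
  obtain ⟨d', hd', hfd⟩ := h𝔅.exists_fresh S b (fun f h => (hb f h).2) _ (ρ₁.finite_ran S)
  obtain ⟨ρ₂, h₂, hdd⟩ := ρ₁.exists_insert (d := d) (d' := d') (fun y hy => hd ⟨y, hy⟩)
    (fun x hx => hd' ⟨x, hx⟩) (fun f h => by rw [hfd f h]; exact (hb f h).1)
  exact ⟨ρ₂, le_trans h₁ h₂, d', hdd⟩

theorem PIso.exists_extend_assignment {Δ : ∀ S, σ.Cst S → σ.Cst S → Prop} (hσ : σ.Tame)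
    (h𝔄 : 𝔄.Strict) (h𝔅 : 𝔅.Rich Δ) {V : σ.Srt → Type} {X : Set (Σ S, V S)} (hX : X.Finite)
    (y : ∀ S, V S → 𝔄.Dom S) (ρ : PIso Cs 𝔄 𝔅) :
    ∃ ρ' : PIso Cs 𝔄 𝔅, ρ ≤ ρ' ∧
      ∃ y' : ∀ S, V S → 𝔅.Dom S, ∀ x ∈ X, ρ'.rel (y x.1 x.2) (y' x.1 x.2) := by
  let g : (Σ S, V S) → Σ S, 𝔄.Dom S := fun x => ⟨x.1, y x.1 x.2⟩
  obtain ⟨ρ', h, hl⟩ := PIso.exists_le_of_list (fun _ => True)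
    (fun p _ ρ => PIso.exists_extend hσ h𝔄 h𝔅 p.1 p.2 ρ)
    (hX.toFinset.toList.map g) (fun _ _ => trivial) ρ
  refine ⟨ρ', h, fun S v => if hv : ∃ b, ρ'.rel (y S v) b then hv.choose else 𝔅.cst (σ.undef S),
    fun x hx => ?_⟩
  have hv : ∃ b, ρ'.rel (y x.1 x.2) b :=
    hl ⟨x.1, y x.1 x.2⟩ (List.mem_map.2 ⟨x, by simpa using hx, rfl⟩)
  beta_reduce
  rw [dif_pos hv]
  exact hv.choose_spec

end Correspondences

/-! ## Terms with restricted variables and constants -/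

section Terms

variable {σ : Signature} {V : σ.Srt → Type}

/-- The variables of the term belong to `X`, its constants to `Cs`. -/
def Term.In (X : Set (Σ S, V S)) (Cs : Set (Σ S, σ.Cst S)) : {S : σ.Srt} → Term σ V S → Prop
  | S, .var v => ⟨S, v⟩ ∈ X
  | S, .cst c => ⟨S, c⟩ ∈ Cs
  | _, .app _ t => t.In X Cs

variable {X X' : Set (Σ S, V S)} {Cs Cs' : Set (Σ S, σ.Cst S)}

theorem Term.In.mono (hX : X ⊆ X') (hC : Cs ⊆ Cs') {S : σ.Srt} {t : Term σ V S}
    (h : t.In X Cs) : t.In X' Cs' := by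
  induction t with
  | var v => exact hX h
  | cst c => exact hC h
  | app f t ih => exact ih h

theorem Term.exists_in {S : σ.Srt} (t : Term σ V S) :
    ∃ X : Set (Σ S, V S), X.Finite ∧ ∃ Cs : Set (Σ S, σ.Cst S), Cs.Finite ∧ t.In X Cs := by
  induction t with
  | @var S v => exact ⟨{⟨S, v⟩}, Set.finite_singleton _, ∅, Set.finite_empty,
      Set.mem_singleton _⟩
  | @cst S c => exact ⟨∅, Set.finite_empty, {⟨S, c⟩}, Set.finite_singleton _,
      Set.mem_singleton _⟩
  | app f t ih => exact ih

theorem Corr.rel_eval {𝔄 𝔅 : Struct σ} (ρ : Corr Cs 𝔄 𝔅) {v : ∀ S, V S → 𝔄.Dom S}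
    {w : ∀ S, V S → 𝔅.Dom S} (hv : ∀ x ∈ X, ρ.rel (v x.1 x.2) (w x.1 x.2)) {S : σ.Srt}
    {t : Term σ V S} (ht : t.In X Cs) : ρ.rel (t.eval 𝔄 v) (t.eval 𝔅 w) := by
  induction t with
  | var v => exact hv _ ht
  | cst c => exact ρ.cst c ht
  | app f t ih => exact ρ.fn f (ih ht)

theorem Term.finite_in (hσ : σ.Tame) (hX : X.Finite) (hC : Cs.Finite) :
    {p : Σ S, Term σ V S | p.2.In X Cs}.Finite := by
  have := hσ.finite_fn
  let g : σ.Fn → (Σ S, Term σ V S) → Σ S, Term σ V S := fun f p =>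
    if h : p.1 = σ.src f then ⟨σ.tgt f, .app f (h ▸ p.2)⟩ else p
  have cover : ∀ F : Set σ.Fn,
      (∀ f ∈ F, {p : Σ S, Term σ V S | p.1 = σ.src f ∧ p.2.In X Cs}.Finite) →
      {p : Σ S, Term σ V S | p.2.In X Cs ∧ ∀ f, σ.tgt f = p.1 → f ∈ F}.Finite := by
    intro F hF
    refine (((hX.image fun x => (⟨x.1, .var x.2⟩ : Σ S, Term σ V S)).union
      (hC.image fun c => (⟨c.1, .cst c.2⟩ : Σ S, Term σ V S))).union
      (F.toFinite.biUnion fun f hf => (hF f hf).image (g f))).subset ?_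
    rintro ⟨S, t⟩ ⟨ht, hS⟩
    cases t with
    | var v => exact Or.inl (Or.inl ⟨_, ht, rfl⟩)
    | cst c => exact Or.inl (Or.inr ⟨_, ht, rfl⟩)
    | app f t =>
      refine Or.inr (Set.mem_biUnion (hS f rfl) ⟨⟨_, t⟩, ⟨rfl, ht⟩, ?_⟩)
      simp [g]
  have main : ∀ S, {p : Σ S, Term σ V S | p.1 = S ∧ p.2.In X Cs}.Finite := by
    intro S
    induction S using hσ.wf_src.induction with
    | _ S ih =>
    refine (cover {f | σ.tgt f = S} fun f hf => ih _ ⟨f, rfl, hf⟩).subset ?_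
    rintro ⟨S', t⟩ ⟨rfl, ht⟩
    exact ⟨ht, fun f hf => hf⟩
  exact (cover Set.univ fun f _ => main _).subset fun p hp => ⟨hp, fun _ _ => trivial⟩

/-- Assignments that satisfy the same equations between terms are related by a finite
correspondence. -/
theorem exists_pIso_of_eval {𝔄 𝔅 : Struct σ} (hσ : σ.Tame) (h𝔄 : 𝔄.Strict) (h𝔅 : 𝔅.Strict)
    (hX : X.Finite) (hC : Cs.Finite) (v : ∀ S, V S → 𝔄.Dom S) (w : ∀ S, V S → 𝔅.Dom S)
    (heq : ∀ S (t u : Term σ V S), t.In X Cs → u.In X Cs →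
      (t.eval 𝔄 v = u.eval 𝔄 v ↔ t.eval 𝔅 w = u.eval 𝔅 w))
    (hundef : ∀ S (t : Term σ V S), t.In X Cs →
      (t.eval 𝔄 v = 𝔄.cst (σ.undef S) ↔ t.eval 𝔅 w = 𝔅.cst (σ.undef S))) :
    ∃ ρ : PIso Cs 𝔄 𝔅, ∀ x ∈ X, ρ.rel (v x.1 x.2) (w x.1 x.2) := by
  have hfin := Term.finite_in hσ hX hC
  refine ⟨⟨⟨fun {S} x y => (∃ t : Term σ V S, t.In X Cs ∧ x = t.eval 𝔄 v ∧ y = t.eval 𝔅 w) ∨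
    (x = 𝔄.cst (σ.undef S) ∧ y = 𝔅.cst (σ.undef S)), ?_, ?_,
    fun c hc => Or.inl ⟨.cst c, hc, rfl, rfl⟩, fun S => Or.inr ⟨rfl, rfl⟩⟩, ?_, ?_⟩,
    fun x hx => Or.inl ⟨.var x.2, hx, rfl, rfl⟩⟩
  · rintro S x x' y y' (⟨t, ht, rfl, rfl⟩ | ⟨rfl, rfl⟩) (⟨u, hu, rfl, rfl⟩ | ⟨rfl, rfl⟩)
    · exact heq S t u ht hu
    · exact hundef S t ht
    · rw [eq_comm, hundef S u hu, eq_comm]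
    · simp
  · rintro f x y (⟨t, ht, rfl, rfl⟩ | ⟨rfl, rfl⟩)
    · exact Or.inl ⟨.app f t, ht, rfl, rfl⟩
    · exact Or.inr ⟨(h𝔄 f _).1 rfl, (h𝔅 f _).1 rfl⟩
  · intro S
    refine ((((hfin.image fun p : (Σ S, Term σ V S) => (⟨p.1, p.2.eval 𝔄 v⟩ : Σ S, 𝔄.Dom S)).insert
      ⟨S, 𝔄.cst (σ.undef S)⟩).preimage
        (f := fun x => (⟨S, x⟩ : Σ S, 𝔄.Dom S)) (sigma_mk_injective.injOn))).subset ?_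
    rintro x ⟨y, ⟨t, ht, rfl, rfl⟩ | ⟨rfl, rfl⟩⟩
    · exact Or.inr ⟨⟨S, t⟩, ht, rfl⟩
    · exact Or.inl rfl
  · intro S
    refine ((((hfin.image fun p : (Σ S, Term σ V S) => (⟨p.1, p.2.eval 𝔅 w⟩ : Σ S, 𝔅.Dom S)).insert
      ⟨S, 𝔅.cst (σ.undef S)⟩).preimage
        (f := fun x => (⟨S, x⟩ : Σ S, 𝔅.Dom S)) (sigma_mk_injective.injOn))).subset ?_
    rintro x ⟨y, ⟨t, ht, rfl, rfl⟩ | ⟨rfl, rfl⟩⟩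
    · exact Or.inr ⟨⟨S, t⟩, ht, rfl⟩
    · exact Or.inl rfl

/-- The variables of a finite sorted family. -/
inductive FamVar {ι : Type} (so : ι → σ.Srt) : σ.Srt → Type
  | mk (i : ι) : FamVar so (so i)

def FamVar.eval {ι : Type} {so : ι → σ.Srt} {𝔄 : Struct σ} (d : ∀ i, 𝔄.Dom (so i)) :
    (S : σ.Srt) → FamVar so S → 𝔄.Dom S
  | _, .mk i => d i

/-- Finite families of elements have finitely many types over a finite set of constants. -/
theorem exists_finite_types (hσ : σ.Tame) (hC : Cs.Finite) {ι : Type} [Finite ι]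
    (so : ι → σ.Srt) :
    ∃ (Θ : Type) (_ : Finite Θ) (tp : ∀ 𝔄 : Struct σ, (∀ i, 𝔄.Dom (so i)) → Θ),
      ∀ 𝔄 𝔅 : Struct σ, 𝔄.Strict → 𝔅.Strict → ∀ d d', tp 𝔄 d = tp 𝔅 d' →
        ∃ ρ : PIso Cs 𝔄 𝔅, ∀ i, ρ.rel (d i) (d' i) := by
  let X : Set (Σ S, FamVar so S) := Set.univ
  have hX : X.Finite := by
    have : Finite (Σ S, FamVar so S) := Finite.of_surjective (fun i : ι => ⟨so i, .mk i⟩) (by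
      rintro ⟨_, ⟨i⟩⟩
      exact ⟨i, rfl⟩)
    exact Set.toFinite _
  let Tm := {p : Σ S, Term σ (FamVar so) S // p.2.In X Cs}
  have hTm : Finite Tm := (Term.finite_in hσ hX hC).to_subtype
  refine ⟨Set (Tm × Tm) × Set Tm, inferInstance, fun 𝔄 d =>
    ({q | (⟨q.1.1.1, q.1.1.2.eval 𝔄 (FamVar.eval d)⟩ : Σ S, 𝔄.Dom S) =
        ⟨q.2.1.1, q.2.1.2.eval 𝔄 (FamVar.eval d)⟩},
      {p | p.1.2.eval 𝔄 (FamVar.eval d) = 𝔄.cst (σ.undef _)}), ?_⟩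
  intro 𝔄 𝔅 h𝔄 h𝔅 d d' h
  obtain ⟨h₁, h₂⟩ := Prod.mk.inj h
  obtain ⟨ρ, hρ⟩ := exists_pIso_of_eval (X := X) hσ h𝔄 h𝔅 hX hC (FamVar.eval d) (FamVar.eval d')
    (fun S t u ht hu => by
      have := Set.ext_iff.1 h₁ (⟨⟨S, t⟩, ht⟩, ⟨⟨S, u⟩, hu⟩)
      simpa using this)
    (fun S t ht => Set.ext_iff.1 h₂ ⟨⟨S, t⟩, ht⟩)
  exact ⟨ρ, fun i => hρ ⟨so i, .mk i⟩ trivial⟩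

end Terms

/-! ## Rich extensions -/

section RichExtension

variable {σ : Signature}

/-- The elements of a rich extension: old elements, elements with prescribed values of the
functions, and in each sort a defined element on which the functions are defined. -/
inductive Struct.RichDom (𝔄 : Struct σ) : σ.Srt → Type
  | base {S : σ.Srt} (a : 𝔄.Dom S) : RichDom 𝔄 S
  | fresh {S : σ.Srt} (n : ℕ) (t : ∀ f, S = σ.src f → RichDom 𝔄 (σ.tgt f)) : RichDom 𝔄 S
  | dflt (S : σ.Srt) : RichDom 𝔄 S

def Struct.RichDom.apply {𝔄 : Struct σ} {S : σ.Srt} (f : σ.Fn) (h : S = σ.src f) :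
    𝔄.RichDom S → 𝔄.RichDom (σ.tgt f)
  | .base a => .base (𝔄.fn f (h ▸ a))
  | .fresh _ t =>
      if t f h = .base (𝔄.cst (σ.undef _)) then .dflt _ else t f h
  | .dflt _ => .dflt _

def Struct.richExt (𝔄 : Struct σ) : Struct σ where
  Dom := 𝔄.RichDom
  fn f := Struct.RichDom.apply f rfl
  cst c := .base (𝔄.cst c)

theorem Struct.richExt_rich {Δ : ∀ S, σ.Cst S → σ.Cst S → Prop} {𝔄 : Struct σ}
    (h : 𝔄.Models (dbTheory σ Δ)) : 𝔄.richExt.Rich Δ := by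
  obtain ⟨h₁, h₂⟩ := Struct.models_dbTheory_iff.1 h
  refine ⟨Struct.models_dbTheory_iff.2 ⟨fun f x => ?_, fun S c d hcd heq => ?_⟩, ?_⟩
  · have aux : ∀ S (x : 𝔄.RichDom S) (e : S = σ.src f),
        x = .base (𝔄.cst (σ.undef S)) ↔ x.apply f e = .base (𝔄.cst (σ.undef _)) := by
      intro S x e
      subst e
      cases x with
      | base a =>
        simp only [RichDom.apply, RichDom.base.injEq]
        exact h₁ f a
      | fresh n t =>
        simp only [RichDom.apply, reduceCtorEq, false_iff]
        split_ifs with hc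
        · simp
        · exact hc
      | dflt S => simp [RichDom.apply]
    exact aux _ x rfl
  · exact h₂ S c d hcd (by simpa [Struct.richExt] using heq)
  · intro S t ht F hF
    let g : ℕ → 𝔄.richExt.Dom S := fun n => RichDom.fresh n fun f _ => t f
    have hg : Function.Injective g := fun m n hmn => by
      have h' : RichDom.fresh m (fun f _ => t f) =
          (RichDom.fresh n (fun f _ => t f) : 𝔄.RichDom S) :=
        hmn
      exact (RichDom.fresh.inj h').1
    obtain ⟨x, ⟨n, rfl⟩, hx⟩ := (Set.infinite_range_of_injective hg).exists_notMem_finite hF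
    refine ⟨g n, hx, fun f e => ?_⟩
    subst e
    have : t f ≠ RichDom.base (𝔄.cst (σ.undef _)) := ht f rfl
    exact if_neg this

theorem Struct.eval_richExt {𝔄 : Struct σ} {V : σ.Srt → Type} (v : ∀ S, V S → 𝔄.Dom S)
    {S : σ.Srt} (t : Term σ V S) :
    t.eval 𝔄.richExt (fun S x => .base (v S x)) = .base (t.eval 𝔄 v) := by
  induction t with
  | var x => rfl
  | cst c => rfl
  | app f t ih =>
    simp only [Term.eval]
    rw [ih]
    rfl

theorem Struct.realize_richExt {𝔄 : Struct σ} {φ : Formula σ} (h : φ.QuantifierFree)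
    (v : ∀ S, ℕ → 𝔄.Dom S) :
    φ.Realize 𝔄.richExt (fun S n => .base (v S n)) ↔ φ.Realize 𝔄 v := by
  induction φ with
  | eq t u =>
    simp only [Formula.Realize]
    rw [Struct.eval_richExt, Struct.eval_richExt]
    exact ⟨fun h => RichDom.base.inj h, fun h => congrArg _ h⟩
  | neg φ ih => exact not_congr (ih h)
  | and φ ψ ih₁ ih₂ => exact and_congr (ih₁ h.1) (ih₂ h.2)
  | all => exact h.elim

end RichExtension

/-! ## Quantifier elimination -/

/-- A property that is determined by the truth values of finitely many formulae is a boolean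
combination of them. -/
theorem exists_boolean_combination {Ω : Type*} {F : Type*} (sat : F → Ω → Prop)
    (htru : ∃ a, ∀ ω, sat a ω) (hneg : ∀ a, ∃ b, ∀ ω, sat b ω ↔ ¬ sat a ω)
    (hand : ∀ a b, ∃ c, ∀ ω, sat c ω ↔ sat a ω ∧ sat b ω) (L : List F) (K P : Ω → Prop)
    (h : ∀ ω ω', K ω → K ω' → (∀ a ∈ L, sat a ω ↔ sat a ω') → (P ω ↔ P ω')) :
    ∃ b, ∀ ω, K ω → (P ω ↔ sat b ω) := by
  induction L generalizing K with
  | nil =>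
    obtain ⟨a, ha⟩ := htru
    by_cases hP : ∃ ω, K ω ∧ P ω
    · obtain ⟨ω₀, hK, hP⟩ := hP
      exact ⟨a, fun ω hω => iff_of_true ((h ω₀ ω hK hω (by simp)).1 hP) (ha ω)⟩
    · obtain ⟨b, hb⟩ := hneg a
      exact ⟨b, fun ω hω => iff_of_false (fun h' => hP ⟨ω, hω, h'⟩) (by simp [hb, ha])⟩
  | cons a L ih =>
    obtain ⟨b₁, h₁⟩ := ih (fun ω => K ω ∧ sat a ω) fun ω ω' hω hω' hL =>
      h ω ω' hω.1 hω'.1 (by simpa [hω.2, hω'.2] using hL)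
    obtain ⟨b₂, h₂⟩ := ih (fun ω => K ω ∧ ¬ sat a ω) fun ω ω' hω hω' hL =>
      h ω ω' hω.1 hω'.1 (by simpa [hω.2, hω'.2] using hL)
    obtain ⟨na, hna⟩ := hneg a
    obtain ⟨nb₁, hnb₁⟩ := hneg b₁
    obtain ⟨nb₂, hnb₂⟩ := hneg b₂
    obtain ⟨c₁, hc₁⟩ := hand a nb₁
    obtain ⟨c₂, hc₂⟩ := hand na nb₂
    obtain ⟨d₁, hd₁⟩ := hneg c₁
    obtain ⟨d₂, hd₂⟩ := hneg c₂
    obtain ⟨b, hb⟩ := hand d₁ d₂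
    refine ⟨b, fun ω hω => ?_⟩
    rw [hb, hd₁, hd₂, hc₁, hc₂, hna, hnb₁, hnb₂]
    by_cases ha : sat a ω
    · simp [ha, h₁ ω ⟨hω, ha⟩]
    · simp [ha, h₂ ω ⟨hω, ha⟩]

section Elimination

variable {σ : Signature}

/-- Finitely many equations determine a family of elements up to correspondence. -/
theorem exists_equations (hσ : σ.Tame) {V : σ.Srt → Type} {X : Set (Σ S, V S)} (hX : X.Finite)
    {Cs : Set (Σ S, σ.Cst S)} (hC : Cs.Finite) :
    ∃ E : List (Σ S, Term σ V S × Term σ V S), ∀ 𝔄 𝔅 : Struct σ, 𝔄.Strict → 𝔅.Strict →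
      ∀ (v : ∀ S, V S → 𝔄.Dom S) (w : ∀ S, V S → 𝔅.Dom S),
        (∀ p ∈ E, p.2.1.eval 𝔄 v = p.2.2.eval 𝔄 v ↔ p.2.1.eval 𝔅 w = p.2.2.eval 𝔅 w) →
        ∃ ρ : PIso Cs 𝔄 𝔅, ∀ x ∈ X, ρ.rel (v x.1 x.2) (w x.1 x.2) := by
  have hfin := Term.finite_in hσ hX hC
  let g : (Σ S, Term σ V S) × (Σ S, Term σ V S) → Σ S, Term σ V S × Term σ V S := fun p =>
    if h : p.2.1 = p.1.1 then ⟨p.1.1, p.1.2, h ▸ p.2.2⟩ else ⟨p.1.1, p.1.2, p.1.2⟩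
  let g' : (Σ S, Term σ V S) → Σ S, Term σ V S × Term σ V S := fun p =>
    ⟨p.1, p.2, .cst (σ.undef p.1)⟩
  have hE := ((hfin.prod hfin).image g).union (hfin.image g')
  refine ⟨hE.toFinset.toList, fun 𝔄 𝔅 h𝔄 h𝔅 v w h => ?_⟩
  have h' : ∀ p ∈ g '' _ ∪ g' '' _,
      (p.2.1.eval 𝔄 v = p.2.2.eval 𝔄 v ↔ p.2.1.eval 𝔅 w = p.2.2.eval 𝔅 w) :=
    fun p hp => h p (by rw [Finset.mem_toList, Set.Finite.mem_toFinset]; exact hp)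
  refine exists_pIso_of_eval hσ h𝔄 h𝔅 hX hC v w (fun S t u ht hu => ?_) (fun S t ht => ?_)
  · have := h' _ (Or.inl ⟨(⟨S, t⟩, ⟨S, u⟩), ⟨ht, hu⟩, rfl⟩)
    rwa [show g (⟨S, t⟩, ⟨S, u⟩) = ⟨S, t, u⟩ from dif_pos rfl] at this
  · exact h' _ (Or.inr ⟨⟨S, t⟩, ht, rfl⟩)

/-- All variables of the formula belong to `X`, its constants to `Cs`. -/
def Formula.In (X : Set (Σ _ : σ.Srt, ℕ)) (Cs : Set (Σ S, σ.Cst S)) : Formula σ → Prop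
  | .eq t u => t.In X Cs ∧ u.In X Cs
  | .neg φ => φ.In X Cs
  | .and φ ψ => φ.In X Cs ∧ ψ.In X Cs
  | .all S n φ => ⟨S, n⟩ ∈ X ∧ φ.In X Cs

theorem Formula.In.mono {X X' : Set (Σ _ : σ.Srt, ℕ)} {Cs Cs' : Set (Σ S, σ.Cst S)}
    (hX : X ⊆ X') (hC : Cs ⊆ Cs') {φ : Formula σ} (h : φ.In X Cs) : φ.In X' Cs' := by
  induction φ with
  | eq t u => exact ⟨h.1.mono hX hC, h.2.mono hX hC⟩
  | neg φ ih => exact ih h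
  | and φ ψ ih₁ ih₂ => exact ⟨ih₁ h.1, ih₂ h.2⟩
  | all S n φ ih => exact ⟨hX h.1, ih h.2⟩

theorem Formula.exists_in (φ : Formula σ) : ∃ X : Set (Σ _ : σ.Srt, ℕ), X.Finite ∧
    ∃ Cs : Set (Σ S, σ.Cst S), Cs.Finite ∧ φ.In X Cs := by
  induction φ with
  | eq t u =>
    obtain ⟨X, hX, C, hC, h⟩ := t.exists_in
    obtain ⟨X', hX', C', hC', h'⟩ := u.exists_in
    exact ⟨_, hX.union hX', _, hC.union hC', h.mono Set.subset_union_left Set.subset_union_left,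
      h'.mono Set.subset_union_right Set.subset_union_right⟩
  | neg φ ih => exact ih
  | and φ ψ ih₁ ih₂ =>
    obtain ⟨X, hX, C, hC, h⟩ := ih₁
    obtain ⟨X', hX', C', hC', h'⟩ := ih₂
    exact ⟨_, hX.union hX', _, hC.union hC', h.mono Set.subset_union_left Set.subset_union_left,
      h'.mono Set.subset_union_right Set.subset_union_right⟩
  | all S n φ ih =>
    obtain ⟨X, hX, C, hC, h⟩ := ih
    exact ⟨_, hX.insert ⟨S, n⟩, C, hC, Set.mem_insert _ _, h.mono (Set.subset_insert _ _) le_rfl⟩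

theorem Formula.nonempty_sort (φ : Formula σ) : Nonempty σ.Srt := by
  induction φ with
  | @eq S t u => exact ⟨S⟩
  | neg φ ih => exact ih
  | and φ ψ ih₁ ih₂ => exact ih₁
  | all S n φ ih => exact ⟨S⟩

theorem Formula.realize_iff_of_corr {X : Set (Σ _ : σ.Srt, ℕ)} {Cs : Set (Σ S, σ.Cst S)}
    {𝔄 𝔅 : Struct σ} (ρ : Corr Cs 𝔄 𝔅) {v : ∀ S, ℕ → 𝔄.Dom S} {w : ∀ S, ℕ → 𝔅.Dom S}
    (hv : ∀ x ∈ X, ρ.rel (v x.1 x.2) (w x.1 x.2)) {φ : Formula σ} (hφ : φ.QuantifierFree)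
    (h : φ.In X Cs) : φ.Realize 𝔄 v ↔ φ.Realize 𝔅 w := by
  induction φ with
  | eq t u => exact ρ.eq_iff (ρ.rel_eval hv h.1) (ρ.rel_eval hv h.2)
  | neg φ ih => exact not_congr (ih hφ h)
  | and φ ψ ih₁ ih₂ => exact and_congr (ih₁ hφ.1 h.1) (ih₂ hφ.2 h.2)
  | all => exact hφ.elim

theorem PIso.rel_update {X : Set (Σ _ : σ.Srt, ℕ)} {Cs : Set (Σ S, σ.Cst S)} {𝔄 𝔅 : Struct σ}
    (ρ : PIso Cs 𝔄 𝔅) {v : ∀ S, ℕ → 𝔄.Dom S} {w : ∀ S, ℕ → 𝔅.Dom S}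
    (hv : ∀ x ∈ X, ρ.rel (v x.1 x.2) (w x.1 x.2)) {S : σ.Srt} {n : ℕ} {d : 𝔄.Dom S}
    {d' : 𝔅.Dom S} (hd : ρ.rel d d') : ∀ x ∈ X,
      ρ.rel (Function.update v S (Function.update (v S) n d) x.1 x.2)
        (Function.update w S (Function.update (w S) n d') x.1 x.2) := by
  rintro ⟨S', m⟩ hx
  by_cases hS : S' = S
  · subst hS
    by_cases hm : m = n
    · subst hm
      simpa using hd
    · simpa [hm] using hv _ hx
  · simpa [Function.update_of_ne hS] using hv _ hx

theorem Formula.realize_iff_of_rich {Δ : ∀ S, σ.Cst S → σ.Cst S → Prop} (hσ : σ.Tame)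
    {X : Set (Σ _ : σ.Srt, ℕ)} {Cs : Set (Σ S, σ.Cst S)}
    {𝔄 𝔅 : Struct σ} (h𝔄 : 𝔄.Rich Δ) (h𝔅 : 𝔅.Rich Δ) {φ : Formula σ} (h : φ.In X Cs)
    (ρ : PIso Cs 𝔄 𝔅) {v : ∀ S, ℕ → 𝔄.Dom S} {w : ∀ S, ℕ → 𝔅.Dom S}
    (hv : ∀ x ∈ X, ρ.rel (v x.1 x.2) (w x.1 x.2)) : φ.Realize 𝔄 v ↔ φ.Realize 𝔅 w := by
  induction φ generalizing ρ v w with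
  | eq t u => exact ρ.eq_iff (ρ.rel_eval hv h.1) (ρ.rel_eval hv h.2)
  | neg φ ih => exact not_congr (ih h ρ hv)
  | and φ ψ ih₁ ih₂ => exact and_congr (ih₁ h.1 ρ hv) (ih₂ h.2 ρ hv)
  | all S n φ ih =>
    constructor
    · intro hall d'
      obtain ⟨ρ', hρ, d, hd⟩ := PIso.exists_extend hσ h𝔅.strict h𝔄 S d' ρ.symm
      exact (ih h.2 ρ'.symm (ρ'.symm.rel_update (fun x hx => hρ (hv x hx)) hd)).1 (hall d)
    · intro hall d
      obtain ⟨ρ', hρ, d', hd⟩ := PIso.exists_extend hσ h𝔄.strict h𝔅 S d ρ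
      exact (ih h.2 ρ' (ρ'.rel_update (fun x hx => hρ (hv x hx)) hd)).2 (hall d')

/-- Rich structures eliminate quantifiers, uniformly. -/
theorem Formula.exists_quantifierFree {Δ : ∀ S, σ.Cst S → σ.Cst S → Prop} (hσ : σ.Tame)
    (φ : Formula σ) : ∃ ψ : Formula σ, ψ.QuantifierFree ∧
      ∀ 𝔄 : Struct σ, 𝔄.Rich Δ → ∀ v, φ.Realize 𝔄 v ↔ ψ.Realize 𝔄 v := by
  obtain ⟨X, hX, C, hC, h⟩ := φ.exists_in
  obtain ⟨E, hE⟩ := exists_equations hσ hX hC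
  obtain ⟨S₀⟩ := φ.nonempty_sort
  obtain ⟨⟨ψ, hψ⟩, hb⟩ := exists_boolean_combination
    (Ω := Σ 𝔄 : Struct σ, ∀ S, ℕ → 𝔄.Dom S) (F := {ψ : Formula σ // ψ.QuantifierFree})
    (fun ψ ω => ψ.1.Realize ω.1 ω.2)
    ⟨⟨.eq (.cst (σ.undef S₀)) (.cst (σ.undef S₀)), trivial⟩, fun _ => rfl⟩
    (fun a => ⟨⟨.neg a.1, a.2⟩, fun _ => Iff.rfl⟩)
    (fun a b => ⟨⟨.and a.1 b.1, a.2, b.2⟩, fun _ => Iff.rfl⟩)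
    (E.map fun p => ⟨.eq p.2.1 p.2.2, trivial⟩)
    (fun ω => ω.1.Rich Δ) (fun ω => φ.Realize ω.1 ω.2) (by
      rintro ⟨𝔄, v⟩ ⟨𝔅, w⟩ h𝔄 h𝔅 hL
      obtain ⟨ρ, hρ⟩ := hE 𝔄 𝔅 (Struct.Rich.strict h𝔄) (Struct.Rich.strict h𝔅) v w
        fun p hp => hL _ (List.mem_map.2 ⟨p, hp, rfl⟩)
      exact Formula.realize_iff_of_rich hσ h𝔄 h𝔅 h ρ hρ)
  exact ⟨ψ, hψ, fun 𝔄 h𝔄 v => hb ⟨𝔄, v⟩ h𝔄⟩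

theorem exists_isModelCompletion (hσ : σ.Tame) (Δ : ∀ S, σ.Cst S → σ.Cst S → Prop) :
    ∃ Ts, IsModelCompletion (dbTheory σ Δ) Ts := by
  refine ⟨{φ | ∀ 𝔄 : Struct σ, 𝔄.Rich Δ → ∀ v, φ.Realize 𝔄 v}, ?_, ?_, ?_⟩
  · exact fun φ hφ 𝔄 h𝔄 v => h𝔄.models φ hφ v
  · rintro φ hφ ⟨𝔄, h𝔄, v, hv⟩
    exact ⟨𝔄.richExt, fun ψ hψ => hψ _ (Struct.richExt_rich h𝔄), _,
      (Struct.realize_richExt hφ v).2 hv⟩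
  · intro φ
    obtain ⟨ψ, hψ, h⟩ := φ.exists_quantifierFree (Δ := Δ) hσ
    refine ⟨ψ, hψ, fun 𝔄 h𝔄 v => ?_⟩
    have := h𝔄 (.and (.neg (.and φ (.neg ψ))) (.neg (.and ψ (.neg φ)))) (by
      intro 𝔅 h𝔅 w
      simp only [Formula.Realize]
      have := h 𝔅 h𝔅 w
      tauto) v
    simp only [Formula.Realize] at this
    tauto

/-- Conjunctions of lists of formulae. -/
def Formula.conj (S : σ.Srt) (l : List (Formula σ)) : Formula σ :=
  l.foldr Formula.and (.eq (.cst (σ.undef S)) (.cst (σ.undef S)))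

theorem Formula.realize_conj {S : σ.Srt} {l : List (Formula σ)} {𝔄 : Struct σ}
    {v : ∀ S, ℕ → 𝔄.Dom S} : (Formula.conj S l).Realize 𝔄 v ↔ ∀ φ ∈ l, φ.Realize 𝔄 v := by
  induction l with
  | nil => simp [Formula.conj, Formula.Realize]
  | cons φ l ih =>
    rw [List.forall_mem_cons, ← ih]
    rfl

theorem Formula.quantifierFree_conj {S : σ.Srt} {l : List (Formula σ)}
    (h : ∀ φ ∈ l, φ.QuantifierFree) : (Formula.conj S l).QuantifierFree := by
  induction l with
  | nil => trivial
  | cons φ l ih =>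
    rw [List.forall_mem_cons] at h
    exact ⟨h.1, ih h.2⟩

theorem exists_assignment {𝔄 : Struct σ} {ι : Type} (p : ι → Σ _ : σ.Srt, ℕ)
    (hp : Function.Injective p) (d : ∀ i, 𝔄.Dom (p i).1) :
    ∃ v : ∀ S, ℕ → 𝔄.Dom S, ∀ i, v (p i).1 (p i).2 = d i := by
  refine ⟨fun S n => if h : ∃ i, p i = ⟨S, n⟩ then
    (show (p h.choose).1 = S from congrArg Sigma.fst h.choose_spec) ▸ d h.choose
    else 𝔄.cst (σ.undef S), fun i => ?_⟩
  have h : ∃ i', p i' = ⟨(p i).1, (p i).2⟩ := ⟨i, rfl⟩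
  beta_reduce
  rw [dif_pos h]
  have key : ∀ (i') (e : (p i').1 = (p i).1), i' = i → e ▸ d i' = d i := by
    rintro i' e rfl
    rfl
  exact key _ _ (hp h.choose_spec)

theorem IsModelCompletion.rich_of_models {Δ : ∀ S, σ.Cst S → σ.Cst S → Prop}
    {Ts : Set (Formula σ)} (hσ : σ.Tame) (hTs : IsModelCompletion (dbTheory σ Δ) Ts)
    {𝔄 : Struct σ} (h𝔄 : 𝔄.Models Ts) : 𝔄.Rich Δ := by
  have hT : 𝔄.Models (dbTheory σ Δ) := fun φ hφ => h𝔄 φ (hTs.1 hφ)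
  refine ⟨hT, fun S t ht F hF => ?_⟩
  have := hσ.finite_fn
  have := Fintype.ofFinite σ.Fn
  obtain ⟨enc, henc⟩ := exists_injective_nat σ.Fn
  obtain ⟨m, g, rfl⟩ : ∃ (m : ℕ) (g : Fin m → 𝔄.Dom S), F = Set.range g := by
    obtain ⟨m, g, -, hg⟩ := hF.fin_param
    exact ⟨m, g, hg.symm⟩
  let body : ℕ → Formula σ := fun M => Formula.conj S
    ((((Finset.univ : Finset σ.Fn).toList.filter fun f => S = σ.src f).map fun f =>
        .eq (.app f (.var M)) (.var (2 * enc f + 1))) ++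
      (List.finRange m).map fun i =>
        .neg (.eq (S := S) (.var M) (.var (2 * i + 2))))
  have body_qf : ∀ M, (body M).QuantifierFree := by
    intro M
    refine Formula.quantifierFree_conj fun φ hφ => ?_
    rcases List.mem_append.1 hφ with h | h
    · obtain ⟨f, -, rfl⟩ := List.mem_map.1 h
      trivial
    · obtain ⟨f, -, rfl⟩ := List.mem_map.1 h
      trivial
  have body_iff : ∀ M (𝔅 : Struct σ) (v : ∀ S, ℕ → 𝔅.Dom S), (body M).Realize 𝔅 v ↔
      (∀ f, S = σ.src f → 𝔅.fn f (v _ M) = v _ (2 * enc f + 1)) ∧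
        ∀ i : Fin m, v S M ≠ v S (2 * i + 2) := by
    intro M 𝔅 v
    simp only [body, Formula.realize_conj, List.forall_mem_append, List.forall_mem_map,
      List.mem_filter, Finset.mem_toList, Finset.mem_univ, true_and, decide_eq_true_eq,
      Formula.Realize, Term.eval, List.mem_finRange, true_implies, ne_eq]
  obtain ⟨ψ, hψ, hqe⟩ := hTs.2.2 (.neg (.all S 0 (.neg (body 0))))
  obtain ⟨v, hv⟩ := exists_assignment (𝔄 := 𝔄) (ι := σ.Fn ⊕ Fin m)
    (Sum.elim (fun f => ⟨σ.tgt f, 2 * enc f + 1⟩) fun i => ⟨S, 2 * i + 2⟩) (by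
      rintro (f | i) (f' | i') h <;> simp only [Sum.elim_inl, Sum.elim_inr, Sigma.mk.injEq] at h
      · rw [henc (by have := eq_of_heq h.2; omega : enc f = enc f')]
      · have := eq_of_heq h.2; omega
      · have := eq_of_heq h.2; omega
      · rw [Fin.ext (by have := eq_of_heq h.2; omega : (i : ℕ) = i')])
    (fun i => match i with
      | .inl f => t f
      | .inr i => g i)
  have hv₁ : ∀ f, v (σ.tgt f) (2 * enc f + 1) = t f := fun f => hv (.inl f)
  have hv₂ : ∀ i : Fin m, v S (2 * i + 2) = g i := fun i => hv (.inr i)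
  by_contra hno
  have hψv : ¬ ψ.Realize 𝔄 v := by
    rw [← hqe 𝔄 h𝔄 v]
    simp only [Formula.Realize, not_not]
    intro d hd
    rw [body_iff] at hd
    refine hno ⟨d, ?_, fun f h => ?_⟩
    · rintro ⟨i, hi⟩
      refine hd.2 i ?_
      simp [hv₂, hi]
    · have := hd.1 f h
      subst h
      rw [← hv₁]
      simp only [Function.update_self] at this
      rw [this]
      by_cases h : σ.tgt f = σ.src f
      · rw [h, Function.update_self]
        simp
      · rw [Function.update_of_ne h]
  obtain ⟨X, hX, C, -, hψX⟩ := ψ.exists_in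
  obtain ⟨N, hN⟩ : ∃ N, ∀ x ∈ X, x.2 < N := by
    obtain ⟨N, hN⟩ := (hX.image fun x => x.2).bddAbove
    exact ⟨N + 1, fun x hx => Nat.lt_succ_of_le (hN ⟨x, hx, rfl⟩)⟩
  let M := 2 * (N + m + 1)
  have hrich := Struct.richExt_rich hT
  obtain ⟨x, hxF, hx⟩ := hrich.exists_fresh S (fun f => .base (t f))
    (fun f h heq => ht f h (Struct.RichDom.base.inj heq))
    (Set.range fun i => Struct.RichDom.base (g i)) (Set.finite_range _)
  let w : ∀ S, ℕ → 𝔄.richExt.Dom S := fun S n => .base (v S n)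
  let w' := Function.update w S (Function.update (w S) M x)
  have hw' : ∀ S' n, n ≠ M → w' S' n = w S' n := by
    intro S' n hn
    by_cases h : S' = S
    · subst h
      simp [w', hn]
    · simp [w', Function.update_of_ne h]
  have hsat : (Formula.and (body M) (.neg ψ)).Realize 𝔄.richExt w' := by
    refine ⟨(body_iff M _ _).2 ⟨fun f h => ?_, fun i => ?_⟩, fun hψ' => hψv ?_⟩
    · have hM : w' (σ.src f) M = h ▸ x := by
        subst h
        simp [w']
      rw [hM, hx f h, hw' _ _ (by omega)]
      exact congrArg _ (hv₁ f).symm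
    · have hM : w' S M = x := by simp [w']
      rw [hM, hw' S (2 * i + 2) (by omega)]
      rintro rfl
      exact hxF ⟨i, congrArg _ (hv₂ i).symm⟩
    · rw [← Struct.realize_richExt hψ]
      refine (Formula.realize_iff_of_corr (Corr.refl C _) (fun y hy => ?_) hψ hψX).1 hψ'
      have := hN y hy
      exact hw' _ _ (by omega)
  obtain ⟨𝔈, h𝔈, u, hu₁, hu₂⟩ := hTs.2.1 (.and (body M) (.neg ψ)) ⟨body_qf M, hψ⟩
    ⟨_, hrich.models, w', hsat⟩
  refine hu₂ ((hqe 𝔈 h𝔈 u).1 fun hall => hall (u S M) ?_)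
  rw [body_iff] at hu₁ ⊢
  have hne : ∀ S' n, n ≠ 0 →
      Function.update u S (Function.update (u S) 0 (u S M)) S' n = u S' n := by
    intro S' n hn
    by_cases h : S' = S
    · subst h
      simp [hn]
    · simp [Function.update_of_ne h]
  refine ⟨fun f h => ?_, fun i => ?_⟩
  · rw [hne _ (2 * enc f + 1) (by omega), ← hu₁.1 f h]
    subst h
    simp
  · rw [hne _ (2 * i + 2) (by omega)]
    simpa using hu₁.2 i

theorem IsModelCompletion.models_iff_rich {Δ : ∀ S, σ.Cst S → σ.Cst S → Prop}
    {Ts : Set (Formula σ)} (hσ : σ.Tame) (hTs : IsModelCompletion (dbTheory σ Δ) Ts)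
    {𝔄 : Struct σ} : 𝔄.Models Ts ↔ 𝔄.Rich Δ := by
  refine ⟨hTs.rich_of_models hσ, fun h𝔄 θ hθ v => ?_⟩
  obtain ⟨ψ, hψ, h⟩ := θ.exists_quantifierFree (Δ := Δ) hσ
  by_contra hno
  rw [h 𝔄 h𝔄] at hno
  obtain ⟨𝔈, h𝔈, u, hu⟩ := hTs.2.1 (.neg ψ) hψ ⟨𝔄, h𝔄.models, v, hno⟩
  exact hu ((h 𝔈 (hTs.rich_of_models hσ h𝔈) u).1 (h𝔈 θ hθ u))

end Elimination

/-! ## State formulae over rich structures -/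

section Supports

variable {σ : Signature} {A : Setting σ} {V : σ.Srt → Type} {I : A.ASort → Type}

/-- The variables of basic sorts are restricted to `Y`, the index variables to `K`. -/
def Cell.In (Y : Set (Σ S, V S)) (K : ∀ E, Set (I E)) : {S : σ.Srt} → Cell A V I S → Prop
  | S, .bas v => ⟨S, v⟩ ∈ Y
  | _, .art _ => True
  | _, .read _ i => i ∈ K _

def Cell.allIn (Y : Set (Σ S, V S)) (K : ∀ E, Set (I E)) : Set (Σ S, Cell A V I S) :=
  {c | c.2.In Y K}

def QF.In (Y : Set (Σ S, V S)) (K : ∀ E, Set (I E)) (Cs : Set (Σ S, σ.Cst S)) : QF A V I → Prop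
  | .tru => True
  | .eq t u => Term.In (Cell.allIn Y K) Cs t ∧ Term.In (Cell.allIn Y K) Cs u
  | .idxEq i j => i ∈ K _ ∧ j ∈ K _
  | .neg φ => φ.In Y K Cs
  | .and φ ψ => φ.In Y K Cs ∧ ψ.In Y K Cs

def CaseDef.In (Y : Set (Σ S, V S)) (K : ∀ E, Set (I E)) (Cs : Set (Σ S, σ.Cst S)) {S : σ.Srt} :
    CaseDef A V I S → Prop
  | .ret t => Term.In (Cell.allIn Y K) Cs t
  | .ite κ d₁ d₂ => κ.In Y K Cs ∧ d₁.In Y K Cs ∧ d₂.In Y K Cs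

variable {Y Y' : Set (Σ S, V S)} {K K' : ∀ E, Set (I E)} {Cs Cs' : Set (Σ S, σ.Cst S)}

theorem Cell.allIn_mono (hY : Y ⊆ Y') (hK : ∀ E, K E ⊆ K' E) :
    (Cell.allIn Y K : Set (Σ S, Cell A V I S)) ⊆ Cell.allIn Y' K' := by
  rintro ⟨S, c⟩ h
  cases c with
  | bas v => exact hY h
  | art x => trivial
  | read a i => exact hK _ h

theorem QF.In.mono (hY : Y ⊆ Y') (hK : ∀ E, K E ⊆ K' E) (hC : Cs ⊆ Cs') {φ : QF A V I}
    (h : φ.In Y K Cs) : φ.In Y' K' Cs' := by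
  induction φ with
  | tru => trivial
  | eq t u => exact ⟨h.1.mono (Cell.allIn_mono hY hK) hC, h.2.mono (Cell.allIn_mono hY hK) hC⟩
  | idxEq i j => exact ⟨hK _ h.1, hK _ h.2⟩
  | neg φ ih => exact ih h
  | and φ ψ ih₁ ih₂ => exact ⟨ih₁ h.1, ih₂ h.2⟩

theorem CaseDef.In.mono (hY : Y ⊆ Y') (hK : ∀ E, K E ⊆ K' E) (hC : Cs ⊆ Cs') {S : σ.Srt}
    {d : CaseDef A V I S} (h : d.In Y K Cs) : d.In Y' K' Cs' := by
  induction d with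
  | ret t => exact Term.In.mono (Cell.allIn_mono hY hK) hC h
  | ite κ d₁ d₂ ih₁ ih₂ => exact ⟨h.1.mono hY hK hC, ih₁ h.2.1, ih₂ h.2.2⟩

/-- The index variables of size less than `N`. -/
def below (sz : ∀ E, I E → ℕ) (N : ℕ) (E : A.ASort) : Set (I E) := {i | sz E i < N}

theorem below_mono {sz : ∀ E, I E → ℕ} {N N' : ℕ} (h : N ≤ N') (E : A.ASort) :
    below sz N E ⊆ below sz N' E := fun _ hi => lt_of_lt_of_le hi h

theorem Term.exists_in_allIn (sz : ∀ E, I E → ℕ) {S : σ.Srt} (t : ATerm A V I S) :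
    ∃ Y : Set (Σ S, V S), Y.Finite ∧ ∃ N, ∃ Cs : Set (Σ S, σ.Cst S), Cs.Finite ∧
      Term.In (Cell.allIn Y (below sz N)) Cs t := by
  induction t with
  | @var S c =>
    cases c with
    | bas v =>
      refine ⟨{⟨S, v⟩}, Set.finite_singleton _, 0, ∅, Set.finite_empty, ?_⟩
      exact Set.mem_singleton (⟨S, v⟩ : Σ S, V S)
    | art x => exact ⟨∅, Set.finite_empty, 0, ∅, Set.finite_empty, trivial⟩
    | read a i => exact ⟨∅, Set.finite_empty, sz _ i + 1, ∅, Set.finite_empty,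
        Nat.lt_succ_self (sz _ i)⟩
  | @cst S c =>
    refine ⟨∅, Set.finite_empty, 0, {⟨S, c⟩}, Set.finite_singleton _, ?_⟩
    exact Set.mem_singleton (⟨S, c⟩ : Σ S, σ.Cst S)
  | app f t ih => exact ih

theorem QF.exists_in (sz : ∀ E, I E → ℕ) (φ : QF A V I) :
    ∃ Y : Set (Σ S, V S), Y.Finite ∧ ∃ N, ∃ Cs : Set (Σ S, σ.Cst S), Cs.Finite ∧
      φ.In Y (below sz N) Cs := by
  induction φ with
  | tru => exact ⟨∅, Set.finite_empty, 0, ∅, Set.finite_empty, trivial⟩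
  | eq t u =>
    obtain ⟨Y, hY, N, C, hC, h⟩ := Term.exists_in_allIn sz t
    obtain ⟨Y', hY', N', C', hC', h'⟩ := Term.exists_in_allIn sz u
    exact ⟨_, hY.union hY', max N N', _, hC.union hC',
      h.mono (Cell.allIn_mono Set.subset_union_left (below_mono (le_max_left _ _)))
        Set.subset_union_left,
      h'.mono (Cell.allIn_mono Set.subset_union_right (below_mono (le_max_right _ _)))
        Set.subset_union_right⟩
  | idxEq i j => exact ⟨∅, Set.finite_empty, max (sz _ i) (sz _ j) + 1, ∅, Set.finite_empty,
      Nat.lt_succ_of_le (le_max_left _ _), Nat.lt_succ_of_le (le_max_right _ _)⟩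
  | neg φ ih => exact ih
  | and φ ψ ih₁ ih₂ =>
    obtain ⟨Y, hY, N, C, hC, h⟩ := ih₁
    obtain ⟨Y', hY', N', C', hC', h'⟩ := ih₂
    exact ⟨_, hY.union hY', max N N', _, hC.union hC',
      h.mono Set.subset_union_left (below_mono (le_max_left _ _)) Set.subset_union_left,
      h'.mono Set.subset_union_right (below_mono (le_max_right _ _)) Set.subset_union_right⟩

theorem CaseDef.exists_in (sz : ∀ E, I E → ℕ) {S : σ.Srt} (d : CaseDef A V I S) :
    ∃ Y : Set (Σ S, V S), Y.Finite ∧ ∃ N, ∃ Cs : Set (Σ S, σ.Cst S), Cs.Finite ∧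
      d.In Y (below sz N) Cs := by
  induction d with
  | ret t => exact Term.exists_in_allIn sz t
  | ite κ d₁ d₂ ih₁ ih₂ =>
    obtain ⟨Y, hY, N, C, hC, h⟩ := κ.exists_in sz
    obtain ⟨Y₁, hY₁, N₁, C₁, hC₁, h₁⟩ := ih₁
    obtain ⟨Y₂, hY₂, N₂, C₂, hC₂, h₂⟩ := ih₂
    refine ⟨Y ∪ Y₁ ∪ Y₂, (hY.union hY₁).union hY₂, N + N₁ + N₂, C ∪ C₁ ∪ C₂,
      (hC.union hC₁).union hC₂, h.mono ?_ (below_mono (by omega)) ?_,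
      h₁.mono ?_ (below_mono (by omega)) ?_, h₂.mono ?_ (below_mono (by omega)) ?_⟩ <;>
    intro x hx <;> simp [hx]

/-- Correspondence of two states together with assignments to the variables. -/
structure Corr.Agree {𝔐 𝔐' : ExtStruct A} (ρ : Corr Cs 𝔐.toStruct 𝔐'.toStruct)
    (Y : Set (Σ S, V S)) (K : ∀ E, Set (I E)) (s : State 𝔐) (s' : State 𝔐')
    (y : ∀ S, V S → 𝔐.Dom S) (y' : ∀ S, V S → 𝔐'.Dom S)
    (e : ∀ E, I E → 𝔐.Idx E) (e' : ∀ E, I E → 𝔐'.Idx E) : Prop where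
  bas : ∀ x ∈ Y, ρ.rel (y x.1 x.2) (y' x.1 x.2)
  art : ∀ x, ρ.rel (s.art x) (s'.art x)
  read : ∀ a, ∀ i ∈ K (A.src a), ρ.rel (s.arr a (e _ i)) (s'.arr a (e' _ i))
  idx : ∀ E, ∀ i ∈ K E, ∀ j ∈ K E, e E i = e E j ↔ e' E i = e' E j

variable {𝔐 𝔐' : ExtStruct A} {ρ : Corr Cs 𝔐.toStruct 𝔐'.toStruct} {s : State 𝔐} {s' : State 𝔐'}
  {y : ∀ S, V S → 𝔐.Dom S} {y' : ∀ S, V S → 𝔐'.Dom S}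
  {e : ∀ E, I E → 𝔐.Idx E} {e' : ∀ E, I E → 𝔐'.Idx E}

theorem Corr.Agree.rel_eval (h : ρ.Agree Y K s s' y y' e e') {S : σ.Srt} {t : ATerm A V I S}
    (ht : Term.In (Cell.allIn Y K) Cs t) :
    ρ.rel (t.eval 𝔐.toStruct (Cell.eval s y e)) (t.eval 𝔐'.toStruct (Cell.eval s' y' e')) := by
  refine ρ.rel_eval ?_ ht
  rintro ⟨S, c⟩ hc
  cases c with
  | bas v => exact h.bas _ hc
  | art x => exact h.art x
  | read a i => exact h.read a i hc

theorem Corr.Agree.holds_iff (h : ρ.Agree Y K s s' y y' e e') {φ : QF A V I}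
    (hφ : φ.In Y K Cs) : φ.Holds s y e ↔ φ.Holds s' y' e' := by
  induction φ with
  | tru => exact Iff.rfl
  | eq t u => exact ρ.eq_iff (h.rel_eval hφ.1) (h.rel_eval hφ.2)
  | idxEq i j => exact h.idx _ i hφ.1 j hφ.2
  | neg φ ih => exact not_congr (ih hφ)
  | and φ ψ ih₁ ih₂ => exact and_congr (ih₁ hφ.1) (ih₂ hφ.2)

theorem Corr.Agree.rel_caseDef (h : ρ.Agree Y K s s' y y' e e') {S : σ.Srt}
    {d : CaseDef A V I S} (hd : d.In Y K Cs) : ρ.rel (d.eval s y e) (d.eval s' y' e') := by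
  induction d with
  | ret t => exact h.rel_eval hd
  | ite κ d₁ d₂ ih₁ ih₂ =>
    simp only [CaseDef.eval]
    by_cases hκ : κ.Holds s y e
    · rw [if_pos hκ, if_pos ((h.holds_iff hd.1).1 hκ)]
      exact ih₁ hd.2.1
    · rw [if_neg hκ, if_neg (fun h' => hκ ((h.holds_iff hd.1).2 h'))]
      exact ih₂ hd.2.2

end Supports

section Systems

variable {σ : Signature} {A : Setting σ}

theorem QF.in_univ {σ : Signature} {A : Setting σ} {V : σ.Srt → Type} {I : A.ASort → Type}
    (φ : QF A V I) : φ.In Set.univ (fun _ => Set.univ) Set.univ := by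
  have ht : ∀ {S : σ.Srt} (t : ATerm A V I S),
      Term.In (Cell.allIn Set.univ fun _ => Set.univ) Set.univ t := by
    intro S t
    induction t with
    | var c =>
      cases c with
      | bas v => trivial
      | art x => trivial
      | read a i => trivial
    | cst c => trivial
    | app f t ih => exact ih
  induction φ with
  | tru => trivial
  | eq t u => exact ⟨ht t, ht u⟩
  | idxEq i j => exact ⟨Set.mem_univ _, Set.mem_univ _⟩
  | neg φ ih => exact ih
  | and φ ψ ih₁ ih₂ => exact ⟨ih₁, ih₂⟩

theorem QF.holds_conj {V : σ.Srt → Type} {I : A.ASort → Type} {𝔐 : ExtStruct A} {s : State 𝔐}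
    {y : ∀ S, V S → 𝔐.Dom S} {e : ∀ E, I E → 𝔐.Idx E} {l : List (QF A V I)} :
    (QF.conj l).Holds s y e ↔ ∀ φ ∈ l, φ.Holds s y e := by
  induction l with
  | nil => simp [QF.conj, QF.Holds]
  | cons φ l ih =>
    rw [List.forall_mem_cons, ← ih]
    rfl

theorem QF.holds_disj {V : σ.Srt → Type} {I : A.ASort → Type} {𝔐 : ExtStruct A} {s : State 𝔐}
    {y : ∀ S, V S → 𝔐.Dom S} {e : ∀ E, I E → 𝔐.Idx E} {l : List (QF A V I)} :
    (QF.disj l).Holds s y e ↔ ∃ φ ∈ l, φ.Holds s y e := by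
  simp [QF.disj, QF.Holds, QF.holds_conj]

theorem QF.in_conj {V : σ.Srt → Type} {I : A.ASort → Type} {Y : Set (Σ S, V S)}
    {K : ∀ E, Set (I E)} {Cs : Set (Σ S, σ.Cst S)} {l : List (QF A V I)} :
    (QF.conj l).In Y K Cs ↔ ∀ φ ∈ l, φ.In Y K Cs := by
  induction l with
  | nil => simp [QF.conj, QF.In]
  | cons φ l ih =>
    rw [List.forall_mem_cons, ← ih]
    rfl

theorem QF.in_disj {V : σ.Srt → Type} {I : A.ASort → Type} {Y : Set (Σ S, V S)}
    {K : ∀ E, Set (I E)} {Cs : Set (Σ S, σ.Cst S)} {l : List (QF A V I)} :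
    (QF.disj l).In Y K Cs ↔ ∀ φ ∈ l, φ.In Y K Cs := by
  simp [QF.disj, QF.In, QF.in_conj]

/-- The state that a transition leads to. -/
def Transition.post (τ : Transition A) {𝔐 : ExtStruct A} (s : State 𝔐) (y : ∀ S, ℕ → 𝔐.Dom S)
    (e : ∀ E, ℕ → 𝔐.Idx E) : State 𝔐 where
  art x := (τ.art x).eval s y e
  arr a j := (τ.arr a).eval s y (WithCur.eval e j)

theorem Transition.rel_iff {τ : Transition A} {𝔐 : ExtStruct A} {s s' : State 𝔐} :
    τ.Rel s s' ↔ ∃ y e, τ.guard.Holds s y e ∧ s' = τ.post s y e := by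
  constructor
  · rintro ⟨y, e, hg, hx, ha⟩
    refine ⟨y, e, hg, ?_⟩
    cases s'
    simp only [Transition.post, State.mk.injEq]
    exact ⟨funext hx, funext fun a => funext (ha a)⟩
  · rintro ⟨y, e, hg, rfl⟩
    exact ⟨y, e, hg, fun _ => rfl, fun _ _ => rfl⟩

/-- The size of an index variable. -/
def natSize (_ : A.ASort) (n : ℕ) : ℕ := n

def WithCur.size {E₀ : A.ASort} (E : A.ASort) : WithCur E₀ E → ℕ
  | .old n => n + 1
  | .cur => 0

structure Transition.In (Y : Set (Σ _ : σ.Srt, ℕ)) (N : ℕ) (Cs : Set (Σ S, σ.Cst S))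
    (τ : Transition A) : Prop where
  guard : τ.guard.In Y (below natSize N) Cs
  art : ∀ x, (τ.art x).In Y (below natSize N) Cs
  arr : ∀ a, (τ.arr a).In Y (below WithCur.size N) Cs

theorem Transition.exists_in [Finite A.AVar] [Finite A.Comp] (τ : Transition A) :
    ∃ Y : Set (Σ _ : σ.Srt, ℕ), Y.Finite ∧ ∃ N, ∃ Cs : Set (Σ S, σ.Cst S), Cs.Finite ∧
      τ.In Y N Cs := by
  obtain ⟨Y, hY, N, C, hC, h⟩ := τ.guard.exists_in natSize
  choose Y₁ hY₁ N₁ C₁ hC₁ h₁ using fun x => (τ.art x).exists_in natSize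
  choose Y₂ hY₂ N₂ C₂ hC₂ h₂ using fun a => (τ.arr a).exists_in WithCur.size
  obtain ⟨M₁, hM₁⟩ := (Set.finite_range N₁).bddAbove
  obtain ⟨M₂, hM₂⟩ := (Set.finite_range N₂).bddAbove
  have hM₁ : ∀ x, N₁ x ≤ M₁ := fun x => hM₁ ⟨x, rfl⟩
  have hM₂ : ∀ x, N₂ x ≤ M₂ := fun x => hM₂ ⟨x, rfl⟩
  refine ⟨Y ∪ (⋃ x, Y₁ x) ∪ ⋃ a, Y₂ a,
    (hY.union (Set.finite_iUnion hY₁)).union (Set.finite_iUnion hY₂), N + M₁ + M₂,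
    C ∪ (⋃ x, C₁ x) ∪ ⋃ a, C₂ a, (hC.union (Set.finite_iUnion hC₁)).union (Set.finite_iUnion hC₂),
    h.mono ?_ (below_mono (by omega)) ?_,
    fun x => (h₁ x).mono ?_ (below_mono (by have := hM₁ x; omega)) ?_,
    fun a => (h₂ a).mono ?_ (below_mono (by have := hM₂ a; omega)) ?_⟩
  · exact fun z hz => Or.inl (Or.inl hz)
  · exact fun z hz => Or.inl (Or.inl hz)
  · exact fun z hz => Or.inl (Or.inr (Set.mem_iUnion.2 ⟨x, hz⟩))
  · exact fun z hz => Or.inl (Or.inr (Set.mem_iUnion.2 ⟨x, hz⟩))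
  · exact fun z hz => Or.inr (Set.mem_iUnion.2 ⟨a, hz⟩)
  · exact fun z hz => Or.inr (Set.mem_iUnion.2 ⟨a, hz⟩)

theorem Transition.In.mono {Y Y' : Set (Σ _ : σ.Srt, ℕ)} {N N' : ℕ} {Cs Cs' : Set (Σ S, σ.Cst S)}
    {τ : Transition A} (hY : Y ⊆ Y') (hN : N ≤ N') (hC : Cs ⊆ Cs') (h : τ.In Y N Cs) :
    τ.In Y' N' Cs' :=
  ⟨h.guard.mono hY (below_mono hN) hC, fun x => (h.art x).mono hY (below_mono hN) hC,
    fun a => (h.arr a).mono hY (below_mono hN) hC⟩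

theorem Cell.finite_allIn [Finite A.AVar] [Finite A.Comp] (N : ℕ) :
    (Cell.allIn ∅ (below natSize N) :
      Set (Σ S, Cell A (fun _ => Empty) (fun _ => ℕ) S)).Finite := by
  refine ((Set.finite_range fun x : A.AVar =>
      (⟨_, .art x⟩ : Σ S, Cell A (fun _ => Empty) (fun _ => ℕ) S)).union
    (((Set.finite_univ (α := A.Comp)).prod (Set.finite_lt_nat N)).image
      fun p => ⟨_, .read p.1 p.2⟩)).subset ?_
  rintro ⟨S, c⟩ h
  cases c with
  | bas v => exact v.elim
  | art x => exact Or.inl ⟨x, rfl⟩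
  | read a i => exact Or.inr ⟨(a, i), ⟨trivial, h⟩, rfl⟩

theorem exists_interleave {J : A.ASort → Type} (e₀ e₁ : ∀ E, ℕ → J E) :
    ∃ e : ∀ E, ℕ → J E, (fun E n => e E (2 * n)) = e₀ ∧ (fun E n => e E (2 * n + 1)) = e₁ := by
  refine ⟨fun E n => if n % 2 = 0 then e₀ E (n / 2) else e₁ E (n / 2), ?_, ?_⟩
  · funext E n
    beta_reduce
    rw [if_pos (by omega), Nat.mul_div_cancel_left _ zero_lt_two]
  · funext E n
    beta_reduce
    rw [if_neg (by omega), show (2 * n + 1) / 2 = n by omega]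

/-- Over rich structures, the preimage of a state formula under a transition is a state formula. -/
theorem Transition.exists_pre [Finite A.AVar] [Finite A.Comp] [Finite A.ASort]
    {Δ : ∀ S, σ.Cst S → σ.Cst S → Prop} (hσ : σ.Tame) (τ : Transition A) (φ : StateFormula A) :
    ∃ ψ : StateFormula A, ∀ 𝔐 : ExtStruct A, 𝔐.toStruct.Rich Δ → ∀ s : State 𝔐,
      ψ.sat 𝔐 s ↔ ∃ s', τ.Rel s s' ∧ φ.sat 𝔐 s' := by
  obtain ⟨Y, hY, N₁, C₁, hC₁, hτ⟩ := τ.exists_in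
  obtain ⟨Y₂, -, N₂, C₂, hC₂, hφ⟩ := φ.exists_in natSize
  let N := N₁ + N₂
  let Cs := C₁ ∪ C₂
  have hτ : τ.In Y N Cs := hτ.mono le_rfl (by omega) Set.subset_union_left
  have hφ : φ.In ∅ (below natSize N) Cs :=
    hφ.mono (fun x => x.2.elim) (below_mono (by omega)) Set.subset_union_right
  have := Fintype.ofFinite A.ASort
  obtain ⟨Eq, hEq⟩ := exists_equations hσ (Cell.finite_allIn (A := A) (2 * N))
    (hC₁.union hC₂)
  let ix : List (StateFormula A) := (Finset.univ : Finset A.ASort).toList.flatMap fun E =>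
    (List.range (2 * N)).flatMap fun m => (List.range (2 * N)).map fun n => .idxEq (E := E) m n
  have hix : ∀ E m n, m < 2 * N → n < 2 * N → (QF.idxEq (E := E) m n : StateFormula A) ∈ ix := by
    intro E m n hm hn
    simp only [ix, List.mem_flatMap, List.mem_map, List.mem_range]
    exact ⟨E, by simp, m, hm, n, hn, rfl⟩
  let P : (Σ 𝔐 : ExtStruct A, State 𝔐 × ∀ E, ℕ → 𝔐.Idx E) → Prop := fun ω =>
    ∃ y : ∀ S, ℕ → ω.1.Dom S, τ.guard.Holds ω.2.1 y (fun E n => ω.2.2 E (2 * n)) ∧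
      QF.Holds (τ.post ω.2.1 y fun E n => ω.2.2 E (2 * n)) (fun _ v => v.elim)
        (fun E n => ω.2.2 E (2 * n + 1)) φ
  let sat : StateFormula A → (Σ 𝔐 : ExtStruct A, State 𝔐 × ∀ E, ℕ → 𝔐.Idx E) → Prop :=
    fun φ ω => QF.Holds ω.2.1 (fun _ v => v.elim) ω.2.2 φ
  have main : ∀ ω ω' : Σ 𝔐 : ExtStruct A, State 𝔐 × ∀ E, ℕ → 𝔐.Idx E,
      ω.1.toStruct.Rich Δ → ω'.1.toStruct.Rich Δ →
      (∀ a ∈ Eq.map (fun p => QF.eq p.2.1 p.2.2) ++ ix, sat a ω ↔ sat a ω') → P ω → P ω' := by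
    rintro ⟨𝔐, s, e⟩ ⟨𝔐', s', e'⟩ h𝔐 h𝔐' hL ⟨y, hg, hpost⟩
    dsimp only at h𝔐 h𝔐' hg hpost
    have hidx : ∀ E m n, m < 2 * N → n < 2 * N → (e E m = e E n ↔ e' E m = e' E n) :=
      fun E m n hm hn => hL _ (List.mem_append_right _ (hix E m n hm hn))
    obtain ⟨ρ₀, hρ₀⟩ := hEq 𝔐.toStruct 𝔐'.toStruct h𝔐.strict h𝔐'.strict
      (Cell.eval s (fun _ v => v.elim) e) (Cell.eval s' (fun _ v => v.elim) e')
      fun p hp => hL _ (List.mem_append_left _ (List.mem_map.2 ⟨p, hp, rfl⟩))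
    obtain ⟨ρ, hρ, y', hy⟩ := ρ₀.exists_extend_assignment hσ h𝔐.strict h𝔐' hY y
    have hart : ∀ x, ρ.rel (s.art x) (s'.art x) := fun x => hρ (hρ₀ ⟨_, .art x⟩ trivial)
    have hread : ∀ a i, i < 2 * N → ρ.rel (s.arr a (e _ i)) (s'.arr a (e' _ i)) :=
      fun a i hi => hρ (hρ₀ ⟨_, .read a i⟩ hi)
    have agree : ρ.Agree Y (below natSize N) s s' y y' (fun E n => e E (2 * n))
        (fun E n => e' E (2 * n)) := by
      refine ⟨hy, hart, fun a i hi => hread _ _ ?_, fun E i hi j hj => hidx _ _ _ ?_ ?_⟩ <;>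
      simp only [below, natSize, Set.mem_ofPred_eq] at * <;> omega
    have agree' : ∀ E₀ n, n < N → ρ.Agree Y (below WithCur.size N) s s' y y'
        (WithCur.eval (E₀ := E₀) (fun E n => e E (2 * n)) (e _ (2 * n + 1)))
        (WithCur.eval (E₀ := E₀) (fun E n => e' E (2 * n)) (e' _ (2 * n + 1))) := by
      intro E₀ n hn
      have key : ∀ E, ∀ i ∈ below (WithCur.size (E₀ := E₀)) N E, ∃ m, m < 2 * N ∧
          WithCur.eval (fun E n => e E (2 * n)) (e _ (2 * n + 1)) E i = e E m ∧
          WithCur.eval (fun E n => e' E (2 * n)) (e' _ (2 * n + 1)) E i = e' E m := by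
        intro E i hi
        cases i with
        | old m =>
          simp only [below, WithCur.size, Set.mem_ofPred_eq] at hi
          exact ⟨2 * m, by omega, rfl, rfl⟩
        | cur => exact ⟨2 * n + 1, by omega, rfl, rfl⟩
      refine ⟨hy, hart, fun a i hi => ?_, fun E i hi j hj => ?_⟩
      · obtain ⟨m, hm, h₁, h₂⟩ := key _ i hi
        rw [h₁, h₂]
        exact hread a m hm
      · obtain ⟨m, hm, h₁, h₂⟩ := key _ i hi
        obtain ⟨m', hm', h₁', h₂'⟩ := key _ j hj
        rw [h₁, h₂, h₁', h₂']
        exact hidx _ _ _ hm hm'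
    refine ⟨y', (agree.holds_iff hτ.guard).1 hg, ?_⟩
    have hfin : ρ.Agree (V := fun _ => Empty) ∅ (below natSize N) (τ.post s y fun E n => e E (2 * n))
        (τ.post s' y' fun E n => e' E (2 * n)) (fun _ v => v.elim) (fun _ v => v.elim)
        (fun E n => e E (2 * n + 1)) (fun E n => e' E (2 * n + 1)) := by
      refine ⟨fun x => x.2.elim, fun x => agree.rel_caseDef (hτ.art x), fun a i hi =>
        (agree' _ i hi).rel_caseDef (hτ.arr a), fun E i hi j hj => hidx _ _ _ ?_ ?_⟩ <;>
      simp only [below, natSize, Set.mem_ofPred_eq] at * <;> omega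
    exact (hfin.holds_iff hφ).1 hpost
  obtain ⟨ψ, hψ⟩ := exists_boolean_combination sat ⟨.tru, fun _ => trivial⟩
    (fun a => ⟨.neg a, fun _ => Iff.rfl⟩) (fun a b => ⟨.and a b, fun _ => Iff.rfl⟩)
    (Eq.map (fun p => QF.eq p.2.1 p.2.2) ++ ix) (fun ω => ω.1.toStruct.Rich Δ) P
    (fun ω ω' h h' hL => ⟨main ω ω' h h' hL, main ω' ω h' h fun a ha => (hL a ha).symm⟩)
  refine ⟨ψ, fun 𝔐 h𝔐 s => ⟨?_, ?_⟩⟩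
  · rintro ⟨e, he⟩
    obtain ⟨y, hg, hpost⟩ := (hψ ⟨𝔐, s, e⟩ h𝔐).2 he
    exact ⟨_, Transition.rel_iff.2 ⟨y, _, hg, rfl⟩, _, hpost⟩
  · rintro ⟨s', hs', e₁, he₁⟩
    obtain ⟨y, e₀, hg, rfl⟩ := Transition.rel_iff.1 hs'
    obtain ⟨e, h₀, h₁⟩ := exists_interleave e₀ e₁
    refine ⟨e, (hψ ⟨𝔐, s, e⟩ h𝔐).1 ⟨y, ?_⟩⟩
    dsimp only
    rw [h₀, h₁]
    exact ⟨hg, he₁⟩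

end Systems
/-! ## Sets of states that are expressed by state formulae -/

section Expressible

variable {σ : Signature} {A : Setting σ}

def Term.mapVar {V V' : σ.Srt → Type} (g : ∀ S, V S → V' S) : {S : σ.Srt} →
    Term σ V S → Term σ V' S
  | _, .var v => .var (g _ v)
  | _, .cst c => .cst c
  | _, .app f t => .app f (t.mapVar g)

theorem Term.eval_mapVar {V V' : σ.Srt → Type} (g : ∀ S, V S → V' S) (𝔄 : Struct σ)
    (v : ∀ S, V' S → 𝔄.Dom S) {S : σ.Srt} (t : Term σ V S) :
    (t.mapVar g).eval 𝔄 v = t.eval 𝔄 fun S x => v S (g S x) := by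
  induction t with
  | var x => rfl
  | cst c => rfl
  | app f t ih => simp only [Term.mapVar, Term.eval, ih]

def Cell.reindex {V : σ.Srt → Type} {I I' : A.ASort → Type} (g : ∀ E, I E → I' E) :
    (S : σ.Srt) → Cell A V I S → Cell A V I' S
  | _, .bas v => .bas v
  | _, .art x => .art x
  | _, .read a i => .read a (g _ i)

def QF.reindex {V : σ.Srt → Type} {I I' : A.ASort → Type} (g : ∀ E, I E → I' E) :
    QF A V I → QF A V I'
  | .tru => .tru
  | .eq t u => .eq (Term.mapVar (Cell.reindex g) t) (Term.mapVar (Cell.reindex g) u)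
  | .idxEq i j => .idxEq (g _ i) (g _ j)
  | .neg φ => .neg (φ.reindex g)
  | .and φ ψ => .and (φ.reindex g) (ψ.reindex g)

theorem QF.holds_reindex {V : σ.Srt → Type} {I I' : A.ASort → Type} (g : ∀ E, I E → I' E)
    {𝔐 : ExtStruct A} {s : State 𝔐} {y : ∀ S, V S → 𝔐.Dom S} {e : ∀ E, I' E → 𝔐.Idx E}
    (φ : QF A V I) : (φ.reindex g).Holds s y e ↔ φ.Holds s y fun E i => e E (g E i) := by
  have hc : (fun S (c : Cell A V I S) => Cell.eval s y e S (Cell.reindex g S c)) =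
      Cell.eval s y fun E i => e E (g E i) := by
    funext S c
    cases c <;> rfl
  induction φ with
  | tru => exact Iff.rfl
  | eq t u => simp only [QF.reindex, QF.Holds, Term.eval_mapVar, hc]
  | idxEq i j => exact Iff.rfl
  | neg φ ih => exact not_congr ih
  | and φ ψ ih₁ ih₂ => exact and_congr ih₁ ih₂

/-- The set of states is expressed by a state formula, modulo the theory. -/
def Expressible (T : Set (Formula σ)) (P : StateSet A) : Prop :=
  ∃ φ : StateFormula A, Equivalent T φ.sat P

variable {T : Set (Formula σ)}

theorem Expressible.congr {P Q : StateSet A} (h : Expressible T P)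
    (hPQ : ∀ 𝔐 : ExtStruct A, 𝔐.toStruct.Models T → ∀ s : State 𝔐, P 𝔐 s ↔ Q 𝔐 s) :
    Expressible T Q := by
  obtain ⟨φ, hφ⟩ := h
  exact ⟨φ, fun 𝔐 h𝔐 s => (hφ 𝔐 h𝔐 s).trans (hPQ 𝔐 h𝔐 s)⟩

theorem Expressible.exists_mem {ι : Type*} (l : List ι) {P : ι → StateSet A}
    (h : ∀ i ∈ l, Expressible T (P i)) : Expressible T fun 𝔐 s => ∃ i ∈ l, P i 𝔐 s := by
  have h' : ∀ i, ∃ φ : StateFormula A, i ∈ l → Equivalent T φ.sat (P i) := by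
    intro i
    by_cases hi : i ∈ l
    · obtain ⟨φ, hφ⟩ := h i hi
      exact ⟨φ, fun _ => hφ⟩
    · exact ⟨.tru, fun hi' => absurd hi' hi⟩
  choose φ hφ using h'
  refine ⟨QF.disj (l.map φ), fun 𝔐 h𝔐 s => ⟨?_, ?_⟩⟩
  · rintro ⟨e, he⟩
    obtain ⟨_, hψ, hh⟩ := QF.holds_disj.1 he
    obtain ⟨i, hi, rfl⟩ := List.mem_map.1 hψ
    exact ⟨i, hi, (hφ i hi 𝔐 h𝔐 s).1 ⟨e, hh⟩⟩
  · rintro ⟨i, hi, hP⟩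
    obtain ⟨e, he⟩ := (hφ i hi 𝔐 h𝔐 s).2 hP
    exact ⟨e, QF.holds_disj.2 ⟨φ i, List.mem_map.2 ⟨i, hi, rfl⟩, he⟩⟩

theorem Expressible.and {P Q : StateSet A} (hP : Expressible T P) (hQ : Expressible T Q) :
    Expressible T fun 𝔐 s => P 𝔐 s ∧ Q 𝔐 s := by
  obtain ⟨φ, hφ⟩ := hP
  obtain ⟨ψ, hψ⟩ := hQ
  refine ⟨.and (φ.reindex fun _ n => 2 * n) (ψ.reindex fun _ n => 2 * n + 1),
    fun 𝔐 h𝔐 s => ⟨?_, ?_⟩⟩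
  · rintro ⟨e, h₁, h₂⟩
    exact ⟨(hφ 𝔐 h𝔐 s).1 ⟨_, (QF.holds_reindex _ _).1 h₁⟩,
      (hψ 𝔐 h𝔐 s).1 ⟨_, (QF.holds_reindex _ _).1 h₂⟩⟩
  · rintro ⟨h₁, h₂⟩
    obtain ⟨e₁, he₁⟩ := (hφ 𝔐 h𝔐 s).2 h₁
    obtain ⟨e₂, he₂⟩ := (hψ 𝔐 h𝔐 s).2 h₂
    obtain ⟨e, rfl, rfl⟩ := exists_interleave e₁ e₂
    exact ⟨e, (QF.holds_reindex _ _).2 he₁, (QF.holds_reindex _ _).2 he₂⟩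

theorem Expressible.forall_mem {ι : Type*} (l : List ι) {P : ι → StateSet A}
    (h : ∀ i, Expressible T (P i)) : Expressible T fun 𝔐 s => ∀ i ∈ l, P i 𝔐 s := by
  induction l with
  | nil =>
    refine ⟨.tru, fun 𝔐 h𝔐 s => ?_⟩
    exact iff_of_true ⟨fun E _ => Classical.choice (𝔐.idx_nonempty E), trivial⟩ (by simp)
  | cons i l ih => exact ((h i).and ih).congr (by simp)

end Expressible

/-! ## Termination by simulation -/

section Termination

variable {σ : Signature} {A : Setting σ}

/-- A model of the database theory as a part of its rich extension. -/
def Struct.richExtCorr (Cs : Set (Σ S, σ.Cst S)) (𝔄 : Struct σ) : Corr Cs 𝔄 𝔄.richExt where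
  rel x y := y = .base x
  eq_iff := by
    rintro S x x' _ _ rfl rfl
    exact ⟨congrArg _, fun h => RichDom.base.inj h⟩
  fn := by
    rintro f x _ rfl
    rfl
  cst _ _ := rfl
  undef _ := rfl

/-- A state formula that is satisfiable together with the negations of others is so in a rich
structure with finitely many indices. -/
theorem exists_rich_finite {Δ : ∀ S, σ.Cst S → σ.Cst S → Prop} {𝔐 : ExtStruct A}
    (h𝔐 : 𝔐.toStruct.Models (dbTheory σ Δ)) {s : State 𝔐} {φ : StateFormula A}
    {B : List (StateFormula A)} (hφ : φ.sat 𝔐 s) (hB : ¬ ∃ ψ ∈ B, StateFormula.sat ψ 𝔐 s) :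
    ∃ ω : Σ 𝔐 : ExtStruct A, State 𝔐, ω.1.toStruct.Rich Δ ∧ (∀ E, Finite (ω.1.Idx E)) ∧
      φ.sat ω.1 ω.2 ∧ ¬ ∃ ψ ∈ B, StateFormula.sat ψ ω.1 ω.2 := by
  obtain ⟨e, he⟩ := hφ
  obtain ⟨Y, -, N, C, -, hφN⟩ := φ.exists_in natSize
  let 𝔐' : ExtStruct A :=
    { toStruct := 𝔐.toStruct.richExt
      Idx := fun E => {i // i ∈ (e E) '' Set.Iic N}
      idx_nonempty := fun E => ⟨⟨e E 0, 0, Nat.zero_le _, rfl⟩⟩ }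
  let s' : State 𝔐' := ⟨fun x => .base (s.art x), fun a i => .base (s.arr a i.1)⟩
  have key : ∀ (ψ : StateFormula A) (e' : ∀ E, ℕ → 𝔐'.Idx E),
      QF.Holds s (fun _ v => v.elim) (fun E n => (e' E n).1) ψ ↔
        QF.Holds s' (fun _ v => v.elim) e' ψ := by
    intro ψ e'
    obtain ⟨Y, -, N, C, -, hψ⟩ := ψ.exists_in natSize
    exact Corr.Agree.holds_iff (ρ := (𝔐.toStruct.richExtCorr C : Corr C 𝔐.toStruct 𝔐'.toStruct))
      ⟨fun x => x.2.elim, fun _ => rfl, fun _ _ _ => rfl, fun _ _ _ _ _ => Subtype.ext_iff.symm⟩ hψ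
  refine ⟨⟨𝔐', s'⟩, Struct.richExt_rich h𝔐,
    fun E => ((Set.finite_Iic N).image (e E)).to_subtype, ?_, ?_⟩
  · refine ⟨fun E n => ⟨e E (min n N), min n N, Set.mem_Iic.2 (min_le_right _ _), rfl⟩, (key _ _).1 ?_⟩
    have hmin : ∀ i, i < N → min i N = i := fun i hi => min_eq_left hi.le
    refine (Corr.Agree.holds_iff (ρ := Corr.refl C _)
      ⟨fun x => x.2.elim, fun _ => rfl, fun a i hi => ?_, fun E i hi j hj => ?_⟩ hφN).1 he
    · dsimp only
      rw [hmin i hi]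
      rfl
    · dsimp only
      rw [hmin i hi, hmin j hj]
  · rintro ⟨ψ, hψ, e', he'⟩
    exact hB ⟨ψ, hψ, _, (key _ _).2 he'⟩

/-- The iterated preimages of a set of states. -/
def System.preIter (𝒮 : System σ) (υ : StateSet 𝒮.setting) : ℕ → StateSet 𝒮.setting
  | 0 => υ
  | n + 1 => 𝒮.pre (𝒮.preIter υ n)

/-- Backward reachability terminates if there is a well-quasi-ordered simulation on the states over
rich structures for which the goal is upward closed. -/
theorem System.terminates_of_simulation {𝒮 : System σ} {Δ : ∀ S, σ.Cst S → σ.Cst S → Prop}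
    (hσ : σ.Tame) (htheory : 𝒮.theory = dbTheory σ Δ) [Finite 𝒮.setting.AVar]
    [Finite 𝒮.setting.Comp] [Finite 𝒮.setting.ASort] {υ : StateSet 𝒮.setting}
    (hυ : Expressible 𝒮.theory υ)
    (Sim : ∀ {𝔐 𝔐' : ExtStruct 𝒮.setting}, State 𝔐 → State 𝔐' → Prop)
    (hwqo : ∀ ω : ℕ → Σ 𝔐 : ExtStruct 𝒮.setting, State 𝔐,
      (∀ n, (ω n).1.toStruct.Rich Δ) → (∀ n E, Finite ((ω n).1.Idx E)) →
      ∃ m n, m < n ∧ Sim (ω m).2 (ω n).2)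
    (hsim : ∀ {𝔐 𝔐' : ExtStruct 𝒮.setting}, 𝔐.toStruct.Rich Δ → 𝔐'.toStruct.Rich Δ →
      ∀ {s : State 𝔐} {s' : State 𝔐'}, Sim s s' → ∀ τ ∈ 𝒮.trans, ∀ t, τ.Rel s t →
        ∃ t', τ.Rel s' t' ∧ Sim t t')
    (hup : ∀ {𝔐 𝔐' : ExtStruct 𝒮.setting}, 𝔐.toStruct.Rich Δ → 𝔐'.toStruct.Rich Δ →
      ∀ {s : State 𝔐} {s' : State 𝔐'}, Sim s s' → υ 𝔐 s → υ 𝔐' s') :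
    𝒮.Terminates υ := by
  refine ⟨htheory ▸ exists_isModelCompletion hσ Δ, hυ, fun Ts hTs => ?_⟩
  rw [htheory] at hTs
  have hrich : ∀ {𝔄 : Struct σ}, 𝔄.Models Ts ↔ 𝔄.Rich Δ := hTs.models_iff_rich hσ
  refine ⟨fun φ => ?_, fun φ hφ => ?_⟩
  · have := Expressible.exists_mem (T := Ts) 𝒮.trans
      (P := fun τ 𝔐 s => ∃ s', τ.Rel s s' ∧ φ.sat 𝔐 s') fun τ _ => by
        obtain ⟨ψ, hψ⟩ := τ.exists_pre (Δ := Δ) hσ φ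
        exact ⟨ψ, fun 𝔐 h𝔐 s => hψ 𝔐 (hrich.1 h𝔐) s⟩
    refine this.congr fun 𝔐 _ s => ⟨?_, ?_⟩
    · rintro ⟨τ, hτ, s', hs', h⟩
      exact ⟨s', ⟨τ, hτ, hs'⟩, h⟩
    · rintro ⟨s', ⟨τ, hτ, hs'⟩, h⟩
      exact ⟨τ, hτ, s', hs', h⟩
  · by_contra hacc
    obtain ⟨c, hc₀, hc⟩ := not_acc_iff_exists_descending_chain.1 hacc
    have hphi : ∀ n (𝔐 : ExtStruct 𝒮.setting), 𝔐.toStruct.Rich Δ → ∀ s : State 𝔐,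
        (c n).phi.sat 𝔐 s ↔ 𝒮.preIter υ n 𝔐 s := by
      intro n
      induction n with
      | zero =>
        intro 𝔐 h𝔐 s
        rw [hc₀]
        exact hφ 𝔐 (htheory ▸ h𝔐.models) s
      | succ n ih =>
        intro 𝔐 h𝔐 s
        rw [(hc n).2.2.2 𝔐 (hrich.2 h𝔐) s]
        simp only [System.preIter, System.pre]
        exact exists_congr fun s' => and_congr_right fun _ => ih 𝔐 h𝔐 s'
    have hB : ∀ m n, m < n → (c m).phi ∈ (c n).B := by
      intro m n hmn
      induction n with
      | zero => omega
      | succ n ih =>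
        rw [(hc n).2.2.1]
        rcases Nat.lt_succ_iff_lt_or_eq.1 hmn with h | rfl
        · exact List.mem_cons_of_mem _ (ih h)
        · exact List.mem_cons_self
    have hmono : ∀ n (𝔐 𝔐' : ExtStruct 𝒮.setting), 𝔐.toStruct.Rich Δ → 𝔐'.toStruct.Rich Δ →
        ∀ (s : State 𝔐) (s' : State 𝔐'), Sim s s' → 𝒮.preIter υ n 𝔐 s →
          𝒮.preIter υ n 𝔐' s' := by
      intro n
      induction n with
      | zero => exact fun 𝔐 𝔐' h h' s s' hss => hup h h' hss
      | succ n ih =>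
        rintro 𝔐 𝔐' h h' s s' hss ⟨t, ⟨τ, hτ, hst⟩, ht⟩
        obtain ⟨t', hst', htt⟩ := hsim h h' hss τ hτ t hst
        exact ⟨t', ⟨τ, hτ, hst'⟩, ih 𝔐 𝔐' h h' t t' htt ht⟩
    have hω : ∀ n, ∃ ω : Σ 𝔐 : ExtStruct 𝒮.setting, State 𝔐, ω.1.toStruct.Rich Δ ∧
        (∀ E, Finite (ω.1.Idx E)) ∧ (c n).phi.sat ω.1 ω.2 ∧
          ¬ ∃ ψ ∈ (c n).B, StateFormula.sat ψ ω.1 ω.2 := by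
      intro n
      obtain ⟨𝔐, h𝔐, s, hs, hs'⟩ := (hc n).1
      rw [htheory] at h𝔐
      exact exists_rich_finite h𝔐 hs hs'
    choose ω h₁ h₂ h₃ h₄ using hω
    obtain ⟨m, n, hmn, hs⟩ := hwqo ω h₁ h₂
    refine h₄ n ⟨_, hB m n hmn, (hphi m _ (h₁ n) _).2 ?_⟩
    exact hmono m _ _ (h₁ m) (h₁ n) _ _ hs ((hphi m _ (h₁ m) _).1 (h₃ m))

end Termination
end RAS

namespace DAB

open RAS

/-! ## The signature of an acyclic catalog -/

theorem Model.Acyclic.tame {M : Model} (h : M.Acyclic) (k : ℕ) : (sig M.schema k).Tame := by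
  have := M.schema.cat_finite
  have hfin : Finite (sig M.schema k).Fn :=
    inferInstanceAs (Finite (Σ R : M.schema.Cat, Fin (M.schema.catArity R)))
  let r : (sig M.schema k).Fn → (sig M.schema k).Fn → Prop := fun f g =>
    (sig M.schema k).tgt f = (sig M.schema k).src g
  have hr : ∀ f g, Relation.TransGen r f g →
      Relation.TransGen (CatEdge M.schema) ⟨f.1, some f.2⟩ ⟨g.1, some g.2⟩ := by
    have step : ∀ f g, r f g →
        Relation.TransGen (CatEdge M.schema) ⟨f.1, some f.2⟩ ⟨g.1, some g.2⟩ := fun f g hfg =>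
      .tail (.single (.ref f.1 f.2 g.1 (Option.some.inj hfg))) (.attr g.1 g.2)
    intro f g hfg
    induction hfg with
    | single h => exact step _ _ h
    | tail _ h ih => exact ih.trans (step _ _ h)
  have irr : Std.Irrefl (Relation.TransGen r) := ⟨fun f hf => h _ (hr f f hf)⟩
  have irr' : Std.Irrefl (Function.swap (Relation.TransGen r)) := ⟨fun f hf => h _ (hr f f hf)⟩
  have trans' : IsTrans _ (Function.swap (Relation.TransGen r)) :=
    ⟨fun _ _ _ h h' => Relation.TransGen.trans h' h⟩
  have wf := Finite.wellFounded_of_trans_of_irrefl (Relation.TransGen r)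
  have wf' := Finite.wellFounded_of_trans_of_irrefl (Function.swap (Relation.TransGen r))
  refine ⟨hfin, ⟨fun S => ⟨_, ?_⟩⟩, ⟨fun S => ⟨_, ?_⟩⟩⟩
  · rintro _ ⟨f, -, rfl⟩
    induction f using wf'.induction with
    | _ f ih =>
    refine ⟨_, ?_⟩
    rintro _ ⟨g, hg, rfl⟩
    exact ih g (.single hg.symm)
  · rintro _ ⟨f, rfl, -⟩
    induction f using wf.induction with
    | _ f ih =>
    refine ⟨_, ?_⟩
    rintro _ ⟨g, rfl, hg⟩
    exact ih g (.single hg)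

theorem Model.finite_name (M : Model) : Finite M.Name :=
  (M.root.names.finite_toSet.subset fun n _ => M.names_all n).to_subtype.of_surjective
    (fun x : {n // n ∈ Set.univ} => x.1) fun n => ⟨⟨n, trivial⟩, rfl⟩

instance {N : Type} [Finite N] : Finite (CtlVar N) :=
  Finite.of_surjective (fun x : N ⊕ N => x.elim CtlVar.life CtlVar.flag) (by
    rintro (n | n)
    · exact ⟨.inl n, rfl⟩
    · exact ⟨.inr n, rfl⟩)

instance {D : DataSchema} {N : Type} [Finite N] : Finite (Slot D N) := by
  have := D.cvar_finite
  exact Finite.of_surjective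
    (fun x : Unit ⊕ D.CVar ⊕ CtlVar N => x.elim (fun _ => Slot.self) (Sum.elim .data .ctl)) (by
      rintro (_ | x | c)
      · exact ⟨.inl (), rfl⟩
      · exact ⟨.inr (.inl x), rfl⟩
      · exact ⟨.inr (.inr c), rfl⟩)

/-! ## The simulation -/

section Simulation

variable {D : DataSchema} {N : Type} {k : ℕ} {Cs : Set (Σ S, (sig D k).Cst S)}
  {𝔐 𝔐' : ExtStruct (setting D N k)}

/-- The identifiers and the control variables of all cases correspond. -/
structure CommonRel (ρ : Corr Cs 𝔐.toStruct 𝔐'.toStruct) (s : State 𝔐) (s' : State 𝔐') : Prop where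
  self : ∀ i, ρ.rel (s.art (i, Slot.self)) (s'.art (i, Slot.self))
  ctl : ∀ i c, ρ.rel (s.art (i, Slot.ctl c)) (s'.art (i, Slot.ctl c))

/-- The variables of the case `j` correspond. -/
structure CaseRel (ρ : Corr Cs 𝔐.toStruct 𝔐'.toStruct) (j : Fin k) (s : State 𝔐) (s' : State 𝔐') :
    Prop extends CommonRel ρ s s' where
  data : ∀ x, ρ.rel (s.art (j, Slot.data x)) (s'.art (j, Slot.data x))

/-- The rows `i` and `i'` correspond. -/
structure RowRel (ρ : Corr Cs 𝔐.toStruct 𝔐'.toStruct) (R : D.Repo) (i : 𝔐.Idx R) (i' : 𝔐'.Idx R)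
    (s : State 𝔐) (s' : State 𝔐') : Prop extends CommonRel ρ s s' where
  row : ∀ a, ρ.rel (s.arr ⟨R, a⟩ i) (s'.arr ⟨R, a⟩ i')

theorem CommonRel.mono {ρ ρ' : PIso Cs 𝔐.toStruct 𝔐'.toStruct} {s : State 𝔐} {s' : State 𝔐'}
    (hρ : ρ ≤ ρ') (h : CommonRel ρ.toCorr s s') : CommonRel ρ'.toCorr s s' :=
  ⟨fun i => hρ (h.self i), fun i c => hρ (h.ctl i c)⟩

theorem CaseRel.mono {ρ ρ' : PIso Cs 𝔐.toStruct 𝔐'.toStruct} {j : Fin k} {s : State 𝔐}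
    {s' : State 𝔐'} (hρ : ρ ≤ ρ') (h : CaseRel ρ.toCorr j s s') : CaseRel ρ'.toCorr j s s' :=
  ⟨h.toCommonRel.mono hρ, fun x => hρ (h.data x)⟩

theorem RowRel.mono {ρ ρ' : PIso Cs 𝔐.toStruct 𝔐'.toStruct} {R : D.Repo} {i : 𝔐.Idx R}
    {i' : 𝔐'.Idx R} {s : State 𝔐} {s' : State 𝔐'} (hρ : ρ ≤ ρ')
    (h : RowRel ρ.toCorr R i i' s s') : RowRel ρ'.toCorr R i i' s s' :=
  ⟨h.toCommonRel.mono hρ, fun x => hρ (h.row x)⟩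

/-- The state `s'` has corresponding cases and, for each row of `s`, a corresponding row. -/
structure SimVia (Cs : Set (Σ S, (sig D k).Cst S)) (ι : ∀ R : D.Repo, 𝔐.Idx R → 𝔐'.Idx R)
    (s : State 𝔐) (s' : State 𝔐') : Prop where
  case : ∀ j, ∃ ρ : PIso Cs 𝔐.toStruct 𝔐'.toStruct, CaseRel ρ.toCorr j s s'
  row : ∀ R i, ∃ ρ : PIso Cs 𝔐.toStruct 𝔐'.toStruct, RowRel ρ.toCorr R i (ι R i) s s'

def Sim (Cs : Set (Σ S, (sig D k).Cst S)) (s : State 𝔐) (s' : State 𝔐') : Prop :=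
  ∃ ι : ∀ R : D.Repo, 𝔐.Idx R → 𝔐'.Idx R, (∀ R, Function.Injective (ι R)) ∧ SimVia Cs ι s s'

theorem exists_injective_of_card_fiber_le {α β Θ : Type} [Finite α] [Finite β] (f : α → Θ)
    (g : β → Θ) (h : ∀ θ, Nat.card {a // f a = θ} ≤ Nat.card {b // g b = θ}) :
    ∃ ι : α → β, Function.Injective ι ∧ ∀ a, g (ι a) = f a := by
  have := Fintype.ofFinite α
  have := Fintype.ofFinite β
  have emb : ∀ θ, Nonempty ({a // f a = θ} ↪ {b // g b = θ}) := fun θ =>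
    Function.Embedding.nonempty_of_card_le (by simpa only [Nat.card_eq_fintype_card] using h θ)
  have F : ∀ θ, {a // f a = θ} ↪ {b // g b = θ} := fun θ => Classical.choice (emb θ)
  have hg : ∀ a, g (F (f a) ⟨a, rfl⟩).1 = f a := fun a => (F (f a) ⟨a, rfl⟩).2
  refine ⟨fun a => (F (f a) ⟨a, rfl⟩).1, fun a a' haa => ?_, hg⟩
  have hf : f a = f a' := by
    rw [← hg a, ← hg a']
    exact congrArg g haa
  have key : ∀ θ (h : f a = θ) (h' : f a' = θ), (F θ ⟨a, h⟩).1 = (F θ ⟨a', h'⟩).1 → a = a' := by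
    intro θ h h' heq
    simpa using (F θ).injective (Subtype.ext heq)
  refine key (f a') hf rfl (Eq.trans ?_ haa)
  have : ∀ θ (h : f a = θ), (F θ ⟨a, h⟩).1 = (F (f a) ⟨a, rfl⟩).1 := by
    rintro _ rfl
    rfl
  exact this _ hf

/-- States over finite index sets are well-quasi-ordered by simulation. -/
theorem exists_sim_of_sequence [Finite N] (hσ : (sig D k).Tame) (hC : Cs.Finite)
    (ω : ℕ → Σ 𝔐 : ExtStruct (setting D N k), State 𝔐) (hstrict : ∀ n, (ω n).1.toStruct.Strict)
    (hfin : ∀ n E, Finite ((ω n).1.Idx E)) : ∃ m n, m < n ∧ Sim Cs (ω m).2 (ω n).2 := by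
  have := D.repo_finite
  have hav : Finite (Fin k × Slot D N) := inferInstance
  choose Θ₁ hΘ₁ tp₁ htp₁ using fun j : Fin k =>
    exists_finite_types (Cs := Cs) hσ hC (ι := {x : Fin k × Slot D N // ∀ v, x.2 = .data v → x.1 = j})
      fun x => x.1.2.sort
  choose Θ₂ hΘ₂ tp₂ htp₂ using fun R : D.Repo =>
    exists_finite_types (Cs := Cs) hσ hC
      (ι := {x : Fin k × Slot D N // ∀ v, x.2 ≠ .data v} ⊕ Fin (D.repoArity R))
      (Sum.elim (fun x => x.1.2.sort) fun a => some (D.repoAttr R a))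
  let rowTp : ∀ (n : ℕ) (R : D.Repo), (ω n).1.Idx R → Θ₂ R := fun n R i =>
    tp₂ R (ω n).1.toStruct fun x => match x with
      | .inl x => (ω n).2.art x.1
      | .inr a => (ω n).2.arr ⟨R, a⟩ i
  let code : ℕ → (∀ j, Θ₁ j) × ((Σ R, Θ₂ R) → ℕ) := fun n =>
    (fun j => tp₁ j (ω n).1.toStruct fun x => (ω n).2.art x.1,
      fun θ => Nat.card {i // rowTp n θ.1 i = θ.2})
  obtain ⟨m, n, hmn, h₁, h₂⟩ := ((Finite.wellQuasiOrdered (α := ∀ j, Θ₁ j) Eq).prod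
    (wellQuasiOrdered_le (α := (Σ R, Θ₂ R) → ℕ))) code
  refine ⟨m, n, hmn, ?_⟩
  choose ι hι hrow using fun R : D.Repo =>
    have := hfin m R
    have := hfin n R
    exists_injective_of_card_fiber_le (rowTp m R) (rowTp n R) fun θ => h₂ ⟨R, θ⟩
  refine ⟨ι, hι, fun j => ?_, fun R i => ?_⟩
  · obtain ⟨ρ, hρ⟩ := htp₁ j _ _ (hstrict m) (hstrict n) _ _ (congrFun h₁ j)
    exact ⟨ρ, ⟨⟨fun i => hρ ⟨(i, .self), nofun⟩, fun i c => hρ ⟨(i, .ctl c), nofun⟩⟩,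
      fun x => hρ ⟨(j, .data x), fun _ _ => rfl⟩⟩⟩
  · obtain ⟨ρ, hρ⟩ := htp₂ R _ _ (hstrict m) (hstrict n) _ _ (hrow R i).symm
    exact ⟨ρ, ⟨⟨fun i => hρ (.inl ⟨(i, .self), nofun⟩), fun i c => hρ (.inl ⟨(i, .ctl c), nofun⟩)⟩,
      fun a => hρ (.inr a)⟩⟩

end Simulation

/-! ## Queries in corresponding states -/

section Queries

variable {D : DataSchema} {N : Type} {k : ℕ} {Cs : Set (Σ S, (sig D k).Cst S)}
  {𝔐 𝔐' : ExtStruct (setting D N k)} {ρ : Corr Cs 𝔐.toStruct 𝔐'.toStruct}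
  {W W' : Option D.Ty → Type} {I I' : D.Repo → Type} {V : D.Ty → Type} {C : Type}
  {s : State 𝔐} {s' : State 𝔐'}
  {y : ∀ S, W S → 𝔐.Dom S} {y' : ∀ S, W' S → 𝔐'.Dom S}
  {e : ∀ E, I E → 𝔐.Idx E} {e' : ∀ E, I' E → 𝔐'.Idx E}
  {Y : Set (Σ S, W S)} {K : ∀ E, Set (I E)} {j : Fin k}
  {ν : ∀ S, V S → ATerm (setting D N k) W I (some S)}
  {ν' : ∀ S, V S → ATerm (setting D N k) W' I' (some S)}

/-- The translations of the variables in `X` have corresponding values. -/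
def VarRel (ρ : Corr Cs 𝔐.toStruct 𝔐'.toStruct) (s : State 𝔐) (s' : State 𝔐')
    (y : ∀ S, W S → 𝔐.Dom S) (y' : ∀ S, W' S → 𝔐'.Dom S)
    (e : ∀ E, I E → 𝔐.Idx E) (e' : ∀ E, I' E → 𝔐'.Idx E)
    (Y : Set (Σ S, W S)) (K : ∀ E, Set (I E))
    (ν : ∀ S, V S → ATerm (setting D N k) W I (some S))
    (ν' : ∀ S, V S → ATerm (setting D N k) W' I' (some S)) (X : Set (Σ S, V S)) : Prop :=
  ∀ v ∈ X, Term.In (Cell.allIn Y K) Cs (ν v.1 v.2) →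
    ρ.rel ((ν v.1 v.2).eval 𝔐.toStruct (Cell.eval s y e))
      ((ν' v.1 v.2).eval 𝔐'.toStruct (Cell.eval s' y' e'))

theorem VarRel.mono {X X' : Set (Σ S, V S)} (hX : X ⊆ X')
    (h : VarRel ρ s s' y y' e e' Y K ν ν' X') : VarRel ρ s s' y y' e e' Y K ν ν' X :=
  fun v hv => h v (hX hv)

theorem rel_trQTerm {S : D.Ty} (t : QTerm D V S)
    (ht : Term.In (Cell.allIn Y K) Cs (trQTerm j ν t))
    (hv : VarRel ρ s s' y y' e e' Y K ν ν' t.vars) (hc : t.CaseFree ∨ CaseRel ρ j s s') :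
    ρ.rel ((trQTerm j ν t).eval 𝔐.toStruct (Cell.eval s y e))
      ((trQTerm j ν' t).eval 𝔐'.toStruct (Cell.eval s' y' e')) := by
  cases t with
  | var v => exact hv _ rfl ht
  | cvar x => exact (hc.resolve_left id).data x
  | self => exact (hc.resolve_left id).self j
  | obj c => exact ρ.cst _ ht

theorem rel_trETerm {S : D.Ty} (t : ETerm D V S)
    (ht : Term.In (Cell.allIn Y K) Cs (trETerm ν t))
    (hv : VarRel ρ s s' y y' e e' Y K ν ν' t.vars) :
    ρ.rel ((trETerm ν t).eval 𝔐.toStruct (Cell.eval s y e))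
      ((trETerm ν' t).eval 𝔐'.toStruct (Cell.eval s' y' e')) := by
  cases t with
  | var v => exact hv _ rfl ht
  | obj c => exact ρ.cst _ ht

theorem holds_rowEq {R : D.Repo} {i : I R}
    {t : ∀ a, ATerm (setting D N k) W I (some (D.repoAttr R a))} :
    (rowEq R i t).Holds s y e ↔
      ∀ a, s.arr ⟨R, a⟩ (e R i) = (t a).eval 𝔐.toStruct (Cell.eval s y e) := by
  simp only [rowEq, QF.holds_conj, List.forall_mem_ofFn_iff]
  exact Iff.rfl

theorem trAtom_holds_iff {ix : ∀ R, I R} {ix' : ∀ R, I' R} {life : C → CtlVar N}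
    (a : Atom D V C) (ha : (trAtom j ν ix life a).In Y K Cs)
    (hv : VarRel ρ s s' y y' e e' Y K ν ν' a.vars) (hc : a.CaseFree ∨ CaseRel ρ j s s')
    (hr : ∀ R args, a = .repo R args →
      ∀ c, ρ.rel (s.arr ⟨R, c⟩ (e R (ix R))) (s'.arr ⟨R, c⟩ (e' R (ix' R)))) :
    (trAtom j ν ix life a).Holds s y e ↔ (trAtom j ν' ix' life a).Holds s' y' e' := by
  cases a with
  | eq t u =>
    exact ρ.eq_iff
      (rel_trQTerm t ha.1 (hv.mono Set.subset_union_left) (hc.imp_left And.left))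
      (rel_trQTerm u ha.2 (hv.mono Set.subset_union_right) (hc.imp_left And.right))
  | cat R key args =>
    have hkey := rel_trQTerm key ha.1.1 (hv.mono Set.subset_union_left) (hc.imp_left And.left)
    have hargs := ha.2
    simp only [QF.in_conj, List.forall_mem_ofFn_iff] at hargs
    refine and_congr (not_congr (ρ.eq_iff hkey (ρ.undef (some (D.catKey R))))) ?_
    simp only [QF.holds_conj, List.forall_mem_ofFn_iff]
    refine forall_congr' fun c => ρ.eq_iff (rel_trQTerm (args c) (hargs c).1
      (hv.mono ?_) (hc.imp_left fun h => h.2 c)) (ρ.fn _ hkey)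
    exact (Set.subset_iUnion (fun a => (args a).vars) c).trans Set.subset_union_right
  | repo R args =>
    simp only [trAtom, rowEq, QF.in_conj, List.forall_mem_ofFn_iff] at ha
    simp only [trAtom, holds_rowEq]
    refine forall_congr' fun c => ρ.eq_iff (hr R args rfl c) (rel_trQTerm (args c) (ha c).2
      (hv.mono (Set.subset_iUnion (fun a => (args a).vars) c)) (hc.imp_left fun h => h c))
  | ctlState b l => exact ρ.eq_iff ((hc.resolve_left id).ctl j _) (ρ.cst _ ha.2)
  | ctlEq b b' => exact ρ.eq_iff ((hc.resolve_left id).ctl j _) ((hc.resolve_left id).ctl j _)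

theorem holds_trCQ {ix : ℕ → ∀ R, I R} {life : C → CtlVar N} {Q : CQ D V C} :
    (trCQ j ν ix life Q).Holds s y e ↔ ∀ p (h : p < Q.length),
      ((trAtom j ν (ix (p + 1)) life Q[p].atom).Holds s y e ↔ Q[p].positive = true) := by
  simp only [trCQ, QF.holds_conj, List.mem_mapIdx, forall_exists_index]
  constructor
  · intro h p hp
    have := h _ p hp rfl
    split_ifs at this with hpos
    · exact iff_of_true this hpos
    · exact iff_of_false this hpos
  · rintro h _ p hp rfl
    have := h p hp
    split_ifs with hpos
    · exact this.2 hpos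
    · exact fun h' => hpos (this.1 h')

theorem in_trCQ {ix : ℕ → ∀ R, I R} {life : C → CtlVar N} {Q : CQ D V C} :
    (trCQ j ν ix life Q).In Y K Cs ↔ ∀ p (h : p < Q.length),
      (trAtom j ν (ix (p + 1)) life Q[p].atom).In Y K Cs := by
  simp only [trCQ, QF.in_conj, List.mem_mapIdx, forall_exists_index]
  constructor
  · intro h p hp
    have := h _ p hp rfl
    split_ifs at this with hpos
    · exact this
    · exact this
  · rintro h _ p hp rfl
    split_ifs
    · exact h p hp
    · exact h p hp

theorem trCQ_holds_iff {ix : ℕ → ∀ R, I R} {ix' : ℕ → ∀ R, I' R} {life : C → CtlVar N}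
    {Q : CQ D V C} (h : ∀ p (h : p < Q.length),
      (trAtom j ν (ix (p + 1)) life Q[p].atom).Holds s y e ↔
        (trAtom j ν' (ix' (p + 1)) life Q[p].atom).Holds s' y' e') :
    (trCQ j ν ix life Q).Holds s y e ↔ (trCQ j ν' ix' life Q).Holds s' y' e' := by
  rw [holds_trCQ, holds_trCQ]
  exact forall_congr' fun p => forall_congr' fun hp => by rw [h p hp]

theorem trCQ_holds_iff_of_repoFree {ix : ℕ → ∀ R, I R} {ix' : ℕ → ∀ R, I' R}
    {life : C → CtlVar N} {Q : CQ D V C} (hQ : cqRepoFree Q)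
    (hIn : (trCQ j ν ix life Q).In Y K Cs) (hv : VarRel ρ s s' y y' e e' Y K ν ν' (cqVars Q))
    (hc : cqCaseFree Q ∨ CaseRel ρ j s s') :
    (trCQ j ν ix life Q).Holds s y e ↔ (trCQ j ν' ix' life Q).Holds s' y' e' := by
  refine trCQ_holds_iff fun p hp => trAtom_holds_iff _ (in_trCQ.1 hIn p hp)
    (hv.mono (X' := cqVars Q) fun x hx => ⟨_, List.getElem_mem hp, hx⟩)
    (hc.imp_left fun h => h _ (List.getElem_mem hp)) fun R args h => ?_
  exact (hQ _ (List.getElem_mem hp) (by rw [h]; trivial)).elim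

end Queries

/-! ## Separated queries -/

section Separated

variable {D : DataSchema} {N : Type} {k : ℕ} {Cs : Set (Σ S, (sig D k).Cst S)}
  {𝔐 𝔐' : ExtStruct (setting D N k)} {C : Type} {s : State 𝔐} {s' : State 𝔐'}
  {y : ∀ S, ℕ → 𝔐.Dom S} {Y : Set (Σ _ : Option D.Ty, ℕ)} {j : Fin k}

theorem varRel_stdVar {ρ : Corr Cs 𝔐.toStruct 𝔐'.toStruct} {I I' : D.Repo → Type}
    {y' : ∀ S, ℕ → 𝔐'.Dom S} {e : ∀ E, I E → 𝔐.Idx E} {e' : ∀ E, I' E → 𝔐'.Idx E}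
    {K : ∀ E, Set (I E)} {X : Set (Σ S, NVar D S)}
    (h : ∀ v ∈ X, (⟨some v.1, v.2⟩ : Σ _ : Option D.Ty, ℕ) ∈ Y →
      ρ.rel (y (some v.1) v.2) (y' (some v.1) v.2)) :
    VarRel ρ s s' y y' e e' Y K (stdVar I) (stdVar I') X :=
  fun v hv hin => h v hv hin

/-- The assignment that agrees with `y₁` on `X` and with `y₂` elsewhere. -/
def mix {𝔄 : Struct (sig D k)} (X : Set (Σ S, NVar D S)) (y₁ y₂ : ∀ S, ℕ → 𝔄.Dom S) :
    ∀ S, ℕ → 𝔄.Dom S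
  | none, n => y₂ none n
  | some S, n => if (⟨S, n⟩ : Σ S, NVar D S) ∈ X then y₁ (some S) n else y₂ (some S) n

theorem mix_of_mem {𝔄 : Struct (sig D k)} {X : Set (Σ S, NVar D S)} {y₁ y₂ : ∀ S, ℕ → 𝔄.Dom S}
    {v : Σ S, NVar D S} (h : v ∈ X) : mix X y₁ y₂ (some v.1) v.2 = y₁ (some v.1) v.2 :=
  if_pos h

theorem mix_of_notMem {𝔄 : Struct (sig D k)} {X : Set (Σ S, NVar D S)}
    {y₁ y₂ : ∀ S, ℕ → 𝔄.Dom S} {v : Σ S, NVar D S} (h : v ∉ X) :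
    mix X y₁ y₂ (some v.1) v.2 = y₂ (some v.1) v.2 :=
  if_neg h

theorem Split.Separates.mem_cases {Q : CQ D (NVar D) C} {p : Split D C} (hp : p.Separates Q)
    {l : Literal D (NVar D) C} (hl : l ∈ Q) : l ∈ p.chi ∨ l ∈ p.tupleLits ∨ l ∈ p.xi := by
  have := hp.perm.mem_iff.1 hl
  simpa [or_assoc] using this

theorem Split.mem_tupleLits {p : Split D C} {l : Literal D (NVar D) C} (hl : l ∈ p.tupleLits) :
    ∃ R t, p.tuple = some ⟨R, t⟩ ∧ l = ⟨true, .repo R t⟩ := by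
  unfold Split.tupleLits at hl
  split at hl
  · simp at hl
  · next R t h => exact ⟨R, t, h, by simpa using hl⟩

/-- A separated query is transferred by one correspondence for `χ` and one for the rest. -/
theorem trCQ_holds_of_separates {ρ₁ ρ₂ : Corr Cs 𝔐.toStruct 𝔐'.toStruct} {K : ∀ _ : D.Repo, Set ℕ}
    {life : C → CtlVar N} {Q : CQ D (NVar D) C} {p : Split D C} (hp : p.Separates Q)
    {y₁ y₂ : ∀ S, ℕ → 𝔐'.Dom S} {e : ∀ E, 𝔐.Idx E} {e' : ∀ E, 𝔐'.Idx E}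
    (hIn : (trCQ (k := k) (N := N) j (stdVar _) (fun p _ => p) life Q).In Y K Cs)
    (hcase : CaseRel ρ₁ j s s') (hy₁ : ∀ x ∈ Y, ρ₁.rel (y x.1 x.2) (y₁ x.1 x.2))
    (hy₂ : ∀ x ∈ Y, ρ₂.rel (y x.1 x.2) (y₂ x.1 x.2))
    (hrow : ∀ R t, p.tuple = some ⟨R, t⟩ →
      ∀ c, ρ₂.rel (s.arr ⟨R, c⟩ (e R)) (s'.arr ⟨R, c⟩ (e' R)))
    (h : (trCQ j (stdVar _) (fun p _ => p) life Q).Holds s y (fun E (_ : ℕ) => e E)) :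
    (trCQ j (stdVar _) (fun p _ => p) life Q).Holds s' (mix (cqVars p.chi) y₁ y₂)
      (fun E (_ : ℕ) => e' E) := by
  refine (trCQ_holds_iff fun q hq => ?_).1 h
  have hin := in_trCQ.1 hIn q hq
  have hsub : ∀ {Q' : CQ D (NVar D) C}, Q[q] ∈ Q' → Q[q].atom.vars ⊆ cqVars Q' :=
    fun hl x hx => ⟨_, hl, hx⟩
  have vr₂ : ∀ {Q' : CQ D (NVar D) C}, Q[q] ∈ Q' → Disjoint (cqVars p.chi) (cqVars Q') →
      VarRel ρ₂ s s' y (mix (cqVars p.chi) y₁ y₂) (fun E (_ : ℕ) => e E) (fun E (_ : ℕ) => e' E)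
        Y K (stdVar _) (stdVar _) Q[q].atom.vars := by
    intro Q' hl hd
    refine varRel_stdVar fun v hv hvY => ?_
    rw [mix_of_notMem fun hc => Set.disjoint_left.1 hd hc (hsub hl hv)]
    exact hy₂ _ hvY
  rcases hp.mem_cases (List.getElem_mem hq) with hl | hl | hl
  · refine trAtom_holds_iff (ρ := ρ₁) _ hin (varRel_stdVar fun v hv hvY => ?_) (Or.inr hcase)
      fun R args hR => (hp.chi_repoFree _ hl (by rw [hR]; trivial)).elim
    rw [mix_of_mem (hsub hl hv)]
    exact hy₁ _ hvY
  · refine trAtom_holds_iff (ρ := ρ₂) _ hin (vr₂ hl hp.chi_tuple)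
      (Or.inl (hp.tuple_caseFree _ hl)) fun R args hR => ?_
    obtain ⟨R', t, ht, heq⟩ := Split.mem_tupleLits hl
    rw [heq] at hR
    obtain ⟨rfl, -⟩ := Atom.repo.inj hR
    exact hrow R' t ht
  · exact trAtom_holds_iff (ρ := ρ₂) _ hin (vr₂ hl hp.chi_xi)
      (Or.inl (hp.xi_caseFree _ hl))
      fun R args hR => (hp.xi_repoFree _ hl (by rw [hR]; trivial)).elim

theorem eval_trQTerm_stdVar {S : D.Ty} (t : QTerm D (NVar D) S) (e e' : ∀ E, ℕ → 𝔐.Idx E) :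
    (trQTerm j (stdVar fun _ => ℕ) t).eval 𝔐.toStruct (Cell.eval s y e) =
      (trQTerm j (stdVar fun _ => ℕ) t).eval 𝔐.toStruct (Cell.eval s y e') := by
  cases t <;> rfl

theorem CaseRel.refl (Cs : Set (Σ S, (sig D k).Cst S)) (s : State 𝔐) :
    CaseRel (Corr.refl Cs 𝔐.toStruct) j s s :=
  ⟨⟨fun _ => rfl, fun _ _ => rfl⟩, fun _ => rfl⟩

/-- In a separated query only the row of the repository atom matters. -/
theorem trCQ_holds_const {K : ∀ _ : D.Repo, Set ℕ} {life : C → CtlVar N} {Q : CQ D (NVar D) C}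
    {p : Split D C} (hp : p.Separates Q) {e : ∀ E, ℕ → 𝔐.Idx E} {e₁ : ∀ E, 𝔐.Idx E}
    (hIn : (trCQ (k := k) (N := N) j (stdVar _) (fun p _ => p) life Q).In Y K Cs)
    (htuple : ∀ R t, p.tuple = some ⟨R, t⟩ → ∀ a, s.arr ⟨R, a⟩ (e₁ R) =
      (trQTerm j (stdVar fun _ => ℕ) (t a)).eval 𝔐.toStruct (Cell.eval s y e))
    (h : (trCQ j (stdVar _) (fun p _ => p) life Q).Holds s y e) :
    (trCQ j (stdVar _) (fun p _ => p) life Q).Holds s y (fun E (_ : ℕ) => e₁ E) := by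
  rw [holds_trCQ] at h ⊢
  intro q hq
  by_cases hrepo : Q[q].atom.IsRepo
  · rcases hp.mem_cases (List.getElem_mem hq) with hl | hl | hl
    · exact (hp.chi_repoFree _ hl hrepo).elim
    · obtain ⟨R, t, ht, heq⟩ := Split.mem_tupleLits hl
      rw [heq]
      refine iff_of_true ?_ rfl
      simp only [trAtom, holds_rowEq]
      intro a
      rw [htuple R t ht a]
      exact eval_trQTerm_stdVar _ _ _
    · exact (hp.xi_repoFree _ hl hrepo).elim
  · rw [← h q hq]
    refine (trAtom_holds_iff (ρ := Corr.refl Cs _) _ (in_trCQ.1 hIn q hq)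
      (varRel_stdVar fun _ _ _ => rfl) (Or.inr (CaseRel.refl Cs s)) fun R args hR => ?_).symm
    exact (hrepo (by rw [hR]; trivial)).elim

/-- The row retrieved by a separated query. -/
theorem exists_tuple_row {life : C → CtlVar N} {Q : CQ D (NVar D) C}
    {p : Split D C} (hp : p.Separates Q) {R : D.Repo}
    {t : ∀ a, QTerm D (NVar D) (D.repoAttr R a)} (ht : p.tuple = some ⟨R, t⟩)
    {e : ∀ E, ℕ → 𝔐.Idx E} (h : (trCQ j (stdVar _) (fun p _ => p) life Q).Holds s y e) :
    ∃ q : ℕ, ∀ a, s.arr ⟨R, a⟩ (e R q) =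
      (trQTerm j (stdVar fun _ => ℕ) (t a)).eval 𝔐.toStruct (Cell.eval s y e) := by
  have hmem : (⟨true, .repo R t⟩ : Literal D (NVar D) C) ∈ Q := by
    rw [hp.perm.mem_iff]
    simp [Split.tupleLits, ht]
  obtain ⟨q, hq, hqe⟩ := List.getElem_of_mem hmem
  have := holds_trCQ.1 h q hq
  rw [hqe] at this
  simp only [trAtom, holds_rowEq, iff_true] at this
  exact ⟨q + 1, this⟩

end Separated

/-! ## Effects in corresponding states -/

section Effects

variable {D : DataSchema} {N : Type} {k : ℕ} {Cs : Set (Σ S, (sig D k).Cst S)}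
  {𝔐 𝔐' : ExtStruct (setting D N k)} {ρ : Corr Cs 𝔐.toStruct 𝔐'.toStruct}
  {s : State 𝔐} {s' : State 𝔐'}
  {y : ∀ S, ℕ → 𝔐.Dom S} {y' : ∀ S, ℕ → 𝔐'.Dom S} {e : ∀ E, ℕ → 𝔐.Idx E}
  {e' : ∀ E, ℕ → 𝔐'.Idx E} {Y : Set (Σ _ : Option D.Ty, ℕ)} {j : Fin k}

theorem rel_trBranch {R : D.Repo} {i : 𝔐.Idx R} {i' : 𝔐'.Idx R}
    {K : ∀ E : D.Repo, Set (WithCur (A := setting D N k) R E)} {a : Fin (D.repoArity R)}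
    (hrow : RowRel ρ R i i' s s') (b : Branch D R) (hcase : b.CaseFree) (hrepo : b.RepoFree)
    (hans : ∀ S n, (⟨S, UVar.ans n⟩ : Σ S, UVar D R S) ∉ b.vars)
    (hIn : (trBranch (N := N) j a b).In Y K Cs) :
    ρ.rel ((trBranch j a b).eval s y (WithCur.eval e i))
      ((trBranch j a b).eval s' y' (WithCur.eval e' i')) := by
  have hv : ∀ X : Set (Σ S, UVar D R S), (∀ S n, (⟨S, UVar.ans n⟩ : Σ S, UVar D R S) ∉ X) →
      VarRel ρ s s' y y' (WithCur.eval e i) (WithCur.eval e' i') Y K (rowVar R) (rowVar R) X := by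
    rintro X hX ⟨S, v⟩ hv -
    cases v with
    | ans n => exact (hX _ _ hv).elim
    | new a => exact hrow.row a
  induction b with
  | tup u =>
    refine rel_trETerm (u a) hIn (hv _ fun S n h => hans S n ?_)
    exact Set.mem_iUnion.2 ⟨a, h⟩
  | ite ψ b₁ b₂ ih₁ ih₂ =>
    have hψ : (QF.disj (ψ.map (trCQ j (rowVar R) (fun p _ => WithCur.old p) Empty.elim))).Holds s y
          (WithCur.eval e i) ↔
        (QF.disj (ψ.map (trCQ j (rowVar R) (fun p _ => WithCur.old p) Empty.elim))).Holds s' y'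
          (WithCur.eval e' i') := by
      rw [QF.holds_disj, QF.holds_disj]
      simp only [List.mem_map, exists_exists_and_eq_and]
      refine exists_congr fun Q => and_congr_right fun hQ => ?_
      have hIn' := QF.in_disj.1 hIn.1
      simp only [List.mem_map, forall_exists_index, and_imp, forall_apply_eq_imp_iff₂] at hIn'
      refine trCQ_holds_iff_of_repoFree (hrepo.1 Q hQ) (hIn' Q hQ) (hv _ fun S n h => hans S n ?_)
        (Or.inl (hcase.1 Q hQ))
      exact Or.inl (Or.inl ⟨Q, hQ, h⟩)
    have h₁ := ih₁ hcase.2.1 hrepo.2.1 (fun S n h => hans S n (Or.inl (Or.inr h))) hIn.2.1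
    have h₂ := ih₂ hcase.2.2 hrepo.2.2 (fun S n h => hans S n (Or.inr h)) hIn.2.2
    simp only [trBranch, CaseDef.eval]
    by_cases h : (QF.disj (ψ.map (trCQ j (rowVar R) (fun p _ => WithCur.old p) Empty.elim))).Holds s
        y (WithCur.eval e i)
    · rw [if_pos h, if_pos (hψ.1 h)]
      exact h₁
    · rw [if_neg h, if_neg (fun h' => h (hψ.2 h'))]
      exact h₂

theorem trCond_holds_iff {K : ∀ _ : D.Repo, Set ℕ} (hcase : CaseRel ρ j s s')
    (hy : ∀ x ∈ Y, ρ.rel (y x.1 x.2) (y' x.1 x.2)) (φ : Cond D)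
    (hIn : (trCond (N := N) (k := k) j (stdVar _) φ).In Y K Cs) :
    (trCond j (stdVar _) φ).Holds s y e ↔ (trCond j (stdVar _) φ).Holds s' y' e' := by
  induction φ with
  | eq t u =>
    exact ρ.eq_iff (rel_trQTerm t hIn.1 (varRel_stdVar fun v _ hv => hy _ hv) (Or.inr hcase))
      (rel_trQTerm u hIn.2 (varRel_stdVar fun v _ hv => hy _ hv) (Or.inr hcase))
  | neg φ ih => exact not_congr (ih hIn)
  | and φ ψ ih₁ ih₂ => exact and_congr (ih₁ hIn.1) (ih₂ hIn.2)

variable {sem : InsertSem} {r : Rule D N} {Q : CQ D (NVar D) Empty} {N₀ : ℕ}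

theorem commonRel_post (hlife : ∀ l, (⟨none, TConst.life l⟩ : Σ S, TConst D k S) ∈ Cs)
    (h : CommonRel ρ s s') :
    CommonRel ρ ((trRule sem j r Q).post s y e) ((trRule sem j r Q).post s' y' e') := by
  constructor
  · intro i
    simp only [Transition.post, trRule, trArt]
    split_ifs
    · exact h.self i
    · exact h.self i
  · intro i c
    simp only [Transition.post, trRule, trArt]
    split_ifs
    · cases r.assigns.find? fun p => decide (p.1 = c) with
      | none => exact h.ctl i c
      | some p => exact ρ.cst _ (hlife p.2)
    · exact h.ctl i c

theorem caseRel_post_of_ne (hlife : ∀ l, (⟨none, TConst.life l⟩ : Σ S, TConst D k S) ∈ Cs)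
    {i : Fin k} (hij : i ≠ j) (h : CaseRel ρ i s s') :
    CaseRel ρ i ((trRule sem j r Q).post s y e) ((trRule sem j r Q).post s' y' e') := by
  refine ⟨commonRel_post hlife h.toCommonRel, fun x => ?_⟩
  simp only [Transition.post, trRule, trArt, if_neg hij]
  exact h.data x

theorem caseRel_post (hlife : ∀ l, (⟨none, TConst.life l⟩ : Σ S, TConst D k S) ∈ Cs)
    (hτ : (trRule sem j r Q).In Y N₀ Cs) (h : CommonRel ρ s s')
    (hkeep : ∀ x, (r.eff.bind fun E => effSet E x) = none →
      ρ.rel (s.art (j, Slot.data x)) (s'.art (j, Slot.data x)))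
    (hset : ∀ x t, (r.eff.bind fun E => effSet E x) = some t → ∀ v ∈ t.vars,
      (⟨some v.1, v.2⟩ : Σ _ : Option D.Ty, ℕ) ∈ Y → ρ.rel (y (some v.1) v.2) (y' (some v.1) v.2)) :
    CaseRel ρ j ((trRule sem j r Q).post s y e) ((trRule sem j r Q).post s' y' e') := by
  refine ⟨commonRel_post hlife h, fun x => ?_⟩
  have hart := hτ.art (j, .data x)
  simp only [trRule, trArt, if_true] at hart
  simp only [Transition.post, trRule, trArt, if_true]
  have hkeep := hkeep x
  have hset := hset x
  revert hart hkeep hset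
  cases (r.eff.bind fun E => effSet E x) with
  | none => exact fun _ hkeep _ => hkeep rfl
  | some t =>
    intro hart _ hset
    exact rel_trETerm t hart (varRel_stdVar (hset t rfl))

theorem arr_trRule_of_none (h : r.eff = none) (c : (setting D N k).Comp) :
    (trRule sem j r Q).arr c = keepRow c.1 c.2 := by
  simp only [trRule, h]

theorem arr_trRule_of_some {E : Effect D} (h : r.eff = some E) (c : (setting D N k).Comp) :
    (trRule sem j r Q).arr c = effRows sem j E c.1 c.2 := by
  simp only [trRule, h]

theorem rowRel_post_of_keep (hlife : ∀ l, (⟨none, TConst.life l⟩ : Σ S, TConst D k S) ∈ Cs)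
    {R : D.Repo} {i : 𝔐.Idx R} {i' : 𝔐'.Idx R}
    (hkeep : ∀ a, (trRule (k := k) sem j r Q).arr ⟨R, a⟩ = keepRow R a)
    (h : RowRel ρ R i i' s s') :
    RowRel ρ R i i' ((trRule sem j r Q).post s y e) ((trRule sem j r Q).post s' y' e') := by
  refine ⟨commonRel_post hlife h.toCommonRel, fun a => ?_⟩
  simp only [Transition.post, hkeep]
  exact h.row a

/-- The rows of `R` when the row `0` gets a new value and the others are kept. -/
theorem rowRel_post_of_ite (hlife : ∀ l, (⟨none, TConst.life l⟩ : Σ S, TConst D k S) ∈ Cs)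
    {R : D.Repo} {i : 𝔐.Idx R} {i' : 𝔐'.Idx R}
    {d : ∀ a, CaseDef (setting D N k) (fun _ => ℕ) (WithCur (A := setting D N k) R)
      (some (D.repoAttr R a))}
    (harr : ∀ a, (trRule (k := k) sem j r Q).arr ⟨R, a⟩ = .ite (isRow0 R) (d a) (keepRow R a))
    (hcommon : CommonRel ρ s s') (hii : i = e R 0 ↔ i' = e' R 0)
    (hnew : i = e R 0 → ∀ a,
      ρ.rel ((d a).eval s y (WithCur.eval e i)) ((d a).eval s' y' (WithCur.eval e' i')))
    (hold : i ≠ e R 0 → RowRel ρ R i i' s s') :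
    RowRel ρ R i i' ((trRule sem j r Q).post s y e) ((trRule sem j r Q).post s' y' e') := by
  refine ⟨commonRel_post hlife hcommon, fun a => ?_⟩
  simp only [Transition.post, harr, CaseDef.eval]
  have h₁ : (isRow0 (N := N) (k := k) R).Holds s y (WithCur.eval e i) ↔ i = e R 0 := Iff.rfl
  have h₂ : (isRow0 (N := N) (k := k) R).Holds s' y' (WithCur.eval e' i') ↔ i' = e' R 0 := Iff.rfl
  by_cases h : i = e R 0
  · rw [if_pos (h₁.2 h), if_pos (h₂.2 (hii.1 h))]
    exact hnew h a
  · rw [if_neg (fun h' => h (h₁.1 h')), if_neg (fun h' => h (hii.2 (h₂.1 h')))]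
    exact (hold h).row a

theorem holds_guard : (trRule sem j r Q).guard.Holds s y e ↔
    (∀ p ∈ r.tests, s.art (j, Slot.ctl p.1) = 𝔐.cst (TConst.life p.2)) ∧
    (∀ φ ∈ r.conds, (trCond j (stdVar _) φ).Holds s y e) ∧
    (trCQ j (stdVar _) (fun p _ => p) Empty.elim Q).Holds s y e ∧
    ∀ E, r.eff = some E → (effGuard E).Holds s y e := by
  simp only [trRule, QF.holds_conj, List.forall_mem_append, List.forall_mem_map,
    List.forall_mem_cons, List.not_mem_nil, false_implies, implies_true, and_true, and_assoc]
  refine and_congr Iff.rfl (and_congr Iff.rfl (and_congr Iff.rfl ?_))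
  cases r.eff with
  | none => simp [QF.Holds]
  | some E => simp

theorem in_guard {K : ∀ _ : D.Repo, Set ℕ} (h : (trRule (k := k) sem j r Q).guard.In Y K Cs) :
    (∀ φ ∈ r.conds, (trCond (N := N) (k := k) j (stdVar _) φ).In Y K Cs) ∧
    (trCQ (N := N) (k := k) j (stdVar _) (fun p _ => p) Empty.elim Q).In Y K Cs ∧
    ∀ E, r.eff = some E → (effGuard (N := N) (k := k) E).In Y K Cs := by
  simp only [trRule, QF.in_conj, List.forall_mem_append, List.forall_mem_map,
    List.forall_mem_cons, List.not_mem_nil, false_implies, implies_true, and_true, and_assoc] at h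
  refine ⟨h.2.1, h.2.2.1, fun E hE => ?_⟩
  have := h.2.2.2
  rw [hE] at this
  exact this

end Effects

/-! ## Transitions in corresponding states -/

section Steps

variable {D : DataSchema} {N : Type} {k : ℕ} {Cs : Set (Σ S, (sig D k).Cst S)}
  {Δ : ∀ S, TConst D k S → TConst D k S → Prop}
  {𝔐 𝔐' : ExtStruct (setting D N k)} {s : State 𝔐} {s' : State 𝔐'}
  {Y : Set (Σ _ : Option D.Ty, ℕ)} {N₀ : ℕ} {j : Fin k} {r : Rule D N}
  {Q : CQ D (NVar D) Empty}

/-- The effect deletes nothing, and its updates depend on the updated row only. -/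
def Effect.RowLocal : Effect D → Prop
  | .insertSet _ _ _ => True
  | .setOnly _ => True
  | .deleteSet _ _ _ => False
  | .update R ψ b₁ b₂ => (Branch.ite ψ b₁ b₂).CaseFree ∧ (Branch.ite ψ b₁ b₂).RepoFree ∧
      ∀ S n, (⟨S, UVar.ans n⟩ : Σ S, UVar D R S) ∉ (Branch.ite ψ b₁ b₂).vars

theorem exists_step_of_repoFree (hσ : (sig D k).Tame) (h𝔐 : 𝔐.toStruct.Rich Δ)
    (h𝔐' : 𝔐'.toStruct.Rich Δ) (hY : Y.Finite)
    (hlife : ∀ l, (⟨none, TConst.life l⟩ : Σ S, TConst D k S) ∈ Cs)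
    (hτ : (trRule .multiset j r Q).In Y N₀ Cs) (hQ : cqRepoFree Q)
    (heff : ∀ E, r.eff = some E → E.RowLocal) (hs : Sim Cs s s') {t : State 𝔐}
    (ht : (trRule .multiset j r Q).Rel s t) :
    ∃ t', (trRule .multiset j r Q).Rel s' t' ∧ Sim Cs t t' := by
  obtain ⟨ι, hι, hs⟩ := hs
  obtain ⟨y, e, hg, rfl⟩ := Transition.rel_iff.1 ht
  obtain ⟨ρ₀, h₀⟩ := hs.case j
  obtain ⟨ρ, hρ, y', hy⟩ := ρ₀.exists_extend_assignment hσ h𝔐.strict h𝔐' hY y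
  have hc := h₀.mono hρ
  let e' : ∀ E, ℕ → 𝔐'.Idx E := fun E n => ι E (e E n)
  obtain ⟨inConds, inQ, inEff⟩ := in_guard hτ.guard
  obtain ⟨g₁, g₂, g₃, g₄⟩ := holds_guard.1 hg
  refine ⟨_, Transition.rel_iff.2 ⟨y', e', holds_guard.2 ⟨fun p hp => ?_, fun φ hφ => ?_, ?_,
    fun E hE => ?_⟩, rfl⟩, ι, hι, fun i => ?_, fun R i => ?_⟩
  · exact (ρ.eq_iff (hc.ctl j p.1) (ρ.cst _ (hlife p.2))).1 (g₁ p hp)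
  · exact (trCond_holds_iff hc hy φ (inConds φ hφ)).1 (g₂ φ hφ)
  · exact (trCQ_holds_iff_of_repoFree hQ inQ (varRel_stdVar fun v _ hv => hy _ hv)
      (Or.inr hc)).1 g₃
  · have hE' := heff E hE
    have hEg := g₄ E hE
    cases E with
    | insertSet R u θ =>
      obtain ⟨ρ', h'⟩ := hs.row R (e R 0)
      simp only [effGuard, holds_rowEq] at hEg ⊢
      exact fun a => (ρ'.eq_iff (h'.row a) (ρ'.undef (some (D.repoAttr R a)))).1 (hEg a)
    | setOnly θ => trivial
    | deleteSet R u θ => exact hE'.elim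
    | update R ψ b₁ b₂ => trivial
  · by_cases hij : i = j
    · subst hij
      exact ⟨ρ, caseRel_post hlife hτ hc.toCommonRel (fun x _ => hc.data x)
        fun x t _ v _ hv => hy _ hv⟩
    · obtain ⟨ρ', h'⟩ := hs.case i
      exact ⟨ρ', caseRel_post_of_ne hlife hij h'⟩
  · obtain ⟨ρ', h'⟩ := hs.row R i
    cases hr : r.eff with
    | none => exact ⟨ρ', rowRel_post_of_keep hlife (fun a => arr_trRule_of_none hr ⟨R, a⟩) h'⟩
    | some E =>
      have harr := fun a => arr_trRule_of_some (k := k) (sem := .multiset) (j := j) (Q := Q) hr ⟨R, a⟩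
      have hE' := heff E hr
      cases E with
      | setOnly θ => exact ⟨ρ', rowRel_post_of_keep hlife harr h'⟩
      | deleteSet R' u θ => exact hE'.elim
      | insertSet R' u θ =>
        by_cases hR : R = R'
        · subst hR
          simp only [effRows, Function.update_self] at harr
          by_cases hi : i = e R 0
          · refine ⟨ρ, rowRel_post_of_ite hlife harr hc.toCommonRel (hι R).eq_iff.symm
              (fun _ a => ?_) fun h => absurd hi h⟩
            have hIn := hτ.arr ⟨R, a⟩
            rw [harr a] at hIn
            exact rel_trETerm (u a) hIn.2.1 (varRel_stdVar fun v _ hv => hy _ hv)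
          · exact ⟨ρ', rowRel_post_of_ite hlife harr h'.toCommonRel (hι R).eq_iff.symm
              (fun h => absurd h hi) fun _ => h'⟩
        · simp only [effRows, Function.update_of_ne hR] at harr
          exact ⟨ρ', rowRel_post_of_keep hlife harr h'⟩
      | update R' ψ b₁ b₂ =>
        by_cases hR : R = R'
        · subst hR
          simp only [effRows, Function.update_self] at harr
          refine ⟨ρ', commonRel_post hlife h'.toCommonRel, fun a => ?_⟩
          have hIn := hτ.arr ⟨R, a⟩
          rw [harr a] at hIn
          simp only [Transition.post, harr]
          exact rel_trBranch h' _ hE'.1 hE'.2.1 hE'.2.2 hIn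
        · simp only [effRows, Function.update_of_ne hR] at harr
          exact ⟨ρ', rowRel_post_of_keep hlife harr h'⟩

theorem Split.Separates.repoFree {C : Type} {Q : CQ D (NVar D) C} {p : Split D C}
    (hp : p.Separates Q) (h : p.tuple = none) : cqRepoFree Q := by
  intro l hl
  rcases hp.mem_cases hl with hl | hl | hl
  · exact hp.chi_repoFree l hl
  · obtain ⟨R, t, ht, -⟩ := Split.mem_tupleLits hl
    simp [h] at ht
  · exact hp.xi_repoFree l hl

/-- A separated query that holds in a state holds in any simulating state. -/
theorem exists_holds_trCQ_of_separates {C : Type} {life : C → CtlVar N} {Q : CQ D (NVar D) C}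
    {p : Split D C} (hσ : (sig D k).Tame) (h𝔐 : 𝔐.toStruct.Rich Δ) (h𝔐' : 𝔐'.toStruct.Rich Δ)
    (hY : Y.Finite) (hp : p.Separates Q) {K : ∀ _ : D.Repo, Set ℕ}
    (hIn : (trCQ (k := k) (N := N) j (stdVar _) (fun p _ => p) life Q).In Y K Cs)
    {ι : ∀ R : D.Repo, 𝔐.Idx R → 𝔐'.Idx R} (hs : SimVia Cs ι s s') {y : ∀ S, ℕ → 𝔐.Dom S}
    {e : ∀ E, 𝔐.Idx E} {R : D.Repo} (hR : ∀ R' t, p.tuple = some ⟨R', t⟩ → R' = R)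
    (h : (trCQ j (stdVar _) (fun p _ => p) life Q).Holds s y (fun E (_ : ℕ) => e E)) :
    ∃ (ρ₂ : PIso Cs 𝔐.toStruct 𝔐'.toStruct) (y' : ∀ S, ℕ → 𝔐'.Dom S),
      (trCQ j (stdVar _) (fun p _ => p) life Q).Holds s' y' (fun E (_ : ℕ) => ι E (e E)) ∧
      RowRel ρ₂.toCorr R (e R) (ι R (e R)) s s' ∧
      ∀ v : Σ S, NVar D S, v ∉ cqVars p.chi → (⟨some v.1, v.2⟩ : Σ _ : Option D.Ty, ℕ) ∈ Y →
        ρ₂.rel (y (some v.1) v.2) (y' (some v.1) v.2) := by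
  obtain ⟨ρ₀, h₀⟩ := hs.case j
  obtain ⟨ρ₁, hρ₁, y₁, hy₁⟩ := ρ₀.exists_extend_assignment hσ h𝔐.strict h𝔐' hY y
  obtain ⟨ρ₀', h₀'⟩ := hs.row R (e R)
  obtain ⟨ρ₂, hρ₂, y₂, hy₂⟩ := ρ₀'.exists_extend_assignment hσ h𝔐.strict h𝔐' hY y
  refine ⟨ρ₂, mix (cqVars p.chi) y₁ y₂, ?_, h₀'.mono hρ₂, fun v hv hvY => ?_⟩
  · refine trCQ_holds_of_separates hp hIn (h₀.mono hρ₁) hy₁ hy₂ (fun R' t ht c => ?_) h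
    obtain rfl := hR R' t ht
    exact (h₀'.mono hρ₂).row c
  · rw [mix_of_notMem hv]
    exact hy₂ _ hvY

theorem exists_step_of_tuple (hσ : (sig D k).Tame) (h𝔐 : 𝔐.toStruct.Rich Δ)
    (h𝔐' : 𝔐'.toStruct.Rich Δ) (hY : Y.Finite)
    (hlife : ∀ l, (⟨none, TConst.life l⟩ : Σ S, TConst D k S) ∈ Cs)
    (hτ : (trRule .multiset j r Q).In Y N₀ Cs) (hconds : r.conds = []) {p : Split D Empty}
    (hp : p.Separates Q) {R : D.Repo} {tup : ∀ a, QTerm D (NVar D) (D.repoAttr R a)}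
    (htup : p.tuple = some ⟨R, tup⟩)
    (heff : ∀ E, r.eff = some E →
      ∃ θ : SetPart D, E = .setOnly θ ∧ θ.IsTotal ∧ Disjoint (cqVars p.chi) θ.vars)
    (hs : Sim Cs s s') {t : State 𝔐} (ht : (trRule .multiset j r Q).Rel s t) :
    ∃ t', (trRule .multiset j r Q).Rel s' t' ∧ Sim Cs t t' := by
  obtain ⟨ι, hι, hs⟩ := hs
  obtain ⟨y, e, hg, rfl⟩ := Transition.rel_iff.1 ht
  obtain ⟨-, inQ, inEff⟩ := in_guard hτ.guard
  obtain ⟨g₁, -, g₃, g₄⟩ := holds_guard.1 hg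
  obtain ⟨q, hq⟩ := exists_tuple_row hp htup g₃
  have hconst := trCQ_holds_const hp (e₁ := fun E => e E q) inQ (fun R' t' h' => by
    obtain ⟨rfl, h⟩ := Sigma.mk.inj (Option.some.inj (htup.symm.trans h'))
    obtain rfl := eq_of_heq h
    exact hq) g₃
  obtain ⟨ρ₂, y', hQ', hrow, hy'⟩ := exists_holds_trCQ_of_separates (R := R) hσ h𝔐 h𝔐' hY hp inQ hs
    (fun R' t' h' => (Sigma.mk.inj (Option.some.inj (htup.symm.trans h'))).1.symm) hconst
  have hkeep : ∀ c, (trRule (k := k) .multiset j r Q).arr c = keepRow c.1 c.2 := by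
    intro c
    cases hr : r.eff with
    | none => exact arr_trRule_of_none hr c
    | some E =>
      obtain ⟨θ, rfl, -⟩ := heff E hr
      exact arr_trRule_of_some hr c
  refine ⟨_, Transition.rel_iff.2 ⟨y', _, holds_guard.2 ⟨fun p hp => ?_, by simp [hconds], hQ',
    fun E hE => ?_⟩, rfl⟩, ι, hι, fun i => ?_, fun R i => ?_⟩
  · obtain ⟨ρ, hc⟩ := hs.case j
    exact (ρ.eq_iff (hc.ctl j p.1) (ρ.cst _ (hlife p.2))).1 (g₁ p hp)
  · obtain ⟨θ, rfl, -⟩ := heff E hE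
    trivial
  · obtain ⟨ρ', h'⟩ := hs.case i
    by_cases hij : i = j
    · subst hij
      cases hr : r.eff with
      | none =>
        exact ⟨ρ', caseRel_post hlife hτ h'.toCommonRel (fun x _ => h'.data x) (by simp [hr])⟩
      | some E =>
        obtain ⟨θ, rfl, hθ, hd⟩ := heff E hr
        refine ⟨ρ₂, caseRel_post hlife hτ hrow.toCommonRel (fun x hx => ?_)
          fun x t hx v hv hvY => hy' v (fun hvc => ?_) hvY⟩
        · have := hθ x
          rw [hr] at hx
          simp only [Option.bind_some, effSet] at hx
          simp [hx] at this
        · rw [hr] at hx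
          exact Set.disjoint_left.1 hd hvc ⟨x, t, hx, hv⟩
    · exact ⟨ρ', caseRel_post_of_ne hlife hij h'⟩
  · obtain ⟨ρ', h'⟩ := hs.row R i
    exact ⟨ρ', rowRel_post_of_keep hlife (fun a => hkeep ⟨R, a⟩) h'⟩

theorem trQTerm_toQTerm {W : Option D.Ty → Type} {I : D.Repo → Type} {V : D.Ty → Type} (j : Fin k)
    (ν : ∀ S, V S → ATerm (setting D N k) W I (some S)) {S : D.Ty} (t : ETerm D V S) :
    trQTerm j ν t.toQTerm = trETerm ν t := by
  cases t <;> rfl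

theorem exists_step_of_delete (hσ : (sig D k).Tame) (h𝔐 : 𝔐.toStruct.Rich Δ)
    (h𝔐' : 𝔐'.toStruct.Rich Δ) (hY : Y.Finite)
    (hlife : ∀ l, (⟨none, TConst.life l⟩ : Σ S, TConst D k S) ∈ Cs)
    (hτ : (trRule .multiset j r Q).In Y N₀ Cs) (hconds : r.conds = []) {p : Split D Empty}
    (hp : p.Separates Q) {R : D.Repo} {u : RepoTuple D R} {θ : SetPart D}
    (heff : r.eff = some (.deleteSet R u θ)) (hθ : θ.IsTotal)
    (hd : Disjoint (cqVars p.chi) (u.vars ∪ θ.vars))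
    (htup : p.tuple = none ∨ p.tuple = some ⟨R, fun a => (u a).toQTerm⟩)
    (hs : Sim Cs s s') {t : State 𝔐} (ht : (trRule .multiset j r Q).Rel s t) :
    ∃ t', (trRule .multiset j r Q).Rel s' t' ∧ Sim Cs t t' := by
  obtain ⟨ι, hι, hs⟩ := hs
  obtain ⟨y, e, hg, rfl⟩ := Transition.rel_iff.1 ht
  obtain ⟨-, inQ, inEff⟩ := in_guard hτ.guard
  obtain ⟨g₁, -, g₃, g₄⟩ := holds_guard.1 hg
  have hdel := g₄ _ heff
  simp only [effGuard, holds_rowEq] at hdel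
  have htup' : ∀ R' t', p.tuple = some ⟨R', t'⟩ →
      (⟨R, fun a => (u a).toQTerm⟩ : Σ R, ∀ a, QTerm D (NVar D) (D.repoAttr R a)) = ⟨R', t'⟩ := by
    intro R' t' h'
    rcases htup with h | h
    · simp [h] at h'
    · exact Option.some.inj (h.symm.trans h')
  have hconst := trCQ_holds_const hp (e₁ := fun E => e E 0) inQ (fun R' t' h' => by
    obtain ⟨rfl, h⟩ := Sigma.mk.inj (htup' R' t' h')
    obtain rfl := eq_of_heq h
    intro a
    rw [hdel a, ← trQTerm_toQTerm j]) g₃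
  obtain ⟨ρ₂, y', hQ', hrow, hy'⟩ := exists_holds_trCQ_of_separates (R := R) hσ h𝔐 h𝔐' hY hp inQ hs
    (fun R' t' h' => (Sigma.mk.inj (htup' R' t' h')).1.symm) hconst
  have harr := fun R' a => arr_trRule_of_some (k := k) (sem := .multiset) (j := j) (Q := Q) heff
    ⟨R', a⟩
  refine ⟨_, Transition.rel_iff.2 ⟨y', _, holds_guard.2 ⟨fun p hp => ?_, by simp [hconds], hQ',
    fun E hE => ?_⟩, rfl⟩, ι, hι, fun i => ?_, fun R' i => ?_⟩
  · obtain ⟨ρ, hc⟩ := hs.case j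
    exact (ρ.eq_iff (hc.ctl j p.1) (ρ.cst _ (hlife p.2))).1 (g₁ p hp)
  · obtain rfl := Option.some.inj (heff.symm.trans hE)
    have hIn := inEff _ heff
    simp only [effGuard, rowEq, QF.in_conj, List.forall_mem_ofFn_iff] at hIn
    simp only [effGuard, holds_rowEq]
    refine fun a => (ρ₂.eq_iff (hrow.row a) (rel_trETerm (u a) (hIn a).2
      (varRel_stdVar fun v hv hvY => hy' v (fun hvc => ?_) hvY))).1 (hdel a)
    exact Set.disjoint_left.1 hd hvc (Or.inl (Set.mem_iUnion.2 ⟨a, hv⟩))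
  · obtain ⟨ρ', h'⟩ := hs.case i
    by_cases hij : i = j
    · subst hij
      refine ⟨ρ₂, caseRel_post hlife hτ hrow.toCommonRel (fun x hx => ?_)
        fun x t hx v hv hvY => hy' v (fun hvc => ?_) hvY⟩
      · have := hθ x
        rw [heff] at hx
        simp only [Option.bind_some, effSet] at hx
        simp [hx] at this
      · rw [heff] at hx
        exact Set.disjoint_left.1 hd hvc (Or.inr ⟨x, t, hx, hv⟩)
    · exact ⟨ρ', caseRel_post_of_ne hlife hij h'⟩
  · obtain ⟨ρ', h'⟩ := hs.row R' i
    have harr := harr R'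
    by_cases hR : R' = R
    · subst hR
      simp only [effRows, Function.update_self] at harr
      exact ⟨ρ', rowRel_post_of_ite hlife harr h'.toCommonRel (hι R').eq_iff.symm
        (fun _ a => ρ'.undef (some (D.repoAttr R' a))) fun _ => h'⟩
    · simp only [effRows, Function.update_of_ne hR] at harr
      exact ⟨ρ', rowRel_post_of_keep hlife harr h'⟩

end Steps

/-! ## The rules of a process -/

theorem Block.ownRules_cases {D : DataSchema} {N : Type} {P B : Block D N} (hB : B.LocallyWF)
    {r : Rule D N} (hr : r ∈ Block.ownRules P B) :
    (r.pre = none ∧ ∀ E, r.eff = some E → ∃ θ, E = .setOnly θ) ∨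
    (r.conds = [] ∧ ∃ u ∈ B.ownSpecs, r.pre = some u.pre ∧
      ((r.eff = none ∧ ∃ θ, u.eff = .setOnly θ) ∨ r.eff = some u.eff)) := by
  have key : (∀ r ∈ Block.ownRules P B, r.pre = none ∧ r.eff = none) →
      (r.pre = none ∧ ∀ E, r.eff = some E → ∃ θ, E = .setOnly θ) := fun h =>
    ⟨(h r hr).1, fun E hE => by simp [(h r hr).2] at hE⟩
  cases B with
  | task n atomic u =>
    cases atomic with
    | true =>
      simp only [Block.ownRules, List.mem_singleton] at hr
      subst hr
      exact Or.inr ⟨rfl, u, by simp [Block.ownSpecs], rfl, Or.inr rfl⟩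
    | false =>
      obtain ⟨θ, hθ⟩ := hB
      simp only [Block.ownRules, List.mem_cons, List.not_mem_nil, or_false] at hr
      rcases hr with rfl | rfl
      · exact Or.inr ⟨rfl, u, by simp [Block.ownSpecs], rfl, Or.inl ⟨rfl, θ, hθ⟩⟩
      · exact Or.inl ⟨rfl, fun E hE => ⟨θ, (Option.some.inj hE).symm.trans hθ⟩⟩
  | event n u =>
    simp only [Block.ownRules, List.mem_singleton] at hr
    subst hr
    exact Or.inr ⟨rfl, u, by simp [Block.ownSpecs], rfl, Or.inr rfl⟩
  | proc n u v B =>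
    simp only [Block.ownRules, List.mem_cons, List.not_mem_nil, or_false] at hr
    rcases hr with rfl | rfl
    · exact Or.inr ⟨rfl, u, by simp [Block.ownSpecs], rfl, Or.inr rfl⟩
    · exact Or.inr ⟨rfl, v, by simp [Block.ownSpecs], rfl, Or.inr rfl⟩
  | possibleCompletion n B φ ev =>
    refine Or.inl (key ?_)
    cases ev <;> simp +contextual [Block.ownRules, or_imp, forall_and]
    all_goals constructor <;> (intros; subst_vars; rfl)
  | empty | subproc | seq | deferredChoice | parallel | exclChoice | inclChoice | loop
    | eventChoice =>
    exact Or.inl (key (by simp [Block.ownRules]))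
  | backExc | forExc | nonInterr =>
    exact Or.inl (key (by simp [Block.ownRules, interruptRules]))

theorem Model.rules_cases (M : Model) {r : Rule M.schema M.Name} (hr : r ∈ M.root.rules) :
    (r.pre = none ∧ ∀ E, r.eff = some E → ∃ θ, E = .setOnly θ) ∨
    (r.conds = [] ∧ ∃ u ∈ M.specs, r.pre = some u.pre ∧
      ((r.eff = none ∧ ∃ θ, u.eff = .setOnly θ) ∨ r.eff = some u.eff)) := by
  rcases List.mem_cons.1 hr with rfl | hr
  · exact Or.inl ⟨rfl, by simp⟩
  · obtain ⟨_, hl, hr⟩ := List.mem_flatten.1 hr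
    obtain ⟨B, hB, rfl⟩ := List.mem_map.1 hl
    refine (Block.ownRules_cases (M.wf B hB) hr).imp_right fun ⟨hc, u, hu, h⟩ =>
      ⟨hc, u, ⟨B, hB, hu⟩, h⟩

/-! ## Properties -/

section Properties

variable {D : DataSchema} {N : Type} {k : ℕ} {C : Type} {j : Fin k} {life : C → CtlVar N}
  {Q : CQ D (NVar D) C}

theorem QTerm.eq_var_of_mem_vars {V : D.Ty → Type} {S : D.Ty} {t : QTerm D V S} {v : Σ S, V S}
    (h : v ∈ t.vars) : ∃ w, v = ⟨S, w⟩ ∧ t = .var w := by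
  cases t with
  | var w => exact ⟨w, h, rfl⟩
  | cvar | self | obj => exact h.elim

/-- A query whose variables are all retrieved from the repository is expressed by a state
formula. -/
theorem expressible_trCQ (T : Set (Formula (sig D k)))
    (hpos : ∀ l ∈ Q, l.atom.IsRepo → l.positive = true)
    (hrange : ∀ v ∈ cqVars Q, ∃ l ∈ Q, l.atom.IsRepo ∧ v ∈ l.atom.vars) :
    Expressible (A := setting D N k) T fun 𝔐 s => ∃ (y : ∀ S, ℕ → 𝔐.Dom S)
      (e : ∀ E, ℕ → 𝔐.Idx E), (trCQ j (stdVar _) (fun p _ => p) life Q).Holds s y e := by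
  have hread : ∀ S (n : ℕ), ∃ ν : ATerm (setting D N k) (fun _ => Empty) (fun _ => ℕ) (some S),
      (⟨S, n⟩ : Σ S, NVar D S) ∈ cqVars Q → ∀ (𝔐 : ExtStruct (setting D N k)) (s : State 𝔐)
        (y : ∀ S, ℕ → 𝔐.Dom S) (e : ∀ E, ℕ → 𝔐.Idx E),
        (trCQ j (stdVar _) (fun p _ => p) life Q).Holds s y e →
          ν.eval 𝔐.toStruct (Cell.eval s (fun _ v => v.elim) e) = y (some S) n := by
    intro S n
    by_cases hv : (⟨S, n⟩ : Σ S, NVar D S) ∈ cqVars Q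
    · obtain ⟨l, hl, hrepo, hvl⟩ := hrange _ hv
      have hl' := hpos l hl hrepo
      obtain ⟨p, hp, rfl⟩ := List.getElem_of_mem hl
      cases ha : Q[p].atom with
      | repo R args =>
        rw [ha] at hvl
        obtain ⟨a, hva⟩ := Set.mem_iUnion.1 hvl
        obtain ⟨w, hw, hargs⟩ := QTerm.eq_var_of_mem_vars hva
        cases hw
        refine ⟨readTerm R a (p + 1), fun _ 𝔐 s y e h => ?_⟩
        have := (holds_trCQ.1 h p hp).2 hl'
        rw [ha] at this
        simp only [trAtom, holds_rowEq] at this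
        refine (this a).trans ?_
        rw [hargs]
        rfl
      | _ => rw [ha] at hrepo; exact hrepo.elim
    · exact ⟨undefTerm S, fun h => absurd h hv⟩
  choose ν hν using hread
  have key : ∀ (𝔐 : ExtStruct (setting D N k)) (s : State 𝔐) (y : ∀ S, ℕ → 𝔐.Dom S)
      (e : ∀ E, ℕ → 𝔐.Idx E), (∀ v ∈ cqVars Q,
        (ν v.1 v.2).eval 𝔐.toStruct (Cell.eval s (fun _ v => v.elim) e) = y (some v.1) v.2) →
      ((trCQ j ν (fun p _ => p) life Q).Holds s (fun _ v => v.elim) e ↔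
        (trCQ j (stdVar _) (fun p _ => p) life Q).Holds s y e) := by
    intro 𝔐 s y e h
    refine trCQ_holds_iff fun p hp => trAtom_holds_iff (ρ := Corr.refl Set.univ 𝔐.toStruct)
      _ (QF.in_univ _) (fun v hv _ => h v ⟨_, List.getElem_mem hp, hv⟩)
      (Or.inr (CaseRel.refl _ s)) fun _ _ _ _ => rfl
  refine ⟨trCQ j ν (fun p _ => p) life Q, fun 𝔐 _ s => ⟨?_, ?_⟩⟩
  · rintro ⟨e, he⟩
    let y : ∀ S : Option D.Ty, ℕ → 𝔐.Dom S
      | none, _ => 𝔐.cst (S := (none : Option D.Ty)) TConst.lifeUndef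
      | some S, n => (ν S n).eval 𝔐.toStruct (Cell.eval s (fun _ v => v.elim) e)
    exact ⟨y, e, (key 𝔐 s y e fun v _ => rfl).1 he⟩
  · rintro ⟨y, e, h⟩
    exact ⟨e, (key 𝔐 s y e fun v hv => hν v.1 v.2 hv 𝔐 s y e h).2 h⟩

theorem Split.Separates.positive {p : Split D C} (hp : p.Separates Q) {l : Literal D (NVar D) C}
    (hl : l ∈ Q) (hrepo : l.atom.IsRepo) : l.positive = true := by
  rcases hp.mem_cases hl with hl | hl | hl
  · exact (hp.chi_repoFree l hl hrepo).elim
  · obtain ⟨R, t, -, rfl⟩ := Split.mem_tupleLits hl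
    rfl
  · exact (hp.xi_repoFree l hl hrepo).elim

theorem Property.expressible {M : Model} {P : Property M} (hP : P.Separated) (k : ℕ)
    (T : Set (Formula (sig M.schema k))) : Expressible T (P.toStateSet k) := by
  have hQ : ∀ (j : Fin k) i, ∀ Q ∈ (P.guard i).body,
      Expressible (A := setting M.schema M.Name k) T fun 𝔐 s => ∃ (y : ∀ S, ℕ → 𝔐.Dom S)
        (e : ∀ E, ℕ → 𝔐.Idx E), (trCQ j (stdVar _) (fun p _ => p) CtlVar.life Q).Holds s y e := by
    intro j i Q hQ
    obtain ⟨hdis, hsep⟩ := hP i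
    obtain ⟨p, hp⟩ := hsep Q hQ
    refine expressible_trCQ T (fun l hl => hp.positive hl) fun v hv => ?_
    obtain ⟨Q', hQ', l, hl, hrepo, hvl⟩ := P.range i v ⟨Q, hQ, hv⟩
    have : Std.Symm fun Q Q' : CQ M.schema (NVar M.schema) M.Name =>
      Disjoint (cqVars Q) (cqVars Q') := ⟨fun _ _ h => h.symm⟩
    have : Q' = Q := by
      by_contra hne
      exact Set.disjoint_left.1 (hdis.forall hQ' hQ hne) ⟨l, hl, hvl⟩ hv
    subst this
    exact ⟨l, hl, hrepo, hvl⟩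
  refine (Expressible.exists_mem (Finset.univ : Finset (Fin P.n ↪ Fin k)).toList fun f _ =>
    Expressible.forall_mem (List.finRange P.n) fun i =>
      Expressible.exists_mem (P.guard i).body (hQ (f i) i)).congr fun 𝔐 _ s => ?_
  simp [Property.toStateSet]

variable {Cs : Set (Σ S, (sig D k).Cst S)} {Δ : ∀ S, TConst D k S → TConst D k S → Prop}
  {𝔐 𝔐' : ExtStruct (setting D N k)} {s : State 𝔐} {s' : State 𝔐'}
  {Y : Set (Σ _ : Option D.Ty, ℕ)}

theorem Sim.exists_holds_trCQ (hσ : (sig D k).Tame) (h𝔐 : 𝔐.toStruct.Rich Δ)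
    (h𝔐' : 𝔐'.toStruct.Rich Δ) (hY : Y.Finite) {p : Split D C} (hp : p.Separates Q)
    {K : ∀ _ : D.Repo, Set ℕ}
    (hIn : (trCQ (k := k) (N := N) j (stdVar _) (fun p _ => p) life Q).In Y K Cs)
    (hs : Sim Cs s s') {y : ∀ S, ℕ → 𝔐.Dom S} {e : ∀ E, ℕ → 𝔐.Idx E}
    (h : (trCQ j (stdVar _) (fun p _ => p) life Q).Holds s y e) :
    ∃ (y' : ∀ S, ℕ → 𝔐'.Dom S) (e' : ∀ E, ℕ → 𝔐'.Idx E),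
      (trCQ j (stdVar _) (fun p _ => p) life Q).Holds s' y' e' := by
  obtain ⟨ι, hι, hs⟩ := hs
  cases htup : p.tuple with
  | none =>
    obtain ⟨ρ₀, h₀⟩ := hs.case j
    obtain ⟨ρ, hρ, y', hy⟩ := ρ₀.exists_extend_assignment hσ h𝔐.strict h𝔐' hY y
    exact ⟨y', fun E n => ι E (e E n), (trCQ_holds_iff_of_repoFree (hp.repoFree htup) hIn
      (varRel_stdVar fun v _ hv => hy _ hv) (Or.inr (h₀.mono hρ))).1 h⟩
  | some t =>
    obtain ⟨q, hq⟩ := exists_tuple_row hp htup h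
    have hconst := trCQ_holds_const hp (e₁ := fun E => e E q) hIn (fun R' t' h' => by
      obtain rfl := Option.some.inj (htup.symm.trans h')
      exact hq) h
    obtain ⟨-, y', hQ', -⟩ := exists_holds_trCQ_of_separates (R := t.1) hσ h𝔐 h𝔐' hY hp hIn hs
      (fun R' t' h' => congrArg Sigma.fst (Option.some.inj (h'.symm.trans htup))) hconst
    exact ⟨y', _, hQ'⟩

end Properties

/-! ## Termination -/

section Termination

variable {M : Model} {k : ℕ} {Cs : Set (Σ S, (sig M.schema k).Cst S)}
  {Δ : ∀ S, TConst M.schema k S → TConst M.schema k S → Prop}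

theorem Model.exists_step (hspecs : ∀ u ∈ M.specs, u.Restricted)
    {𝔐 𝔐' : ExtStruct (setting M.schema M.Name k)} {s : State 𝔐} {s' : State 𝔐'}
    {Y : Set (Σ _ : Option M.schema.Ty, ℕ)} {N₀ : ℕ} {j : Fin k} {r : Rule M.schema M.Name}
    {Q : CQ M.schema (NVar M.schema) Empty} (hσ : (sig M.schema k).Tame)
    (h𝔐 : 𝔐.toStruct.Rich Δ) (h𝔐' : 𝔐'.toStruct.Rich Δ) (hY : Y.Finite)
    (hlife : ∀ l, (⟨none, TConst.life l⟩ : Σ S, TConst M.schema k S) ∈ Cs)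
    (hτ : (trRule .multiset j r Q).In Y N₀ Cs) (hr : r ∈ M.root.rules) (hQ : Q ∈ r.disjuncts)
    (hs : Sim Cs s s') {t : State 𝔐} (ht : (trRule .multiset j r Q).Rel s t) :
    ∃ t', (trRule .multiset j r Q).Rel s' t' ∧ Sim Cs t t' := by
  rcases M.rules_cases hr with ⟨hpre, heff⟩ | ⟨hconds, u, hu, hpre, heff⟩
  · obtain rfl : Q = [] := by simpa [Rule.disjuncts, hpre] using hQ
    refine exists_step_of_repoFree hσ h𝔐 h𝔐' hY hlife hτ (by simp [cqRepoFree])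
      (fun E hE => ?_) hs ht
    obtain ⟨θ, rfl⟩ := heff E hE
    trivial
  · replace hQ : Q ∈ u.pre.body := by simpa [Rule.disjuncts, hpre] using hQ
    have hE : ∀ E, r.eff = some E → E = u.eff := by
      rintro E hE
      rcases heff with ⟨h, -⟩ | h
      · simp [h] at hE
      · exact Option.some.inj (hE.symm.trans h)
    have hfree : cqRepoFree Q → u.eff.RowLocal →
        ∃ t', (trRule .multiset j r Q).Rel s' t' ∧ Sim Cs t t' := fun hQ hu =>
      exists_step_of_repoFree hσ h𝔐 h𝔐' hY hlife hτ hQ (fun E h => hE E h ▸ hu) hs ht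
    have hres := hspecs u hu
    unfold UpdateSpec.Restricted at hres
    cases hu' : u.eff with
    | insertSet R t θ =>
      simp only [hu'] at hres
      exact hfree (hres Q hQ) (by simp [hu', Effect.RowLocal])
    | update R ψ b₁ b₂ =>
      simp only [hu'] at hres
      have hfil := u.filters
      rw [hu'] at hfil
      refine hfree (hres.1 Q hQ) ?_
      rw [hu']
      exact ⟨hres.2.2.2, hfil, fun S n h => hres.2.2.1 ⟨S, n⟩ h⟩
    | setOnly θ =>
      simp only [hu'] at hres
      rcases hres with hres | ⟨-, hθ, hiso⟩
      · exact hfree (hres Q hQ) (by simp [hu', Effect.RowLocal])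
      · obtain ⟨p, hp, hd, -⟩ := hiso Q hQ
        cases htup : p.tuple with
        | none => exact hfree (hp.repoFree htup) (by simp [hu', Effect.RowLocal])
        | some tup =>
          rw [hu'] at hd
          exact exists_step_of_tuple hσ h𝔐 h𝔐' hY hlife hτ hconds hp htup
            (fun E h => ⟨θ, (hE E h).trans hu', hθ, hd⟩) hs ht
    | deleteSet R t θ =>
      simp only [hu'] at hres
      obtain ⟨-, hθ, hiso⟩ := hres
      obtain ⟨p, hp, hd, htup⟩ := hiso Q hQ
      simp only [hu'] at hd htup
      refine exists_step_of_delete hσ h𝔐 h𝔐' hY hlife hτ hconds hp (R := R) (u := t) (θ := θ) ?_ hθ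
        hd htup hs ht
      rcases heff with ⟨-, θ', h⟩ | h
      · simp [hu'] at h
      · rw [h, hu']

instance : Finite LState :=
  Finite.of_surjective
    (![.idle, .enabled, .active, .waiting, .waiting1, .waiting2, .completed, .error] :
      Fin 8 → LState) (by
    rintro (_ | _ | _ | _ | _ | _ | _ | _)
    exacts [⟨0, rfl⟩, ⟨1, rfl⟩, ⟨2, rfl⟩, ⟨3, rfl⟩, ⟨4, rfl⟩, ⟨5, rfl⟩, ⟨6, rfl⟩, ⟨7, rfl⟩])

/-- Finitely many constants occur in the transitions and in a property. -/
theorem Model.exists_constants (M : Model) (k : ℕ)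
    (Δ : ∀ S, TConst M.schema k S → TConst M.schema k S → Prop) (P : Property M) :
    ∃ Cs : Set (Σ S, (sig M.schema k).Cst S), Cs.Finite ∧
      (∀ l, (⟨none, TConst.life l⟩ : Σ S, TConst M.schema k S) ∈ Cs) ∧
      (∀ τ ∈ (M.toSystem .multiset k Δ).trans, ∃ Y : Set (Σ _ : Option M.schema.Ty, ℕ),
        Y.Finite ∧ ∃ N₀, τ.In Y N₀ Cs) ∧
      ∀ (j : Fin k) i, ∀ Q ∈ (P.guard i).body, ∃ Y : Set (Σ _ : Option M.schema.Ty, ℕ),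
        Y.Finite ∧ ∃ N₀, (trCQ (k := k) (N := M.Name) j (stdVar _) (fun p _ => p)
          CtlVar.life Q).In Y (below natSize N₀) Cs := by
  have := M.finite_name
  have := M.schema.repo_finite
  have : Finite (setting M.schema M.Name k).AVar :=
    inferInstanceAs (Finite (Fin k × Slot M.schema M.Name))
  have : Finite (setting M.schema M.Name k).Comp :=
    inferInstanceAs (Finite (Σ R : M.schema.Repo, Fin (M.schema.repoArity R)))
  choose Y₁ hY₁ N₁ C₁ hC₁ h₁ using fun τ : Transition (setting M.schema M.Name k) => τ.exists_in
  choose Y₂ hY₂ N₂ C₂ hC₂ h₂ using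
    fun φ : QF (setting M.schema M.Name k) (fun _ => ℕ) (fun _ => ℕ) => φ.exists_in natSize
  let L : Set (Σ S, (sig M.schema k).Cst S) :=
    Set.range fun l : LState => (⟨none, TConst.life l⟩ : Σ S, TConst M.schema k S)
  let B₁ : Set (Σ S, (sig M.schema k).Cst S) :=
    ⋃ τ ∈ {τ | τ ∈ (M.toSystem .multiset k Δ).trans}, C₁ τ
  let B₂ : Set (Σ S, (sig M.schema k).Cst S) := ⋃ (j : Fin k), ⋃ (i : Fin P.n),
    ⋃ Q ∈ {Q | Q ∈ (P.guard i).body}, C₂ (trCQ j (stdVar _) (fun p _ => p) CtlVar.life Q)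
  refine ⟨L ∪ B₁ ∪ B₂, ?_, fun l => Or.inl (Or.inl ⟨l, rfl⟩), fun τ hτ => ?_, fun j i Q hQ => ?_⟩
  · exact ((Set.finite_range _).union ((List.finite_toSet _).biUnion fun τ _ => hC₁ τ)).union
      (Set.finite_iUnion fun j => Set.finite_iUnion fun i =>
        (List.finite_toSet _).biUnion fun Q _ => hC₂ _)
  · refine ⟨Y₁ τ, hY₁ τ, N₁ τ, (h₁ τ).mono subset_rfl le_rfl fun c hc => Or.inl (Or.inr ?_)⟩
    exact Set.mem_biUnion (show τ ∈ {τ | τ ∈ (M.toSystem .multiset k Δ).trans} from hτ) hc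
  · refine ⟨Y₂ _, hY₂ _, N₂ _, (h₂ _).mono subset_rfl (fun _ => subset_rfl) fun c hc => Or.inr ?_⟩
    exact Set.mem_iUnion₂.2 ⟨j, i, Set.mem_biUnion (show Q ∈ {Q | Q ∈ (P.guard i).body} from hQ) hc⟩

end Termination

end DAB

end

/-- Let `M` be an acyclic DAB, run with at most `k` cases under the multiset insertion semantics,
all of whose update specifications are restricted. Then `BackReach` terminates on separated
properties. `Δ` lists the pairs of constants assumed distinct by the database theory. -/
theorem backReach_terminates_case_bounded_restricted (M : DAB.Model) (k : ℕ)
    (Δ : ∀ S, DAB.TConst M.schema k S → DAB.TConst M.schema k S → Prop)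
    (hacyclic : M.Acyclic)
    (hspecs : ∀ u ∈ M.specs, u.Restricted)
    (P : DAB.Property M) (hP : P.Separated) :
    DAB.BackReachTerminates M DAB.InsertSem.multiset k Δ P := by
  have := M.finite_name
  have := M.schema.repo_finite
  have hAVar : Finite (M.toSystem .multiset k Δ).setting.AVar :=
    inferInstanceAs (Finite (Fin k × DAB.Slot M.schema M.Name))
  have hComp : Finite (M.toSystem .multiset k Δ).setting.Comp :=
    inferInstanceAs (Finite (Σ R : M.schema.Repo, Fin (M.schema.repoArity R)))
  have hASort : Finite (M.toSystem .multiset k Δ).setting.ASort := M.schema.repo_finite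
  have hσ := hacyclic.tame k
  obtain ⟨Cs, hC, hlife, htrans, hprop⟩ := M.exists_constants k Δ P
  refine RAS.System.terminates_of_simulation (𝒮 := M.toSystem .multiset k Δ) (Δ := Δ) hσ rfl
    (DAB.Property.expressible hP k _) (fun {𝔐 𝔐'} s s' => DAB.Sim Cs s s')
    (fun ω hrich hfin => DAB.exists_sim_of_sequence hσ hC ω (fun n => (hrich n).strict) hfin) ?_ ?_
  · intro 𝔐 𝔐' h𝔐 h𝔐' s s' hs τ hτ t ht
    obtain ⟨Y, hY, N₀, hIn⟩ := htrans τ hτ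
    obtain ⟨j, -, hτ⟩ := List.mem_flatMap.1 hτ
    obtain ⟨r, hr, hτ⟩ := List.mem_flatMap.1 hτ
    obtain ⟨Q, hQ, rfl⟩ := List.mem_map.1 hτ
    exact DAB.Model.exists_step hspecs hσ h𝔐 h𝔐' hY hlife hIn hr hQ hs ht
  · rintro 𝔐 𝔐' h𝔐 h𝔐' s s' hs ⟨f, hf⟩
    refine ⟨f, fun i => ?_⟩
    obtain ⟨Q, hQ, y, e, h⟩ := hf i
    obtain ⟨p, hp⟩ := (hP i).2 Q hQ
    obtain ⟨Y, hY, N₀, hIn⟩ := hprop (f i) i Q hQ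
    exact ⟨Q, hQ, hs.exists_holds_trCQ hσ h𝔐 h𝔐' hY hp hIn h⟩
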